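/- Every group of F-type is subgroup separable (LERF): for every finitely generated subgroup K of a group G of F-type and every element g ∈ G with g ∉ K, there exists a subgroup K* of finite index in G with K ⊆ K* and g ∉ K*. -/

import Mathlib

open scoped MatrixGroups

namespace FPaper

/-- A (reduced) word in a free group is *cyclically reduced* if its first letter is not the
formal inverse of its last letter. -/
def CyclicallyReduced {α : Type*} [DecidableEq α] (w : FreeGroup α) : Prop :=
  ∀ x y : α × Bool, w.toWord.head? = some x → w.toWord.getLast? = some y →
    x.1 = y.1 → x.2 = y.2

/-- The combinatorial data of a presentation of F-type:
`⟨a_1, …, a_n ∣ a_1^{e_1} = ⋯ = a_n^{e_n} = U V = 1⟩` with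
`U = U(a_1, …, a_p)` and `V = V(a_{p+1}, …, a_n)`. -/
structure FTypeBase where
  n : ℕ
  e : Fin n → ℕ
  p : ℕ
  U : FreeGroup (Fin n)
  V : FreeGroup (Fin n)

namespace FTypeBase

/-- Relators of the full F-type presentation. -/
def rels (D : FTypeBase) : Set (FreeGroup (Fin D.n)) :=
  {w | ∃ i : Fin D.n, w = FreeGroup.of i ^ D.e i} ∪ {D.U * D.V}

/-- Relators presenting the first factor `G₁` (the generators `a_{p+1}, …, a_n` are killed), so
that `PresentedGroup D.rels1` is the free product of cyclics on `a_1, …, a_p`. -/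
def rels1 (D : FTypeBase) : Set (FreeGroup (Fin D.n)) :=
  {w | ∃ i : Fin D.n, (i : ℕ) < D.p ∧ w = FreeGroup.of i ^ D.e i} ∪
    {w | ∃ i : Fin D.n, D.p ≤ (i : ℕ) ∧ w = FreeGroup.of i}

/-- Relators presenting the second factor `G₂` (the generators `a_1, …, a_p` are killed), so
that `PresentedGroup D.rels2` is the free product of cyclics on `a_{p+1}, …, a_n`. -/
def rels2 (D : FTypeBase) : Set (FreeGroup (Fin D.n)) :=
  {w | ∃ i : Fin D.n, D.p ≤ (i : ℕ) ∧ w = FreeGroup.of i ^ D.e i} ∪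
    {w | ∃ i : Fin D.n, (i : ℕ) < D.p ∧ w = FreeGroup.of i}

/-- The group presented by the F-type presentation. -/
abbrev Gp (D : FTypeBase) := PresentedGroup D.rels

/-- The first factor `G₁ = ⟨a_1, …, a_p ∣ a_1^{e_1} = ⋯ = a_p^{e_p} = 1⟩`. -/
abbrev Gp1 (D : FTypeBase) := PresentedGroup D.rels1

/-- The second factor `G₂ = ⟨a_{p+1}, …, a_n ∣ a_{p+1}^{e_{p+1}} = ⋯ = a_n^{e_n} = 1⟩`. -/
abbrev Gp2 (D : FTypeBase) := PresentedGroup D.rels2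

/-- The image of the word `U` in the first factor `G₁`. -/
def imgU1 (D : FTypeBase) : D.Gp1 := PresentedGroup.mk D.rels1 D.U

/-- The image of the word `V` in the second factor `G₂`. -/
def imgV2 (D : FTypeBase) : D.Gp2 := PresentedGroup.mk D.rels2 D.V

/-- The conditions making an F-type presentation: `n ≥ 2`; each `e_i` is `0` or `≥ 2`;
`1 ≤ p ≤ n - 1`; `U` is a cyclically reduced word in `a_1, …, a_p` of infinite order in `G₁`;
`V` is a cyclically reduced word in `a_{p+1}, …, a_n` of infinite order in `G₂`; and if
`p = 1` (resp. `p = n - 1`) then `U = a_1^m` (resp. `V = a_n^m`) for some `m ≥ 2`. -/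
def IsFType (D : FTypeBase) : Prop :=
  2 ≤ D.n ∧ (∀ i, D.e i = 0 ∨ 2 ≤ D.e i) ∧ 1 ≤ D.p ∧ D.p ≤ D.n - 1 ∧
  (∀ x ∈ D.U.toWord, (x.1 : ℕ) < D.p) ∧ (∀ x ∈ D.V.toWord, D.p ≤ (x.1 : ℕ)) ∧
  CyclicallyReduced D.U ∧ CyclicallyReduced D.V ∧
  ¬ IsOfFinOrder D.imgU1 ∧ ¬ IsOfFinOrder D.imgV2 ∧
  (D.p = 1 → ∃ (i : Fin D.n) (m : ℕ), (i : ℕ) = 0 ∧ 2 ≤ m ∧ D.U = FreeGroup.of i ^ m) ∧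
  (D.p = D.n - 1 → ∃ (i : Fin D.n) (m : ℕ), (i : ℕ) = D.n - 1 ∧ 2 ≤ m ∧ D.V = FreeGroup.of i ^ m)

/-- The subgroup of the F-type group generated by (the images of) `a_1, …, a_p`. -/
def factor1 (D : FTypeBase) : Subgroup D.Gp :=
  Subgroup.closure {g | ∃ i : Fin D.n, (i : ℕ) < D.p ∧ g = PresentedGroup.of i}

/-- The subgroup of the F-type group generated by (the images of) `a_{p+1}, …, a_n`. -/
def factor2 (D : FTypeBase) : Subgroup D.Gp :=
  Subgroup.closure {g | ∃ i : Fin D.n, D.p ≤ (i : ℕ) ∧ g = PresentedGroup.of i}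

/-- The amalgamated subgroup `A = ⟨U⟩ = ⟨V⟩` of the F-type group. -/
def amalg (D : FTypeBase) : Subgroup D.Gp :=
  Subgroup.zpowers (PresentedGroup.mk D.rels D.U)

end FTypeBase

/-- A group is *of F-type* if it is isomorphic to the group of some F-type presentation. -/
def IsFTypeGroup (G : Type*) [Group G] : Prop :=
  ∃ D : FTypeBase, D.IsFType ∧ Nonempty (G ≃* D.Gp)

/-- An element of a group is a *proper power* if it equals `h ^ k` for some `k ≥ 2`. -/
def IsProperPower {G : Type*} [Group G] (g : G) : Prop :=
  ∃ (h : G) (k : ℕ), 2 ≤ k ∧ g = h ^ k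

/-- A group is a *free product of cyclic groups* if it has a presentation in which every
relator is a power of a generator. -/
def IsFreeProductOfCyclics (H : Type*) [Group H] : Prop :=
  ∃ (ι : Type) (e : ι → ℕ),
    Nonempty (H ≃* PresentedGroup {w : FreeGroup ι | ∃ i : ι, w = FreeGroup.of i ^ e i})

/-- A subgroup `K` of `H` is *malnormal* if `g K g⁻¹ ∩ K = {1}` for every `g ∉ K`. -/
def IsMalnormal {H : Type*} [Group H] (K : Subgroup H) : Prop :=
  ∀ g : H, g ∉ K → ∀ x ∈ K, g * x * g⁻¹ ∈ K → x = 1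

end FPaper

namespace FPaper

/-- A partial coloured system: points with colours in `P` and, for each `i : κ`, a labelling whose
fibres are the (partial) orbits of the `i`-th generator. -/
structure PSys (κ P : Type) where
  T : Type
  Lab : Type
  c : T → P
  r : κ → T → Lab
  inj : ∀ i x y, r i x = r i y → c x = c y → x = y

namespace PSys

variable {κ P : Type} [AddCommGroup P]

/-- `y` is reached from `x` inside the orbit of the generator `l.1`, with colour change `l.2`. -/
def Step (Q : PSys κ P) (l : κ × P) (x y : Q.T) : Prop :=
  Q.r l.1 x = Q.r l.1 y ∧ Q.c y = Q.c x + l.2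

/-- `q` follows the labels `lam` on the integer interval from `a` to `b`. -/
def IsPath (Q : PSys κ P) (lam : ℤ → κ × P) (q : ℤ → Q.T) (a b : ℤ) : Prop :=
  ∀ t, a ≤ t → t < b → Q.Step (lam t) (q t) (q (t + 1))

/-- The inverse label. -/
def inv (l : κ × P) : κ × P := (l.1, -l.2)

/-- The label sequence read backwards. -/
def rev (lam : ℤ → κ × P) : ℤ → κ × P := fun t => inv (lam (-t - 1))

/-- A cyclically reduced label sequence of period `L`. -/
structure Good (lam : ℤ → κ × P) (L : ℤ) : Prop where
  pos : 0 < L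
  per : ∀ t, lam (t + L) = lam t
  adj : ∀ t, (lam (t + 1)).1 ≠ (lam t).1
  ne : ∀ t, (lam t).2 ≠ 0

theorem inv_inv (l : κ × P) : inv (inv l) = l := by simp [inv]

theorem rev_rev (lam : ℤ → κ × P) : rev (rev lam) = lam := by
  funext t
  simp only [rev, inv_inv]
  congr 1; ring

theorem Good.rev {lam : ℤ → κ × P} {L : ℤ} (h : Good lam L) : Good (rev lam) L where
  pos := h.pos
  per t := by
    simp only [PSys.rev]
    rw [← h.per (-(t + L) - 1)]
    congr 2; ring
  adj t := by
    simp only [PSys.rev, inv]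
    have := h.adj (-(t + 1) - 1)
    rw [show -(t + 1) - 1 + 1 = -t - 1 by ring] at this
    exact this.symm
  ne t := by
    simp only [PSys.rev, inv]
    exact neg_ne_zero.mpr (h.ne _)

theorem per_mul {β : Type*} {f : ℤ → β} {L : ℤ} (h : ∀ t, f (t + L) = f t) (t k : ℤ) :
    f (t + k * L) = f t := by
  induction k using Int.induction_on with
  | zero => simp
  | succ i ih => rw [← ih, ← h (t + i * L)]; congr 1; ring
  | pred i ih => rw [← ih, ← h (t + (-(i : ℤ) - 1) * L)]; congr 1; ring

theorem per_dvd {β : Type*} {f : ℤ → β} {L : ℤ} (h : ∀ t, f (t + L) = f t) {t u : ℤ}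
    (hd : L ∣ u - t) : f u = f t := by
  obtain ⟨k, hk⟩ := hd
  rw [← per_mul h t k]; congr 1; linarith

/-- Two functions of the same period that agree on one period agree everywhere. -/
theorem per_ext {β : Type*} {f g : ℤ → β} {L : ℤ} (hL : 0 < L) (hf : ∀ t, f (t + L) = f t)
    (hg : ∀ t, g (t + L) = g t) (s : ℤ) (h : ∀ t, s ≤ t → t < s + L → f t = g t) (t : ℤ) :
    f t = g t := by
  have h1 : L ∣ t - (s + (t - s) % L) := by
    have := Int.emod_add_mul_ediv (t - s) L
    exact ⟨(t - s) / L, by linarith⟩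
  rw [per_dvd hf h1, per_dvd hg h1]
  have := Int.emod_nonneg (t - s) hL.ne'
  have := Int.emod_lt_of_pos (t - s) hL
  exact h _ (by omega) (by omega)

section basic

variable {Q : PSys κ P} {lam : ℤ → κ × P}

theorem Step.symm {l : κ × P} {x y : Q.T} (h : Q.Step l x y) : Q.Step (inv l) y x :=
  ⟨h.1.symm, by simp [inv, h.2]⟩

theorem Step.det {l : κ × P} {x y z : Q.T} (h : Q.Step l x y) (h' : Q.Step l x z) : y = z :=
  Q.inj l.1 y z (h.1.symm.trans h'.1) (h.2.trans h'.2.symm)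

theorem Step.det' {l : κ × P} {x y z : Q.T} (h : Q.Step l y x) (h' : Q.Step l z x) : y = z :=
  h.symm.det h'.symm

theorem IsPath.reverse {q : ℤ → Q.T} {a b : ℤ} (h : Q.IsPath lam q a b) :
    Q.IsPath (rev lam) (fun t => q (-t)) (-b) (-a) := by
  intro t h1 h2
  have := (h (-t - 1) (by omega) (by omega)).symm
  rw [show -t - 1 + 1 = -t by ring] at this
  show Q.Step (inv (lam (-t - 1))) (q (-t)) (q (-(t + 1)))
  rw [show -(t + 1) = -t - 1 by ring]
  exact this

theorem IsPath.mono {q : ℤ → Q.T} {a b a' b' : ℤ} (h : Q.IsPath lam q a b) (ha : a ≤ a')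
    (hb : b' ≤ b) : Q.IsPath lam q a' b' := fun t h1 h2 => h t (by omega) (by omega)

/-- Paths with the same labels that meet once agree. -/
theorem IsPath.unique {q p : ℤ → Q.T} {a b s : ℤ} (h : Q.IsPath lam q a b)
    (h' : Q.IsPath lam p a b) (h1 : a ≤ s) (h2 : s ≤ b) (hs : q s = p s) (t : ℤ) (ht1 : a ≤ t)
    (ht2 : t ≤ b) : q t = p t := by
  have fwd : ∀ n : ℕ, s + n ≤ b → q (s + n) = p (s + n) := by
    intro n
    induction n with
    | zero => intro _; simpa using hs
    | succ n ih =>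
      intro hn
      push_cast at hn ⊢
      have e := ih (by omega)
      have s1 := h (s + n) (by omega) (by omega)
      have s2 := h' (s + n) (by omega) (by omega)
      rw [e] at s1
      rw [← add_assoc]
      exact s1.det s2
  have bwd : ∀ n : ℕ, a ≤ s - n → q (s - n) = p (s - n) := by
    intro n
    induction n with
    | zero => intro _; simpa using hs
    | succ n ih =>
      intro hn
      push_cast at hn ⊢
      have e := ih (by omega)
      have s1 := h (s - (n + 1)) (by omega) (by omega)
      have s2 := h' (s - (n + 1)) (by omega) (by omega)
      rw [show s - ((n : ℤ) + 1) + 1 = s - n by ring] at s1 s2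
      rw [e] at s1
      exact s1.det' s2
  rcases le_total s t with hst | hst
  · have := fwd (t - s).toNat (by omega)
    rwa [show s + ((t - s).toNat : ℤ) = t by omega] at this
  · have := bwd (s - t).toNat (by omega)
    rwa [show s - ((s - t).toNat : ℤ) = t by omega] at this

theorem IsPath.color {q : ℤ → Q.T} {a b : ℤ} (h : Q.IsPath lam q a b) {Θ : ℤ → P}
    (hΘ : ∀ t, Θ (t + 1) = Θ t + (lam t).2) (t : ℤ) (h1 : a ≤ t) (h2 : t ≤ b) :
    Q.c (q t) - Θ t = Q.c (q a) - Θ a := by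
  have fwd : ∀ n : ℕ, a + n ≤ b → Q.c (q (a + n)) - Θ (a + n) = Q.c (q a) - Θ a := by
    intro n
    induction n with
    | zero => simp
    | succ n ih =>
      intro hn
      push_cast at hn ⊢
      have e := ih (by omega)
      have s1 := h (a + n) (by omega) (by omega)
      rw [← add_assoc, s1.2, hΘ, ← e]
      abel
  have := fwd (t - a).toNat (by omega)
  rwa [show a + ((t - a).toNat : ℤ) = t by omega] at this

end basic

/-- `z` lies on a closed path whose length divides `D`. -/
def Closed (Q : PSys κ P) (lam : ℤ → κ × P) (D : ℤ) (z : Q.T) : Prop :=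
  ∃ q : ℤ → Q.T, q 0 = z ∧ (∀ t, Q.Step (lam t) (q t) (q (t + 1))) ∧ ∀ t, q (t + D) = q t

/-- Paths through `z` have length at most `C` in both directions. -/
def Bounded (Q : PSys κ P) (lam : ℤ → κ × P) (C : ℤ) (z : Q.T) : Prop :=
  ∀ q a b, a ≤ 0 → 0 ≤ b → q 0 = z → Q.IsPath lam q a b → b ≤ C ∧ -C ≤ a

/-- A full embedding of partial systems. -/
structure Emb (Q Q' : PSys κ P) where
  f : Q.T → Q'.T
  c_eq : ∀ x, Q'.c (f x) = Q.c x
  r_iff : ∀ i x y, Q'.r i (f x) = Q'.r i (f y) ↔ Q.r i x = Q.r i y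

namespace Emb

variable {Q Q' : PSys κ P} (E : Emb Q Q') {lam : ℤ → κ × P}

theorem step_iff (l : κ × P) (x y : Q.T) : Q'.Step l (E.f x) (E.f y) ↔ Q.Step l x y := by
  simp [Step, E.c_eq, E.r_iff]

theorem injective {κ P : Type} {Q Q' : PSys κ P} (E : Emb Q Q')
    (i : κ) : Function.Injective E.f := fun x y h =>
  Q.inj i x y ((E.r_iff i x y).1 (by rw [h])) (by rw [← E.c_eq, h, E.c_eq])

theorem closed {D : ℤ} {z : Q.T} (h : Q.Closed lam D z) : Q'.Closed lam D (E.f z) := by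
  obtain ⟨q, h0, h1, h2⟩ := h
  exact ⟨fun t => E.f (q t), by simp [h0], fun t => (E.step_iff _ _ _).2 (h1 t),
    fun t => by simp [h2]⟩

theorem descend {q : ℤ → Q'.T} {a b : ℤ} (h : Q'.IsPath lam q a b) (hab : a ≤ b)
    (hr : ∀ t, a ≤ t → t ≤ b → ∃ z, q t = E.f z) :
    ∃ p : ℤ → Q.T, Q.IsPath lam p a b ∧ ∀ t, a ≤ t → t ≤ b → q t = E.f (p t) := by
  classical
  obtain ⟨z0, -⟩ := hr a le_rfl hab
  refine ⟨fun t => if ht : a ≤ t ∧ t ≤ b then (hr t ht.1 ht.2).choose else z0, ?_, ?_⟩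
  · intro t h1 h2
    rw [← E.step_iff]
    have e1 := (hr t h1 h2.le).choose_spec
    have e2 := (hr (t + 1) (by omega) (by omega)).choose_spec
    simp only [h1, h2.le, and_self, dif_pos, show a ≤ t + 1 by omega, show t + 1 ≤ b by omega]
    rw [← e1, ← e2]
    exact h t h1 h2
  · intro t h1 h2
    simp only [h1, h2, and_self, dif_pos]
    exact (hr t h1 h2).choose_spec

end Emb

section extend

open Classical in
/-- Adding one point of colour `d` to the `i`-orbit of `v`. -/
noncomputable def ext1 (Q : PSys κ P) (i : κ) (v : Q.T) (d : P)
    (h : ∀ z, Q.r i z = Q.r i v → Q.c z ≠ d) : PSys κ P where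
  T := Option Q.T
  Lab := Option Q.Lab
  c o := o.elim d Q.c
  r j o := o.elim (if j = i then some (Q.r i v) else none) (fun x => some (Q.r j x))
  inj j x y h1 h2 := by
    cases x with
    | none =>
      cases y with
      | none => rfl
      | some y =>
        simp only [Option.elim] at h1 h2
        split_ifs at h1 with hj
        subst hj
        exact absurd h2.symm (h y (Option.some.inj h1).symm)
    | some x =>
      cases y with
      | none =>
        simp only [Option.elim] at h1 h2
        split_ifs at h1 with hj
        subst hj
        exact absurd h2 (h x (Option.some.inj h1))
      | some y =>
        simp only [Option.elim] at h1 h2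
        rw [Q.inj j x y (Option.some.inj h1) h2]

variable {Q : PSys κ P} {i : κ} {v : Q.T} {d : P} {h : ∀ z, Q.r i z = Q.r i v → Q.c z ≠ d}
  {lam : ℤ → κ × P} {L : ℤ}

/-- The inclusion into a one-point extension. -/
def ext1Emb (Q : PSys κ P) (i : κ) (v : Q.T) (d : P) (h : ∀ z, Q.r i z = Q.r i v → Q.c z ≠ d) :
    Emb Q (Q.ext1 i v d h) where
  f := some
  c_eq _ := rfl
  r_iff j x y := by simp [ext1]

theorem ext1_step_none {l : κ × P} (hl : l.2 ≠ 0) {x : Option Q.T}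
    (hs : (Q.ext1 i v d h).Step l x none) : l.1 = i := by
  cases x with
  | none => exact absurd (by simpa using hs.2) hl
  | some x =>
    have := hs.1
    simp only [ext1, Option.elim] at this
    split_ifs at this with hj
    exact hj

theorem ext1_none_step {l : κ × P} (hl : l.2 ≠ 0) {x : Option Q.T}
    (hs : (Q.ext1 i v d h).Step l none x) : l.1 = i :=
  ext1_step_none (l := inv l) (by simpa [inv] using hl) hs.symm

theorem ext1_interior (hg : Good lam L) {q : ℤ → Option Q.T} {a b : ℤ}
    (hp : (Q.ext1 i v d h).IsPath lam q a b) (t : ℤ) (h1 : a < t) (h2 : t < b) :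
    ∃ z, q t = some z := by
  cases hq : q t with
  | some z => exact ⟨z, rfl⟩
  | none =>
    exfalso
    have s1 := hp (t - 1) (by omega) (by omega)
    have s2 := hp t (by omega) (by omega)
    rw [show t - 1 + 1 = t by ring, hq] at s1
    rw [hq] at s2
    have := hg.adj (t - 1)
    rw [show t - 1 + 1 = t by ring, ext1_step_none (hg.ne _) s1, ext1_none_step (hg.ne _) s2]
      at this
    exact this rfl

theorem ext1_bounded (hg : Good lam L) {C : ℤ} (hC : 0 ≤ C) {z : Q.T} (hb : Q.Bounded lam C z) :
    (Q.ext1 i v d h).Bounded lam (C + 1) (some z) := by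
  intro q a b ha hb' h0 hp
  constructor
  · by_contra hlt
    have hp' := hp.mono ha (show b - 1 ≤ b by omega)
    obtain ⟨p, hpp, hpe⟩ := (ext1Emb Q i v d h).descend hp' (by omega) (by
      intro t h1 h2
      rcases h1.eq_or_lt with rfl | h1
      · exact ⟨z, h0⟩
      · exact ext1_interior hg hp t (by omega) (by omega))
    have e0 : p 0 = z := by
      have := hpe 0 le_rfl (by omega)
      rw [h0] at this
      exact (Option.some.inj this).symm
    have := (hb p 0 (b - 1) le_rfl (by omega) e0 hpp).1
    omega
  · by_contra hlt
    have hp' := hp.mono (show a ≤ a + 1 by omega) hb'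
    obtain ⟨p, hpp, hpe⟩ := (ext1Emb Q i v d h).descend hp' (by omega) (by
      intro t h1 h2
      rcases h2.eq_or_lt with rfl | h2
      · exact ⟨z, h0⟩
      · exact ext1_interior hg hp t (by omega) (by omega))
    have e0 : p 0 = z := by
      have := hpe 0 (by omega) le_rfl
      rw [h0] at this
      exact (Option.some.inj this).symm
    have := (hb p (a + 1) 0 (by omega) le_rfl e0 hpp).2
    omega

end extend

/-- The invariant maintained while paths of the marked points `μ` are being closed up. -/
structure Inv {Ξ : Type} (lam : ℤ → κ × P) (L D C : ℤ) (Ref : Ξ → Ξ → ℤ → Prop) (c0 : Ξ → P)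
    (rel0 : κ → Ξ → Ξ → Prop) (Q : PSys κ P) (μ : Ξ → Q.T) : Prop where
  fin : Finite Q.T
  color : ∀ x, Q.c (μ x) = c0 x
  rel : ∀ i x y, rel0 i x y → Q.r i (μ x) = Q.r i (μ y)
  ref : ∀ x y k q, 0 ≤ k → q 0 = μ x → q (k * L) = μ y → Q.IsPath lam q 0 (k * L) → Ref x y k
  bd : ∀ x, Q.Closed lam D (μ x) ∨ Q.Bounded lam C (μ x)

/-- A path through `z` that cannot be prolonged. -/
structure MaxPath (Q : PSys κ P) (lam : ℤ → κ × P) (z : Q.T) (q : ℤ → Q.T) (a b : ℤ) : Prop where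
  ha : a ≤ 0
  hb : 0 ≤ b
  h0 : q 0 = z
  path : Q.IsPath lam q a b
  fwd : ∀ y, ¬ Q.Step (lam b) (q b) y
  bwd : ∀ y, ¬ Q.Step (lam (a - 1)) y (q a)

/-- The two ends of a path would be prolonged by the same point. -/
def Conflict (Q : PSys κ P) (lam : ℤ → κ × P) (q : ℤ → Q.T) (a b : ℤ) : Prop :=
  (lam b).1 = (lam (a - 1)).1 ∧ Q.r (lam b).1 (q b) = Q.r (lam b).1 (q a) ∧
    Q.c (q b) + (lam b).2 = Q.c (q a) - (lam (a - 1)).2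

section conflict

variable {Ξ : Type} {lam : ℤ → κ × P} {L D C : ℤ} {Ref : Ξ → Ξ → ℤ → Prop} {c0 : Ξ → P}
  {rel0 : κ → Ξ → Ξ → Prop} {Q : PSys κ P} {μ : Ξ → Q.T}

theorem Inv.ext1 (hg : Good lam L) (hC : 0 ≤ C) (hI : Inv lam L D C Ref c0 rel0 Q μ) (i : κ)
    (v : Q.T) (d : P) (h : ∀ z, Q.r i z = Q.r i v → Q.c z ≠ d) :
    Inv lam L D (C + 1) Ref c0 rel0 (Q.ext1 i v d h) (fun x => some (μ x)) where
  fin := by have := hI.fin; exact inferInstanceAs (Finite (Option Q.T))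
  color := hI.color
  rel j x y hxy := congrArg some (hI.rel j x y hxy)
  ref x y k q hk h0 h1 hp := by
    obtain ⟨p, hpp, hpe⟩ := (ext1Emb Q i v d h).descend hp (mul_nonneg hk hg.pos.le) (by
      intro t h2 h3
      rcases h2.eq_or_lt with rfl | h2
      · exact ⟨_, h0⟩
      rcases h3.eq_or_lt with rfl | h3
      · exact ⟨_, h1⟩
      exact ext1_interior hg hp t h2 h3)
    have hkL := mul_nonneg hk hg.pos.le
    refine hI.ref x y k p hk ?_ ?_ hpp
    · have := hpe 0 le_rfl hkL
      rw [h0] at this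
      exact (Option.some.inj this).symm
    · have := hpe _ hkL le_rfl
      rw [h1] at this
      exact (Option.some.inj this).symm
  bd x := (hI.bd x).imp (ext1Emb Q i v d h).closed (ext1_bounded hg hC)

theorem exists_maxPath {z : Q.T} (hb : Q.Bounded lam C z) : ∃ q a b, MaxPath Q lam z q a b := by
  classical
  have key : ∀ n : ℕ, (∃ q a b, MaxPath Q lam z q a b) ∨
      ∃ q a b, a ≤ 0 ∧ 0 ≤ b ∧ q 0 = z ∧ Q.IsPath lam q a b ∧ (n : ℤ) ≤ b - a := by
    intro n
    induction n with
    | zero => exact Or.inr ⟨fun _ => z, 0, 0, le_rfl, le_rfl, rfl, fun t h1 h2 => by omega, by simp⟩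
    | succ n ih =>
      rcases ih with ih | ⟨q, a, b, ha, hb', h0, hp, hn⟩
      · exact Or.inl ih
      by_cases hf : ∃ y, Q.Step (lam b) (q b) y
      · obtain ⟨y, hy⟩ := hf
        refine Or.inr ⟨Function.update q (b + 1) y, a, b + 1, ha, by omega, ?_, ?_,
          by push_cast; omega⟩
        · rw [Function.update_of_ne (by omega), h0]
        · intro t h1 h2
          rw [Function.update_of_ne (by omega : t ≠ b + 1)]
          rcases eq_or_ne t b with rfl | hne
          · simpa using hy
          · rw [Function.update_of_ne (by omega)]
            exact hp t h1 (by omega)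
      by_cases hf' : ∃ y, Q.Step (lam (a - 1)) y (q a)
      · obtain ⟨y, hy⟩ := hf'
        refine Or.inr ⟨Function.update q (a - 1) y, a - 1, b, by omega, hb', ?_, ?_,
          by push_cast; omega⟩
        · rw [Function.update_of_ne (by omega), h0]
        · intro t h1 h2
          rw [Function.update_of_ne (by omega : t + 1 ≠ a - 1)]
          rcases eq_or_ne t (a - 1) with rfl | hne
          · simpa using hy
          · rw [Function.update_of_ne (by omega)]
            exact hp t (by omega) h2
      exact Or.inl ⟨q, a, b, ha, hb', h0, hp, fun y hy => hf ⟨y, hy⟩, fun y hy => hf' ⟨y, hy⟩⟩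
  rcases key (2 * C + 1).toNat with h | ⟨q, a, b, ha, hb', h0, hp, hn⟩
  · exact h
  · have := hb q a b ha hb' h0 hp
    omega

theorem conflict_step (hg : Good lam L) {z : Q.T} {q : ℤ → Q.T} {a b : ℤ}
    (hm : MaxPath Q lam z q a b) (hc : Conflict Q lam q a b) :
    ∃ (h : ∀ y, Q.r (lam b).1 y = Q.r (lam b).1 (q b) → Q.c y ≠ Q.c (q b) + (lam b).2)
      (q' : ℤ → Option Q.T),
      MaxPath (Q.ext1 (lam b).1 (q b) (Q.c (q b) + (lam b).2) h) lam (some z) q' (a - 1) (b + 1) ∧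
        q' (a - 1) = q' (b + 1) := by
  classical
  have h : ∀ y, Q.r (lam b).1 y = Q.r (lam b).1 (q b) → Q.c y ≠ Q.c (q b) + (lam b).2 :=
    fun y h1 h2 => hm.fwd y ⟨h1.symm, h2⟩
  have hab := hm.ha.trans hm.hb
  refine ⟨h, fun t => if a ≤ t ∧ t ≤ b then some (q t) else none, ⟨?_, ?_, ?_, ?_, ?_, ?_⟩, ?_⟩
  · have := hm.ha; omega
  · have := hm.hb; omega
  · simp [hm.ha, hm.hb, hm.h0]
    rfl
  · intro t h1 h2
    rcases eq_or_ne t (a - 1) with rfl | hne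
    · simp only [sub_add_cancel, le_refl, hab, and_self, if_true,
        show ¬ (a ≤ a - 1 ∧ a - 1 ≤ b) by omega, if_false]
      refine ⟨?_, ?_⟩
      · simp only [PSys.ext1, Option.elim]
        rw [if_pos hc.1.symm, hc.2.1, hc.1]
      · simp only [PSys.ext1, Option.elim]
        rw [hc.2.2]; abel
    rcases eq_or_ne t b with rfl | hne'
    · simp only [hab, le_refl, and_self, if_true, show ¬ (a ≤ t + 1 ∧ t + 1 ≤ t) by omega, if_false]
      refine ⟨?_, rfl⟩
      simp [PSys.ext1]
    · simp only [show a ≤ t ∧ t ≤ b by omega, show a ≤ t + 1 ∧ t + 1 ≤ b by omega, and_self,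
        if_true]
      exact ((ext1Emb Q _ _ _ h).step_iff _ _ _).2 (hm.path t (by omega) (by omega))
  · intro y hy
    simp only [show ¬ (a ≤ b + 1 ∧ b + 1 ≤ b) by omega, if_false] at hy
    exact hg.adj b (ext1_none_step (hg.ne _) hy)
  · intro y hy
    simp only [show ¬ (a ≤ a - 1 ∧ a - 1 ≤ b) by omega, if_false] at hy
    have h3 := ext1_step_none (hg.ne _) hy
    have := hg.adj (a - 1 - 1)
    rw [h3, sub_add_cancel, ← hc.1] at this
    exact this rfl
  · simp only [show ¬ (a ≤ a - 1 ∧ a - 1 ≤ b) by omega, show ¬ (a ≤ b + 1 ∧ b + 1 ≤ b) by omega,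
      if_false]

/-- A closed path cannot be labelled by a word that is its own inverse. -/
theorem no_reflection (hg : Good lam L) {q : ℤ → Q.T} {a b : ℤ} (hp : Q.IsPath lam q a b)
    (hab : a < b) (he : q a = q b) (hs : ∀ k, lam (b - k) = inv (lam (a - 1 + k))) : False := by
  have hcol : ∀ n : ℕ, a + n ≤ b → Q.c (q (a + n)) = Q.c (q (b - n)) := by
    intro n
    induction n with
    | zero => intro _; simp [he]
    | succ n ih =>
      intro hn
      push_cast at hn ⊢
      have e := ih (by omega)
      have s1 := (hp (a + n) (by omega) (by omega)).2
      have s2 := (hp (b - (n + 1)) (by omega) (by omega)).2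
      rw [show b - ((n : ℤ) + 1) + 1 = b - n by ring, hs] at s2
      rw [show a - 1 + ((n : ℤ) + 1) = a + n by ring] at s2
      rw [← add_assoc, s1, e, s2]
      simp [inv]
  rcases Int.even_or_odd (b - a) with ⟨m, hm⟩ | ⟨m, hm⟩
  · have h1 := hs m
    have h2 := hg.adj (a - 1 + m)
    rw [show a - 1 + m + 1 = b - m by omega, h1] at h2
    exact h2 rfl
  · have h1 := hcol m.toNat (by omega)
    rw [show ((m.toNat : ℕ) : ℤ) = m by omega] at h1
    have s1 := (hp (a + m) (by omega) (by omega)).2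
    rw [show a + m + 1 = b - m by omega, ← h1] at s1
    exact hg.ne (a + m) (by simpa using s1)

/-- After finitely many one-point extensions, the maximal path through a given bounded point has no
conflict. -/
theorem exists_no_conflict (hg : Good lam L) (hC : 0 ≤ C) (hI : Inv lam L D C Ref c0 rel0 Q μ)
    (x0 : Ξ) (hx : Q.Bounded lam C (μ x0)) :
    ∃ (Q' : PSys κ P) (μ' : Ξ → Q'.T) (q : ℤ → Q'.T) (a b : ℤ),
      Inv lam L D (C + L + 1) Ref c0 rel0 Q' μ' ∧ (∀ x, Q.Closed lam D (μ x) →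
        Q'.Closed lam D (μ' x)) ∧ Q'.Bounded lam (C + L + 1) (μ' x0) ∧
      MaxPath Q' lam (μ' x0) q a b ∧ ¬ Conflict Q' lam q a b := by
  have hmono : ∀ {C C' : ℤ} {Q : PSys κ P} {μ : Ξ → Q.T}, C ≤ C' →
      Inv lam L D C Ref c0 rel0 Q μ → Inv lam L D C' Ref c0 rel0 Q μ := by
    intro C C' Q μ hCC hI
    refine ⟨hI.fin, hI.color, hI.rel, hI.ref, fun x => (hI.bd x).imp id ?_⟩
    intro hb q a b h1 h2 h3 h4
    have := hb q a b h1 h2 h3 h4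
    omega
  have key : ∀ (n m : ℕ), (m : ℤ) + n = L + 1 → ∀ (Q' : PSys κ P) (μ' : Ξ → Q'.T) (q : ℤ → Q'.T)
      (a b : ℤ), Inv lam L D (C + m) Ref c0 rel0 Q' μ' → (∀ x, Q.Closed lam D (μ x) →
        Q'.Closed lam D (μ' x)) → Q'.Bounded lam (C + m) (μ' x0) → MaxPath Q' lam (μ' x0) q a b →
      (1 ≤ m → q a = q b ∧ a < b) →
      (∀ k : ℤ, 1 ≤ k → k < m → lam (b - k) = inv (lam (a - 1 + k))) →
      ∃ (Q' : PSys κ P) (μ' : Ξ → Q'.T) (q : ℤ → Q'.T) (a b : ℤ),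
      Inv lam L D (C + L + 1) Ref c0 rel0 Q' μ' ∧ (∀ x, Q.Closed lam D (μ x) →
        Q'.Closed lam D (μ' x)) ∧ Q'.Bounded lam (C + L + 1) (μ' x0) ∧
      MaxPath Q' lam (μ' x0) q a b ∧ ¬ Conflict Q' lam q a b := by
    intro n
    induction n with
    | zero =>
      intro m hmn Q' μ' q a b hI hcl hbd hmp h1 h2
      have hL := hg.pos
      obtain ⟨he, hab⟩ := h1 (by omega)
      refine (no_reflection hg hmp.path hab he ?_).elim
      refine per_ext (f := fun k => lam (b - k)) (g := fun k => inv (lam (a - 1 + k))) hL ?_ ?_ 1 ?_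
      · intro t
        rw [← hg.per (b - (t + L))]; congr 1; ring
      · intro t
        rw [← add_assoc, hg.per]
      · intro t h3 h4
        exact h2 t h3 (by omega)
    | succ n ih =>
      intro m hmn Q' μ' q a b hI hcl hbd hmp h1 h2
      by_cases hcf : Conflict Q' lam q a b
      · obtain ⟨h, q', hm', he'⟩ := conflict_step hg hmp hcf
        refine ih (m + 1) (by push_cast at hmn ⊢; omega)
          (Q'.ext1 (lam b).1 (q b) _ h) (fun x => some (μ' x)) q' (a - 1) (b + 1) ?_ ?_ ?_ hm' ?_ ?_
        · have := hI.ext1 hg (by omega) (lam b).1 (q b) _ h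
          refine hmono ?_ this
          push_cast; omega
        · intro x hx
          exact (ext1Emb _ _ _ _ h).closed (hcl x hx)
        · have := ext1_bounded (h := h) hg (by omega) hbd
          push_cast
          rwa [← add_assoc]
        · intro _
          have := hmp.ha.trans hmp.hb
          exact ⟨he', by omega⟩
        · intro k hk1 hk2
          push_cast at hk2
          rcases hk1.eq_or_lt with rfl | hk1
          · have hm1 := (h1 (by omega)).1
            rw [show b + 1 - 1 = b by ring, show a - 1 - 1 + 1 = a - 1 by ring]
            refine Prod.ext hcf.1 ?_
            have := hcf.2.2
            rw [hm1] at this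
            simpa [inv, sub_eq_add_neg] using this
          · have := h2 (k - 1) (by omega) (by omega)
            rw [show b - (k - 1) = b + 1 - k by ring,
              show a - 1 + (k - 1) = a - 1 - 1 + k by ring] at this
            exact this
      · refine ⟨Q', μ', q, a, b, hmono (by omega) hI, hcl, ?_, hmp, hcf⟩
        intro q a b e1 e2 e3 e4
        have := hbd q a b e1 e2 e3 e4
        omega
  obtain ⟨q, a, b, hmp⟩ := exists_maxPath hx
  refine key (L + 1).toNat 0 ?_ Q μ q a b ?_ (fun x hx => hx) ?_ hmp ?_ ?_
  · have := hg.pos; push_cast; omega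
  · simpa using hI
  · simpa using hx
  · intro h; omega
  · intro k h1 h2; push_cast at h2; omega

end conflict

end PSys

namespace PSys

variable {κ P : Type} [AddCommGroup P]

/-- A closed `lam`-path `p` of length `D` in an extension `E` of a partial system, which meets the
old system exactly in the times from `u0` to `u1` and contains all the new points. -/
structure Arc {Q Q' : PSys κ P} (E : Emb Q Q') (lam : ℤ → κ × P) (D : ℤ) (p : ℤ → Q'.T)
    (u0 u1 : ℤ) : Prop where
  le : u0 ≤ u1
  lt : u1 < u0 + D
  path : ∀ t, Q'.Step (lam t) (p t) (p (t + 1))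
  per : ∀ t, p (t + D) = p t
  old : ∀ t, u0 ≤ t → t ≤ u1 → ∃ z, p t = E.f z
  new : ∀ t, u1 < t → t < u0 + D → ∀ z, p t ≠ E.f z
  all : ∀ y, (∃ z, y = E.f z) ∨ ∃ t, u1 < t ∧ t < u0 + D ∧ y = p t
  type : ∀ t, u1 < t → t < u0 + D → ∀ l y, l.2 ≠ 0 → Q'.Step l (p t) y →
    l.1 = (lam t).1 ∨ l.1 = (lam (t - 1)).1
  succ : ∀ t, u1 < t → t + 1 < u0 + D → ∀ l y, l.2 ≠ 0 → Q'.Step l (p t) y →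
    l.1 = (lam t).1 → y = p (t + 1)
  pred : ∀ t, u1 < t - 1 → t < u0 + D → ∀ l y, l.2 ≠ 0 → Q'.Step l (p t) y →
    l.1 = (lam (t - 1)).1 → y = p (t - 1)

section arc

variable {Q Q' : PSys κ P} {E : Emb Q Q'} {lam lam' : ℤ → κ × P} {L D : ℤ} {p : ℤ → Q'.T}
  {u0 u1 : ℤ}

theorem Arc.rev (h : Arc E lam D p u0 u1) (hD : ∀ t, lam (t + D) = lam t) :
    Arc E (rev lam) D (fun t => p (-t)) (-u1) (-u0) where
  le := by have := h.le; omega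
  lt := by have := h.lt; omega
  path t := by
    have := (h.path (-t - 1)).symm
    rw [show -t - 1 + 1 = -t by ring] at this
    show Q'.Step (inv (lam (-t - 1))) (p (-t)) (p (-(t + 1)))
    rw [show -(t + 1) = -t - 1 by ring]
    exact this
  per t := by
    show p (-(t + D)) = p (-t)
    rw [← h.per (-(t + D))]; congr 1; ring
  old t h1 h2 := h.old (-t) (by omega) (by omega)
  new t h1 h2 z := by
    show p (-t) ≠ _
    rw [← h.per (-t)]
    exact h.new _ (by omega) (by omega) z
  all y := by
    refine (h.all y).imp id ?_
    rintro ⟨t, h1, h2, rfl⟩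
    refine ⟨D - t, by omega, by omega, ?_⟩
    show p t = p (-(D - t))
    rw [← h.per (-(D - t))]; congr 1; ring
  type t h1 h2 l y hl hs := by
    change Q'.Step l (p (-t)) y at hs
    rw [← h.per (-t)] at hs
    have := h.type _ (by omega) (by omega) l y hl hs
    simp only [PSys.rev, inv]
    rw [← hD (-t - 1), ← hD (-(t - 1) - 1)]
    rw [show -t - 1 + D = -t + D - 1 by ring, show -(t - 1) - 1 + D = -t + D by ring]
    exact this.symm
  succ t h1 h2 l y hl hs ht := by
    change Q'.Step l (p (-t)) y at hs
    rw [← h.per (-t)] at hs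
    simp only [PSys.rev, inv] at ht
    rw [← hD (-t - 1), show -t - 1 + D = -t + D - 1 by ring] at ht
    have := h.pred _ (by omega) (by omega) l y hl hs ht
    show y = p (-(t + 1))
    rw [this, ← h.per (-(t + 1))]; congr 1; ring
  pred t h1 h2 l y hl hs ht := by
    change Q'.Step l (p (-t)) y at hs
    rw [← h.per (-t)] at hs
    simp only [PSys.rev, inv] at ht
    rw [← hD (-(t - 1) - 1), show -(t - 1) - 1 + D = -t + D by ring] at ht
    have := h.succ _ (by omega) (by omega) l y hl hs ht
    show y = p (-(t - 1))
    rw [this, ← h.per (-(t - 1))]; congr 1; ring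

theorem Arc.enter_type (h : Arc E lam D p u0 u1) {l : κ × P} (hl : l.2 ≠ 0) {x : Q.T} {t : ℤ}
    (h1 : u1 < t) (h2 : t < u0 + D) (hs : Q'.Step l (E.f x) (p t)) :
    (t = u1 + 1 ∧ l.1 = (lam u1).1) ∨ (t = u0 + D - 1 ∧ l.1 = (lam t).1) := by
  have hl' : (inv l).2 ≠ 0 := neg_ne_zero.mpr hl
  rcases h.type t h1 h2 _ _ hl' hs.symm with e | e
  · refine Or.inr ⟨?_, e⟩
    by_contra hne
    exact h.new (t + 1) (by omega) (by omega) x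
      (h.succ t h1 (by omega) _ _ hl' hs.symm e).symm
  · have : t = u1 + 1 := by
      by_contra hne
      exact h.new (t - 1) (by omega) (by omega) x
        (h.pred t (by omega) h2 _ _ hl' hs.symm e).symm
    refine Or.inl ⟨this, ?_⟩
    rw [this, add_sub_cancel_right] at e
    exact e

theorem Arc.follow (h : Arc E lam D p u0 u1) (hg' : Good lam' L) {q : ℤ → Q'.T} {s β : ℤ}
    (hq : Q'.IsPath lam' q s β) (h1 : q (s + 1) = p (u1 + 1)) (h2 : (lam' s).1 = (lam u1).1)
    (n : ℕ) (hn : s + 1 + n ≤ β) (hn' : u1 + 1 + n < u0 + D) :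
    q (s + 1 + n) = p (u1 + 1 + n) ∧ (lam' (s + n)).1 = (lam (u1 + n)).1 ∧
      (1 ≤ n → lam' (s + n) = lam (u1 + n)) := by
  induction n with
  | zero => simpa using ⟨h1, h2⟩
  | succ n ih =>
    push_cast at hn hn' ⊢
    obtain ⟨e1, e2, -⟩ := ih (by omega) (by omega)
    have hs := hq (s + 1 + n) (by omega) (by omega)
    rw [e1] at hs
    have hty : (lam' (s + 1 + n)).1 = (lam (u1 + 1 + n)).1 := by
      rcases h.type _ (by omega) (by omega) _ _ (hg'.ne _) hs with e | e
      · exact e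
      · rw [show u1 + 1 + (n : ℤ) - 1 = u1 + n by ring, ← e2] at e
        have := hg'.adj (s + n)
        rw [show s + (n : ℤ) + 1 = s + 1 + n by ring] at this
        exact absurd e this
    have e3 := h.succ _ (by omega) (by omega) _ _ (hg'.ne _) hs hty
    have hl : lam' (s + 1 + n) = lam (u1 + 1 + n) := by
      refine Prod.ext hty ?_
      have c1 := hs.2
      have c2 := (h.path (u1 + 1 + n)).2
      rw [e3, c2] at c1
      exact (add_left_cancel c1).symm
    rw [← add_assoc, ← add_assoc, show s + ((n : ℤ) + 1) = s + 1 + n by ring,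
      show u1 + ((n : ℤ) + 1) = u1 + 1 + n by ring]
    exact ⟨e3, hty, fun _ => hl⟩

theorem Arc.enter_aux (h : Arc E lam D p u0 u1) (hg : Good lam L) (hg' : Good lam' L)
    (hlong : u1 + L + 1 < u0 + D) {q : ℤ → Q'.T} {s α β : ℤ} (hq : Q'.IsPath lam' q α β)
    (hs1 : α ≤ s) (hs2 : s < β) (h1 : q (s + 1) = p (u1 + 1)) (h2 : (lam' s).1 = (lam u1).1) :
    (∃ v, (∀ t, lam' t = lam (t + v)) ∧ ∀ t, α ≤ t → t ≤ β → q t = p (t + v)) ∨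
      (β ≤ s + L ∧ ∀ t, s < t → t ≤ β → ∀ z, q t ≠ E.f z) := by
  have hf := fun n => h.follow hg' (hq.mono hs1 le_rfl) h1 h2 n
  have hL := hg.pos
  by_cases hβ : β ≤ s + L
  · refine Or.inr ⟨hβ, fun t ht1 ht2 z => ?_⟩
    have := (hf (t - s - 1).toNat (by omega) (by omega)).1
    rw [show s + 1 + ((t - s - 1).toNat : ℤ) = t by omega] at this
    rw [this]
    exact h.new _ (by omega) (by omega) z
  · have hlam : ∀ t, lam' t = lam (t + (u1 - s)) := by
      refine per_ext hL hg'.per (fun t => ?_) (s + 1) (fun t ht1 ht2 => ?_)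
      · rw [← hg.per (t + (u1 - s))]; congr 1; ring
      · have := (hf (t - s).toNat (by omega) (by omega)).2.2 (by omega)
        rw [show s + ((t - s).toNat : ℤ) = t by omega,
          show u1 + ((t - s).toNat : ℤ) = t + (u1 - s) by omega] at this
        exact this
    refine Or.inl ⟨u1 - s, hlam, fun t ht1 ht2 => ?_⟩
    refine hq.unique (p := fun t => p (t + (u1 - s))) (s := s + 1) ?_ (by omega) (by omega) ?_ t
      ht1 ht2
    · intro t _ _
      rw [hlam]
      have := h.path (t + (u1 - s))
      rwa [show t + (u1 - s) + 1 = t + 1 + (u1 - s) by ring] at this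
    · show q (s + 1) = p (s + 1 + (u1 - s))
      rw [h1]; congr 1; ring

/-- A path entering the new points either follows the closed path, or ends soon. -/
theorem Arc.enter (h : Arc E lam D p u0 u1) (hg : Good lam L) (hg' : Good lam' L)
    (hD : ∀ t, lam (t + D) = lam t)
    (hlong : u1 + L + 1 < u0 + D) {q : ℤ → Q'.T} {s α β : ℤ} (hq : Q'.IsPath lam' q α β)
    (hs1 : α ≤ s) (hs2 : s < β) {x : Q.T} (h1 : q s = E.f x) (h2 : ∀ z, q (s + 1) ≠ E.f z) :
    (∃ v, (∀ t, lam' t = lam (t + v)) ∧ ∀ t, α ≤ t → t ≤ β → q t = p (t + v)) ∨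
    (∃ v, (∀ t, lam' t = PSys.rev lam (t + v)) ∧ ∀ t, α ≤ t → t ≤ β → q t = p (-(t + v))) ∨
      (β ≤ s + L ∧ ∀ t, s < t → t ≤ β → ∀ z, q t ≠ E.f z) := by
  obtain ⟨z, hz⟩ | ⟨t, ht1, ht2, ht⟩ := h.all (q (s + 1))
  · exact absurd hz (h2 z)
  have hst := hq s hs1 hs2
  rw [h1, ht] at hst
  rcases h.enter_type (hg'.ne _) ht1 ht2 hst with ⟨rfl, e⟩ | ⟨e1, e⟩
  · rcases h.enter_aux hg hg' hlong hq hs1 hs2 ht e with h' | h'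
    · exact Or.inl h'
    · exact Or.inr (Or.inr h')
  · refine Or.inr ((h.rev hD).enter_aux hg.rev hg' (by omega) hq hs1 hs2 ?_ ?_)
    · show _ = p (-(-u0 + 1))
      rw [ht, e1, ← h.per (-(-u0 + 1))]; congr 1; ring
    · rw [e, e1]
      simp only [PSys.rev, inv]
      rw [← hD (- -u0 - 1)]; congr 2; ring

theorem Arc.time (h : Arc E lam D p u0 u1) {v : ℤ} {x : Q.T} (hx : p v = E.f x) :
    ∃ m, u0 ≤ v + m * D ∧ v + m * D ≤ u1 := by
  have hD : 0 < D := by have := h.le; have := h.lt; omega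
  have e := Int.emod_add_mul_ediv (v - u0) D
  have e1 := Int.emod_nonneg (v - u0) hD.ne'
  have e2 := Int.emod_lt_of_pos (v - u0) hD
  refine ⟨-((v - u0) / D), ?_, ?_⟩
  · linarith
  · by_contra hlt
    refine h.new (v + -((v - u0) / D) * D) (by omega) (by linarith) x ?_
    rw [per_mul h.per, hx]

theorem Arc.ref_aux (h : Arc E lam D p u0 u1) (hg : Good lam L) {N : ℤ} (hN : D = N * L)
    {lam' : ℤ → κ × P} {v k : ℤ} (hl : ∀ t, lam' t = lam (t + v)) {x y : Q.T}
    (hx : p v = E.f x) (hy : p (k * L + v) = E.f y) :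
    ∃ k', k ≡ k' [ZMOD N] ∧ ((0 ≤ k' ∧ ∃ q, q 0 = x ∧ q (k' * L) = y ∧
      Q.IsPath lam' q 0 (k' * L)) ∨ (k' ≤ 0 ∧ ∃ q, q 0 = y ∧ q (-k' * L) = x ∧
      Q.IsPath lam' q 0 (-k' * L))) := by
  obtain ⟨m, hm1, hm2⟩ := h.time hx
  obtain ⟨m', hm1', hm2'⟩ := h.time hy
  have hL := hg.pos
  have hDL : ∀ t m, lam (t + m * D) = lam t := fun t m => by
    rw [hN, ← mul_assoc]; exact per_mul hg.per _ _
  have hfi := E.injective (lam 0).1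
  refine ⟨k + (m' - m) * N, ?_, ?_⟩
  · exact (Int.modEq_iff_dvd.2 ⟨m' - m, by ring⟩)
  have key : k * L + v + m' * D = v + m * D + (k + (m' - m) * N) * L := by rw [hN]; ring
  rw [key] at hm1' hm2'
  have hx' : p (v + m * D) = E.f x := by rw [per_mul h.per, hx]
  have hy' : p (v + m * D + (k + (m' - m) * N) * L) = E.f y := by
    rw [← key, per_mul h.per, hy]
  set K := k + (m' - m) * N
  rcases le_total 0 K with hK | hK
  · left
    refine ⟨hK, ?_⟩
    have hKL := mul_nonneg hK hL.le
    obtain ⟨q, hq, hqe⟩ := E.descend (q := fun t => p (t + (v + m * D))) (lam := lam') (a := 0)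
      (b := K * L) (by
        intro t _ _
        rw [hl, ← hDL _ m]
        have := h.path (t + v + m * D)
        rw [show t + v + m * D + 1 = t + 1 + (v + m * D) by ring] at this
        simpa only [add_assoc] using this) hKL
      (fun t h1 h2 => h.old _ (by linarith) (by linarith))
    refine ⟨q, ?_, ?_, hq⟩
    · apply hfi; rw [← hqe 0 le_rfl hKL, ← hx']; congr 1; ring
    · apply hfi; rw [← hqe _ hKL le_rfl, ← hy']; congr 1; ring
  · right
    refine ⟨hK, ?_⟩
    have hKL : 0 ≤ -K * L := mul_nonneg (by omega) hL.le
    obtain ⟨q, hq, hqe⟩ := E.descend (q := fun t => p (t + (v + m * D + K * L))) (lam := lam')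
      (a := 0) (b := -K * L) (by
        intro t _ _
        rw [hl, ← hDL _ m, ← per_mul hg.per _ K]
        have := h.path (t + v + m * D + K * L)
        rw [show t + v + m * D + K * L + 1 = t + 1 + (v + m * D + K * L) by ring] at this
        simpa only [add_assoc] using this) hKL
      (fun t h1 h2 => h.old _ (by linarith) (by linarith))
    refine ⟨q, ?_, ?_, hq⟩
    · apply hfi; rw [← hqe 0 le_rfl hKL, ← hy']; congr 1; ring
    · apply hfi; rw [← hqe _ hKL le_rfl, ← hx']; congr 1; ring

theorem Emb.exit_or {κ P : Type} {Q Q' : PSys κ P}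
    (E : Emb Q Q') {q : ℤ → Q'.T} {b : ℤ} (hb : 0 ≤ b) {x : Q.T}
    (h0 : q 0 = E.f x) : (∀ t, 0 ≤ t → t ≤ b → ∃ z, q t = E.f z) ∨
      ∃ s, 0 ≤ s ∧ s < b ∧ (∀ t, 0 ≤ t → t ≤ s → ∃ z, q t = E.f z) ∧ ∀ z, q (s + 1) ≠ E.f z := by
  by_contra hcon
  push Not at hcon
  obtain ⟨⟨t, ht1, ht2, ht3⟩, h2⟩ := hcon
  have key : ∀ n : ℕ, (n : ℤ) ≤ b → ∀ t : ℤ, 0 ≤ t → t ≤ n → ∃ z, q t = E.f z := by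
    intro n
    induction n with
    | zero =>
      intro _ t h1 h3
      obtain rfl : t = 0 := by simp at h3; omega
      exact ⟨x, h0⟩
    | succ n ih =>
      intro hn t h1 h3
      push_cast at hn h3
      rcases h3.eq_or_lt with rfl | h3
      · exact h2 n (by omega) (by omega) (ih (by omega))
      · exact ih (by omega) t h1 (by omega)
  obtain ⟨z, hz⟩ := key b.toNat (by omega) t ht1 (by omega)
  exact ht3 z hz

theorem Closed.of_rev {D : ℤ} {z : Q.T} (h : Q.Closed (PSys.rev lam) D z) : Q.Closed lam D z := by
  obtain ⟨q, h0, h1, h2⟩ := h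
  refine ⟨fun t => q (-t), by simpa using h0, fun t => ?_, fun t => ?_⟩
  · have := (h1 (-t - 1)).symm
    rw [show -t - 1 + 1 = -t by ring] at this
    simp only [PSys.rev, inv_inv] at this
    rw [show -(-t - 1) - 1 = t by ring] at this
    show Q.Step (lam t) (q (-t)) (q (-(t + 1)))
    rwa [show -(t + 1) = -t - 1 by ring]
  · show q (-(t + D)) = q (-t)
    rw [← h2 (-(t + D))]; congr 1; ring

theorem Arc.closed_of (h : Arc E lam D p u0 u1) {v : ℤ} (hl : ∀ t, lam' t = lam (t + v)) {x : Q.T}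
    (hx : p v = E.f x) : Q'.Closed lam' D (E.f x) := by
  refine ⟨fun t => p (t + v), by simpa using hx, fun t => ?_, fun t => ?_⟩
  · have := h.path (t + v)
    rw [hl]
    rwa [show t + v + 1 = t + 1 + v by ring] at this
  · show p (t + D + v) = p (t + v)
    rw [← h.per (t + v)]; congr 1; ring

theorem Arc.bounded_fwd (h : Arc E lam D p u0 u1) (hg : Good lam L) (hg' : Good lam' L)
    (hD : ∀ t, lam (t + D) = lam t)
    (hlong : u1 + L + 1 < u0 + D) {C : ℤ} {z : Q.T}
    (hb : ∀ q b, 0 ≤ b → q 0 = z → Q.IsPath lam' q 0 b → b ≤ C) :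
    Q'.Closed lam' D (E.f z) ∨
      ∀ q b, 0 ≤ b → q 0 = E.f z → Q'.IsPath lam' q 0 b → b ≤ C + L := by
  by_cases hc : Q'.Closed lam' D (E.f z)
  · exact Or.inl hc
  refine Or.inr fun q b hb0 h0 hq => ?_
  have hfi := E.injective (lam 0).1
  have hdesc : ∀ s, 0 ≤ s → s ≤ b → (∀ t, 0 ≤ t → t ≤ s → ∃ z, q t = E.f z) → s ≤ C := by
    intro s hs hsb hr
    obtain ⟨q', hq', hqe⟩ := E.descend (hq.mono le_rfl hsb) hs hr
    refine hb q' s hs (hfi ?_) hq'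
    rw [← hqe 0 le_rfl hs, h0]
  have hL := hg.pos
  rcases E.exit_or hb0 h0 with hr | ⟨s, hs1, hs2, hr, hn⟩
  · have := hdesc b hb0 le_rfl hr
    omega
  have := hdesc s hs1 hs2.le hr
  obtain ⟨y, hy⟩ := hr s hs1 le_rfl
  rcases h.enter hg hg' hD hlong hq hs1 hs2 hy hn with ⟨v, e1, e2⟩ | ⟨v, e1, e2⟩ | ⟨e, -⟩
  · refine absurd (h.closed_of e1 ?_) hc
    rw [← h0, e2 0 le_rfl hb0, zero_add]
  · refine absurd ((h.rev hD).closed_of e1 ?_) hc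
    rw [← h0, e2 0 le_rfl hb0, zero_add]
  · omega

variable {Ξ : Type} {C N : ℤ} {Ref : Ξ → Ξ → ℤ → Prop} {c0 : Ξ → P}
  {rel0 : κ → Ξ → Ξ → Prop} {μ : Ξ → Q.T}

theorem Arc.inv (h : Arc E lam D p u0 u1) (hg : Good lam L) (hN : D = N * L)
    (hlong : u1 + L + 1 < u0 + D) (hI : Inv lam L D C Ref c0 rel0 Q μ) (hfin : Finite Q'.T)
    (hR1 : ∀ x y k k', Ref x y k → k ≡ k' [ZMOD N] → Ref x y k')
    (hR2 : ∀ x y k, Ref x y k → Ref y x (-k)) :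
    Inv lam L D (C + L) Ref c0 rel0 Q' (fun x => E.f (μ x)) := by
  have hL := hg.pos
  have hD : ∀ t, lam (t + D) = lam t := fun t => by rw [hN]; exact per_mul hg.per _ _
  refine ⟨hfin, fun x => by rw [E.c_eq, hI.color], fun i x y hxy => (E.r_iff _ _ _).2
    (hI.rel i x y hxy), ?_, ?_⟩
  · intro x y k q hk h0 h1 hq
    have hkL := mul_nonneg hk hL.le
    have fin : ∀ {lam2 : ℤ → κ × P} {p2 : ℤ → Q'.T} {w0 w1 : ℤ}, Arc E lam2 D p2 w0 w1 →
        Good lam2 L → (∃ v, (∀ t, lam t = lam2 (t + v)) ∧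
          ∀ t, 0 ≤ t → t ≤ k * L → q t = p2 (t + v)) → Ref x y k := by
      intro lam2 p2 w0 w1 h2 hg2 ⟨v, e1, e2⟩
      obtain ⟨k', hkk, ⟨hk', q', a1, a2, a3⟩ | ⟨hk', q', a1, a2, a3⟩⟩ :=
        h2.ref_aux hg2 hN e1 (x := μ x) (y := μ y) (k := k)
          (by rw [← h0, e2 0 le_rfl hkL, zero_add]) (by rw [← h1, e2 _ hkL le_rfl])
      · exact hR1 _ _ _ _ (hI.ref _ _ _ q' hk' a1 a2 a3) hkk.symm
      · refine hR1 _ _ _ _ (hR2 _ _ _ (hI.ref _ _ _ q' (by omega) a1 a2 a3)) ?_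
        rw [neg_neg]; exact hkk.symm
    rcases E.exit_or hkL h0 with hr | ⟨s, hs1, hs2, hr, hn⟩
    · obtain ⟨q', hq', hqe⟩ := E.descend hq hkL hr
      have hfi := E.injective (lam 0).1
      exact hI.ref x y k q' hk (hfi (by rw [← hqe 0 le_rfl hkL, h0]))
        (hfi (by rw [← hqe _ hkL le_rfl, h1])) hq'
    obtain ⟨z, hz⟩ := hr s hs1 le_rfl
    rcases h.enter hg hg hD hlong hq hs1 hs2 hz hn with e | e | ⟨-, e⟩
    · exact fin h hg e
    · exact fin (h.rev hD) hg.rev e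
    · exact absurd h1 (e _ hs2 le_rfl _)
  · intro x
    rcases hI.bd x with hc | hb
    · exact Or.inl (E.closed hc)
    rcases h.bounded_fwd hg hg hD hlong (z := μ x) (C := C)
      (fun q b h1 h2 h3 => (hb q 0 b le_rfl h1 h2 h3).1) with e | e
    · exact Or.inl e
    rcases h.bounded_fwd hg hg.rev hD hlong (z := μ x) (C := C) (fun q b h1 h2 h3 => by
        have := h3.reverse
        rw [rev_rev, neg_zero] at this
        have := (hb _ (-b) 0 (by omega) le_rfl (by simpa using h2) this).2
        omega) with e' | e'
    · exact Or.inl e'.of_rev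
    refine Or.inr fun q a b h1 h2 h3 h4 => ⟨e q b h2 h3 (h4.mono h1 le_rfl), ?_⟩
    have := (h4.mono le_rfl h2).reverse
    rw [neg_zero] at this
    have := e' _ _ (by omega) (by simpa using h3) this
    omega

end arc

end PSys

namespace PSys

variable {κ P : Type} [AddCommGroup P]

theorem exists_potential (lam : ℤ → κ × P) : ∃ Θ : ℤ → P, ∀ t, Θ (t + 1) = Θ t + (lam t).2 := by
  let g : Equiv.Perm (ℤ × P) :=
    { toFun := fun x => (x.1 + 1, x.2 + (lam x.1).2)
      invFun := fun x => (x.1 - 1, x.2 - (lam (x.1 - 1)).2)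
      left_inv := fun x => by simp
      right_inv := fun x => by simp }
  have h1 : ∀ t : ℤ, ((g ^ (t + 1)) (0, 0)) = g ((g ^ t) (0, 0)) := fun t => by
    rw [add_comm, zpow_add, zpow_one]; rfl
  have h2 : ∀ t : ℤ, ((g ^ t) (0, 0)).1 = t := by
    intro t
    induction t using Int.induction_on with
    | zero => rfl
    | succ i ih => rw [h1]; show _ + 1 = _; rw [ih]
    | pred i ih =>
      have := h1 (-(i : ℤ) - 1)
      rw [sub_add_cancel] at this
      rw [this] at ih
      change _ + 1 = _ at ih
      omega
  refine ⟨fun t => ((g ^ t) (0, 0)).2, fun t => ?_⟩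
  show ((g ^ (t + 1)) (0, 0)).2 = _
  rw [h1]
  show _ + (lam ((g ^ t) (0, 0)).1).2 = _
  rw [h2]

theorem potential_per {lam : ℤ → κ × P} {L N : ℤ} (hg : Good lam L) (hN : ∀ x : P, N • x = 0)
    {Θ : ℤ → P} (hΘ : ∀ t, Θ (t + 1) = Θ t + (lam t).2) (t : ℤ) : Θ (t + N * L) = Θ t := by
  have h1 : ∀ t, Θ (t + L) - Θ t = Θ (0 + L) - Θ 0 := fun t => by
    have := per_mul (f := fun t => Θ (t + L) - Θ t) (L := 1) (fun t => by
      show Θ (t + 1 + L) - Θ (t + 1) = _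
      rw [show t + 1 + L = t + L + 1 by ring, hΘ, hΘ, hg.per]; abel) 0 t
    simpa using this
  have h2 : ∀ k : ℤ, Θ (t + k * L) = Θ t + k • (Θ (0 + L) - Θ 0) := by
    intro k
    induction k using Int.induction_on with
    | zero => simp
    | succ i ih =>
      have := h1 (t + i * L)
      rw [show t + ((i : ℤ) + 1) * L = t + i * L + L by ring, add_smul, one_smul,
        eq_add_of_sub_eq this, ih]
      abel
    | pred i ih =>
      have := h1 (t + (-i - 1) * L)
      rw [show t + (-(i : ℤ) - 1) * L + L = t + (-i) * L by ring, ih] at this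
      rw [sub_smul, one_smul]
      rw [sub_eq_iff_eq_add] at this
      rw [← add_sub_assoc, this]
      abel
  rw [h2, hN, add_zero]

section build

variable {Q : PSys κ P} {lam : ℤ → κ × P} {L D : ℤ} {z : Q.T} {q : ℤ → Q.T} {a b : ℤ} {Θ : ℤ → P}

open Classical in
/-- The label of the edge from time `s` to time `s + 1` of a closing arc. -/
noncomputable def edgeLab (Q : PSys κ P) (lam : ℤ → κ × P) (D : ℤ) (q : ℤ → Q.T) (a b s : ℤ) :
    Q.Lab ⊕ (ℤ ⊕ ℤ) :=
  if s = b then Sum.inl (Q.r (lam b).1 (q b)) else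
    if s = a + D - 1 then Sum.inl (Q.r (lam s).1 (q a)) else Sum.inr (Sum.inl s)

open Classical in
/-- The labels at time `t` of a closing arc. -/
noncomputable def arcLab (Q : PSys κ P) (lam : ℤ → κ × P) (D : ℤ) (q : ℤ → Q.T) (a b : ℤ) (i : κ)
    (t : ℤ) : Q.Lab ⊕ (ℤ ⊕ ℤ) :=
  if (lam t).1 = i then edgeLab Q lam D q a b t else
    if (lam (t - 1)).1 = i then edgeLab Q lam D q a b (t - 1) else Sum.inr (Sum.inr t)

theorem edgeLab_eq_inl {κ P : Type} {Q : PSys κ P} {lam : ℤ → κ × P} {D : ℤ} {q : ℤ → Q.T} {a b : ℤ}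
    {s : ℤ} {l : Q.Lab} (h : edgeLab Q lam D q a b s = Sum.inl l) :
    (s = b ∧ l = Q.r (lam b).1 (q b)) ∨ (s = a + D - 1 ∧ l = Q.r (lam s).1 (q a)) := by
  unfold edgeLab at h
  split_ifs at h with h1 h2
  · exact Or.inl ⟨h1, (Sum.inl.inj h).symm⟩
  · exact Or.inr ⟨h2, (Sum.inl.inj h).symm⟩

theorem edgeLab_eq_inr {κ P : Type} {Q : PSys κ P} {lam : ℤ → κ × P} {D : ℤ} {q : ℤ → Q.T} {a b : ℤ}
    {s u : ℤ} (h : edgeLab Q lam D q a b s = Sum.inr (Sum.inl u)) : s = u := by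
  unfold edgeLab at h
  split_ifs at h with h1 h2
  exact Sum.inl.inj (Sum.inr.inj h)

theorem edgeLab_ne {κ P : Type} {Q : PSys κ P} {lam : ℤ → κ × P} {D : ℤ} {q : ℤ → Q.T} {a b : ℤ}
    {s u : ℤ} : edgeLab Q lam D q a b s ≠ Sum.inr (Sum.inr u) := by
  unfold edgeLab
  split_ifs <;> simp

theorem arcLab_cases {κ P : Type} {Q : PSys κ P} {lam : ℤ → κ × P} {D : ℤ} {q : ℤ → Q.T} {a b : ℤ}
    (i : κ) (t : ℤ) :
    (arcLab Q lam D q a b i t = Sum.inr (Sum.inr t) ∧ (lam t).1 ≠ i ∧ (lam (t - 1)).1 ≠ i) ∨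
    ∃ s, arcLab Q lam D q a b i t = edgeLab Q lam D q a b s ∧ (lam s).1 = i ∧
      (s = t ∨ s = t - 1) := by
  unfold arcLab
  split_ifs with h1 h2
  · exact Or.inr ⟨t, rfl, h1, Or.inl rfl⟩
  · exact Or.inr ⟨t - 1, rfl, h2, Or.inr rfl⟩
  · exact Or.inl ⟨rfl, h1, h2⟩

theorem edgeLab_eq {κ P : Type} {Q : PSys κ P} {lam : ℤ → κ × P} {D : ℤ} {q : ℤ → Q.T} {a b : ℤ}
    {s s' : ℤ} (h : edgeLab Q lam D q a b s = edgeLab Q lam D q a b s')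
    (hne : s ≠ s') :
    (s = b ∧ s' = a + D - 1 ∧ Q.r (lam b).1 (q b) = Q.r (lam s').1 (q a)) ∨
      (s' = b ∧ s = a + D - 1 ∧ Q.r (lam b).1 (q b) = Q.r (lam s).1 (q a)) := by
  rcases hs : edgeLab Q lam D q a b s with l | u | u
  · rcases edgeLab_eq_inl hs with ⟨e1, e2⟩ | ⟨e1, e2⟩ <;>
    rcases edgeLab_eq_inl (h.symm.trans hs) with ⟨e3, e4⟩ | ⟨e3, e4⟩
    · omega
    · exact Or.inl ⟨e1, e3, e2.symm.trans e4⟩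
    · exact Or.inr ⟨e3, e1, e4.symm.trans e2⟩
    · omega
  · exact absurd ((edgeLab_eq_inr hs).trans (edgeLab_eq_inr (h.symm.trans hs)).symm) hne
  · exact absurd hs edgeLab_ne

/-- The data for closing up a maximal path. -/
structure ArcData (Q : PSys κ P) (lam : ℤ → κ × P) (L D : ℤ) (z : Q.T) (q : ℤ → Q.T) (a b : ℤ)
    (Θ : ℤ → P) : Prop where
  good : Good lam L
  mp : MaxPath Q lam z q a b
  nc : ¬ Conflict Q lam q a b
  hD : ∀ t, lam (t + D) = lam t
  pot : ∀ t, Θ (t + 1) = Θ t + (lam t).2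
  pot_per : ∀ t, Θ (t + D) = Θ t
  col : ∀ t, a ≤ t → t ≤ b → Q.c (q t) = Θ t
  long : b + 2 < a + D

theorem ArcData.not_inl (h : ArcData Q lam L D z q a b Θ) {i : κ} {x : Q.T} {t : ℤ} (h1 : b < t)
    (h2 : t < a + D) (hr : Sum.inl (Q.r i x) = arcLab Q lam D q a b i t) (hc : Q.c x = Θ t) :
    False := by
  have hab := h.mp.ha.trans h.mp.hb
  rcases arcLab_cases (Q := Q) (lam := lam) (D := D) (q := q) (a := a) (b := b) i t with
    ⟨e, -⟩ | ⟨s, e, e', e''⟩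
  · rw [e] at hr; cases hr
  rcases edgeLab_eq_inl (e ▸ hr.symm) with ⟨rfl, e3⟩ | ⟨rfl, e3⟩
  · obtain rfl : t = s + 1 := by omega
    refine h.mp.fwd x ⟨by rw [← e3, e'], ?_⟩
    rw [hc, h.pot, h.col _ hab le_rfl]
  · obtain rfl : t = a + D - 1 := by omega
    have hl : lam (a - 1) = lam (a + D - 1) := by rw [← h.hD]; congr 1; ring
    have hp : Θ (a - 1) = Θ (a + D - 1) := by rw [← h.pot_per]; congr 1; ring
    refine h.mp.bwd x ⟨by rw [hl, ← e3, e'], ?_⟩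
    rw [hc, ← hp, ← h.pot, h.col _ le_rfl hab]
    congr 1; ring

theorem ArcData.inj_aux (h : ArcData Q lam L D z q a b Θ) {i : κ} {t u : ℤ} (h1 : b < t)
    (h2 : t < a + D) (h3 : b < u) (h4 : u < a + D)
    (hr : arcLab Q lam D q a b i t = arcLab Q lam D q a b i u) (hc : Θ t = Θ u) : t = u := by
  have hab := h.mp.ha.trans h.mp.hb
  have conf : ∀ {t u : ℤ}, t = b + 1 → u = a + D - 1 → Θ t = Θ u → (lam b).1 = i →
      (lam u).1 = i → Q.r (lam b).1 (q b) = Q.r (lam u).1 (q a) → False := by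
    rintro t u rfl rfl hc hb hu hr
    have hl : lam (a - 1) = lam (a + D - 1) := by rw [← h.hD]; congr 1; ring
    have hp : Θ (a - 1) = Θ (a + D - 1) := by rw [← h.pot_per]; congr 1; ring
    refine h.nc ⟨by rw [hl, hb, hu], by rw [hr, hb, hu], ?_⟩
    have e1 := h.pot (a - 1)
    rw [sub_add_cancel] at e1
    rw [h.col _ hab le_rfl, h.col _ le_rfl hab, ← h.pot, hc, e1, hp]
    abel
  rcases arcLab_cases (Q := Q) (lam := lam) (D := D) (q := q) (a := a) (b := b) i t with
    ⟨e, -⟩ | ⟨s, e, e', e''⟩ <;>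
  rcases arcLab_cases (Q := Q) (lam := lam) (D := D) (q := q) (a := a) (b := b) i u with
    ⟨f, -⟩ | ⟨s', f, f', f''⟩
  · rw [e, f] at hr
    exact Sum.inr.inj (Sum.inr.inj hr)
  · rw [e, f] at hr
    exact absurd hr.symm edgeLab_ne
  · rw [e, f] at hr
    exact absurd hr edgeLab_ne
  · rw [e, f] at hr
    by_cases hs : s = s'
    · subst hs
      by_contra hne
      have := h.pot s
      have hz : (lam s).2 = 0 := by
        rcases e'' with rfl | rfl <;> rcases f'' with f | f
        · omega
        · rw [show s + 1 = u by omega, ← hc] at this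
          simpa using this.symm
        · rw [show t - 1 + 1 = t by ring, hc, ← f] at this
          simpa using this.symm
        · omega
      exact h.good.ne _ hz
    · rcases edgeLab_eq hr hs with ⟨g1, g2, g3⟩ | ⟨g1, g2, g3⟩
      · have hu : s' = u := by omega
        subst hu
        exact (conf (by omega) g2 hc (by rw [← g1, e']) f' g3).elim
      · have hu : s = t := by omega
        subst hu
        exact (conf (by omega) g2 hc.symm (by rw [← g1, f']) e' g3).elim

/-- The system obtained by closing up a maximal path with an arc of new points. -/
noncomputable def arcSys (h : ArcData Q lam L D z q a b Θ) : PSys κ P where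
  T := Q.T ⊕ {t : ℤ // b < t ∧ t < a + D}
  Lab := Q.Lab ⊕ (ℤ ⊕ ℤ)
  c := Sum.elim Q.c (fun t => Θ t.1)
  r i := Sum.elim (fun x => Sum.inl (Q.r i x)) (fun t => arcLab Q lam D q a b i t.1)
  inj := by
    intro i x y hr hc
    rcases x with x | ⟨t, ht⟩ <;> rcases y with y | ⟨u, hu⟩
    · rw [Q.inj i x y (Sum.inl.inj hr) hc]
    · exact (h.not_inl hu.1 hu.2 hr hc).elim
    · exact (h.not_inl ht.1 ht.2 hr.symm hc.symm).elim
    · congr 1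
      exact Subtype.ext (h.inj_aux ht.1 ht.2 hu.1 hu.2 hr hc)

/-- The inclusion of the old system. -/
noncomputable def arcEmb (h : ArcData Q lam L D z q a b Θ) : Emb Q (arcSys h) where
  f := Sum.inl
  c_eq _ := rfl
  r_iff _ _ _ := ⟨fun e => Sum.inl.inj e, fun e => congrArg Sum.inl e⟩

open Classical in
/-- The point at a time in the fundamental interval of the closed path through the new points. -/
noncomputable def arcPt (Q : PSys κ P) (D : ℤ) (q : ℤ → Q.T) (a b t : ℤ) :
    Q.T ⊕ {t : ℤ // b < t ∧ t < a + D} :=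
  if ht : b < t ∧ t < a + D then Sum.inr ⟨t, ht⟩ else Sum.inl (q t)

/-- The closed path through the new points. -/
noncomputable def arcPath (h : ArcData Q lam L D z q a b Θ) (t : ℤ) : (arcSys h).T :=
  arcPt Q D q a b (a + (t - a) % D)

theorem arcPath_old (h : ArcData Q lam L D z q a b Θ) {t : ℤ} (h1 : a ≤ t) (h2 : t ≤ b) :
    arcPath h t = Sum.inl (q t) := by
  have hlong := h.long
  have e : a + (t - a) % D = t := by rw [Int.emod_eq_of_lt (by omega) (by omega)]; ring
  show arcPt Q D q a b _ = _
  rw [e]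
  exact dif_neg (by omega)

theorem arcPath_new (h : ArcData Q lam L D z q a b Θ) {t : ℤ} (h1 : b < t) (h2 : t < a + D) :
    arcPath h t = Sum.inr ⟨t, h1, h2⟩ := by
  have hlong := h.long
  have hab := h.mp.ha.trans h.mp.hb
  have e : a + (t - a) % D = t := by rw [Int.emod_eq_of_lt (by omega) (by omega)]; ring
  show arcPt Q D q a b _ = _
  rw [e]
  exact dif_pos ⟨h1, h2⟩

theorem arcPath_per (h : ArcData Q lam L D z q a b Θ) (t : ℤ) :
    arcPath h (t + D) = arcPath h t := by
  have : (t + D - a) % D = (t - a) % D := by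
    rw [show t + D - a = t - a + D by ring, Int.add_emod_right]
  show arcPt Q D q a b _ = arcPt Q D q a b _
  rw [this]

theorem arcLab_self {κ P : Type} {Q : PSys κ P} {lam : ℤ → κ × P} {D : ℤ} {q : ℤ → Q.T} {a b : ℤ}
    (t : ℤ) :
    arcLab Q lam D q a b (lam t).1 t = edgeLab Q lam D q a b t := by
  unfold arcLab; rw [if_pos rfl]

theorem arcLab_prev (h : ArcData Q lam L D z q a b Θ) (t : ℤ) :
    arcLab Q lam D q a b (lam t).1 (t + 1) = edgeLab Q lam D q a b t := by
  unfold arcLab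
  rw [if_neg (h.good.adj t), add_sub_cancel_right, if_pos rfl]

theorem arcPath_step (h : ArcData Q lam L D z q a b Θ) (t : ℤ) :
    (arcSys h).Step (lam t) (arcPath h t) (arcPath h (t + 1)) := by
  have hlong := h.long
  have hab := h.mp.ha.trans h.mp.hb
  have key : ∀ t, a ≤ t → t < a + D →
      (arcSys h).Step (lam t) (arcPath h t) (arcPath h (t + 1)) := by
    intro t h1 h2
    rcases lt_trichotomy t b with h3 | rfl | h3
    · rw [arcPath_old h h1 h3.le, arcPath_old h (by omega) (by omega)]
      exact ((arcEmb h).step_iff _ _ _).2 (h.mp.path t h1 h3)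
    · rw [arcPath_old h h1 le_rfl, arcPath_new h (by omega) (by omega)]
      refine ⟨?_, ?_⟩
      · show Sum.inl _ = arcLab Q lam D q a t _ _
        rw [arcLab_prev h, edgeLab, if_pos rfl]
      · show Θ _ = Q.c _ + _
        rw [h.pot, h.col _ hab le_rfl]
    · rw [arcPath_new h h3 h2]
      by_cases h4 : t + 1 < a + D
      · rw [arcPath_new h (by omega) h4]
        refine ⟨?_, h.pot t⟩
        show arcLab Q lam D q a b _ _ = arcLab Q lam D q a b _ _
        rw [arcLab_prev h, arcLab_self]
      · obtain rfl : t = a + D - 1 := by omega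
        have e : arcPath h (a + D - 1 + 1) = Sum.inl (q a) := by
          rw [show a + D - 1 + 1 = a + D by ring, arcPath_per, arcPath_old h le_rfl hab]
        rw [e]
        refine ⟨?_, ?_⟩
        · show arcLab Q lam D q a b _ _ = Sum.inl _
          rw [arcLab_self, edgeLab, if_neg (by omega), if_pos rfl]
        · show Q.c _ = Θ _ + _
          rw [← h.pot, h.col _ le_rfl hab, ← h.pot_per]
          congr 1; ring
  have hD0 : 0 < D := by omega
  have e := Int.emod_add_mul_ediv (t - a) D
  have e1 := Int.emod_nonneg (t - a) hD0.ne'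
  have e2 := Int.emod_lt_of_pos (t - a) hD0
  have := key (a + (t - a) % D) (by omega) (by omega)
  have ht : D ∣ t - (a + (t - a) % D) := ⟨(t - a) / D, by linarith⟩
  have ht' : D ∣ t + 1 - (a + (t - a) % D + 1) := ⟨(t - a) / D, by linarith⟩
  rw [per_dvd h.hD ht, per_dvd (arcPath_per h) ht, per_dvd (arcPath_per h) ht']
  exact this

theorem arc_built (h : ArcData Q lam L D z q a b Θ) :
    Arc (arcEmb h) lam D (arcPath h) a b := by
  have hlong := h.long
  have hab := h.mp.ha.trans h.mp.hb
  have hlabel : ∀ (i : κ) (t : ℤ) (y : (arcSys h).T),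
      (arcSys h).r i (arcPath h t) = (arcSys h).r i y →
      b < t → t < a + D → (∃ s, (lam s).1 = i ∧ (s = t ∨ s = t - 1) ∧
        arcLab Q lam D q a b i t = edgeLab Q lam D q a b s) ∨ y = arcPath h t := by
    intro i t y hy h1 h2
    rw [arcPath_new h h1 h2] at hy ⊢
    rcases arcLab_cases (Q := Q) (lam := lam) (D := D) (q := q) (a := a) (b := b) i t with
      ⟨e, -⟩ | ⟨s, e, e', e''⟩
    · right
      change arcLab Q lam D q a b i t = _ at hy
      rw [e] at hy
      rcases y with y | ⟨u, hu⟩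
      · cases hy
      · change _ = arcLab Q lam D q a b i u at hy
        rcases arcLab_cases (Q := Q) (lam := lam) (D := D) (q := q) (a := a) (b := b) i u with
          ⟨f, -⟩ | ⟨s', f, f', f''⟩
        · rw [f] at hy
          congr 1
          exact Subtype.ext (Sum.inr.inj (Sum.inr.inj hy)).symm
        · rw [f] at hy
          exact absurd hy.symm edgeLab_ne
    · exact Or.inl ⟨s, e', e'', e⟩
  have hmid : ∀ (i : κ) (s : ℤ) (y : (arcSys h).T), b < s → s + 1 < a + D →
      edgeLab Q lam D q a b s = (arcSys h).r i y → y = arcPath h s ∨ y = arcPath h (s + 1) := by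
    intro i s y h1 h2 hy
    have e0 : edgeLab Q lam D q a b s = Sum.inr (Sum.inl s) := by
      rw [edgeLab, if_neg (by omega), if_neg (by omega)]
    rw [e0] at hy
    rcases y with y | ⟨u, hu⟩
    · cases hy
    · change _ = arcLab Q lam D q a b i u at hy
      rcases arcLab_cases (Q := Q) (lam := lam) (D := D) (q := q) (a := a) (b := b) i u with
        ⟨f, -⟩ | ⟨s', f, f', f''⟩
      · rw [f] at hy
        cases Sum.inr.inj hy
      · rw [f] at hy
        have hss := edgeLab_eq_inr hy.symm
        rw [← arcPath_new h hu.1 hu.2]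
        rcases f'' with g | g
        · exact Or.inl (by congr 1; omega)
        · exact Or.inr (by congr 1; omega)
  refine ⟨hab, by omega, arcPath_step h, arcPath_per h, fun t h1 h2 => ⟨_, arcPath_old h h1 h2⟩,
    ?_, ?_, ?_,
    ?_, ?_⟩
  · intro t h1 h2 z hz
    rw [arcPath_new h h1 h2] at hz
    cases hz
  · rintro (y | ⟨u, hu⟩)
    · exact Or.inl ⟨y, rfl⟩
    · exact Or.inr ⟨u, hu.1, hu.2, (arcPath_new h hu.1 hu.2).symm⟩
  · intro t h1 h2 l y hl hs
    rcases hlabel _ t y hs.1 h1 h2 with ⟨s, e, rfl | rfl, -⟩ | rfl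
    · exact Or.inl e.symm
    · exact Or.inr e.symm
    · exact absurd (by simpa using hs.2) hl
  · intro t h1 h2 l y hl hs ht
    have hr := hs.1
    rw [arcPath_new h h1 (by omega)] at hr
    change arcLab Q lam D q a b l.1 t = _ at hr
    nth_rw 1 [ht] at hr
    rw [arcLab_self] at hr
    rcases hmid _ t y h1 h2 hr with rfl | rfl
    · exact absurd (by simpa using hs.2) hl
    · rfl
  · intro t h1 h2 l y hl hs ht
    have hr := hs.1
    rw [arcPath_new h (by omega) h2] at hr
    change arcLab Q lam D q a b l.1 t = _ at hr
    have e := arcLab_prev h (t - 1)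
    rw [sub_add_cancel] at e
    nth_rw 1 [ht] at hr
    rw [e] at hr
    rcases hmid _ (t - 1) y h1 (by omega) hr with rfl | rfl
    · rfl
    · rw [sub_add_cancel] at hs
      exact absurd (by simpa using hs.2) hl

end build

section closing

variable {Ξ : Type} {lam : ℤ → κ × P} {L D C N : ℤ} {Ref : Ξ → Ξ → ℤ → Prop} {c0 : Ξ → P}
  {rel0 : κ → Ξ → Ξ → Prop} {Q : PSys κ P} {μ : Ξ → Q.T}

/-- One round of the closing process. -/
theorem close_one (hg : Good lam L) (hC : 0 ≤ C) (hN : D = N * L) (hP : ∀ x : P, N • x = 0)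
    (hlong : 2 * (C + L + 1) + L + 2 < D) (hI : Inv lam L D C Ref c0 rel0 Q μ)
    (hR1 : ∀ x y k k', Ref x y k → k ≡ k' [ZMOD N] → Ref x y k')
    (hR2 : ∀ x y k, Ref x y k → Ref y x (-k)) (x0 : Ξ) (hx : Q.Bounded lam C (μ x0)) :
    ∃ (Q' : PSys κ P) (μ' : Ξ → Q'.T), Inv lam L D (C + 2 * L + 1) Ref c0 rel0 Q' μ' ∧
      (∀ x, Q.Closed lam D (μ x) → Q'.Closed lam D (μ' x)) ∧ Q'.Closed lam D (μ' x0) := by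
  obtain ⟨Q₁, μ₁, q, a, b, hI₁, hcl, hbd, hmp, hnc⟩ := exists_no_conflict hg hC hI x0 hx
  obtain ⟨Θ, hΘ⟩ := exists_potential lam
  have hab := hbd q a b hmp.ha hmp.hb hmp.h0 hmp.path
  have hD : ∀ t, lam (t + D) = lam t := fun t => by rw [hN]; exact per_mul hg.per _ _
  have hL := hg.pos
  have h : ArcData Q₁ lam L D (μ₁ x0) q a b (fun t => Θ t + (Q₁.c (q a) - Θ a)) :=
    ⟨hg, hmp, hnc, hD, fun t => by rw [hΘ]; abel, fun t => by
      rw [hN, potential_per hg hP hΘ], fun t h1 h2 => by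
        have := hmp.path.color hΘ t h1 h2
        rw [← this]; abel, by omega⟩
  have hA := arc_built h
  have hinv := hA.inv hg hN (by omega) hI₁ (by
    have := hI₁.fin
    have : Finite {t : ℤ // b < t ∧ t < a + D} := Set.finite_Ioo b (a + D)
    exact inferInstanceAs (Finite (Q₁.T ⊕ {t : ℤ // b < t ∧ t < a + D}))) hR1 hR2
  refine ⟨arcSys h, fun x => (arcEmb h).f (μ₁ x), ?_, fun x hx => (arcEmb h).closed (hcl x hx), ?_⟩
  · rwa [show C + 2 * L + 1 = C + L + 1 + L by ring]
  · refine hA.closed_of (v := 0) (by simp) ?_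
    rw [arcPath_old h hmp.ha hmp.hb, hmp.h0]
    rfl

/-- All marked points can be put on closed paths. -/
theorem close_all [Finite Ξ] (hg : Good lam L) (hC : 0 ≤ C) (hN : D = N * L)
    (hP : ∀ x : P, N • x = 0)
    (hlong : 2 * (C + (Nat.card Ξ + 1) * (2 * L + 1)) + L + 2 < D)
    (hI : Inv lam L D C Ref c0 rel0 Q μ)
    (hR1 : ∀ x y k k', Ref x y k → k ≡ k' [ZMOD N] → Ref x y k')
    (hR2 : ∀ x y k, Ref x y k → Ref y x (-k)) :
    ∃ (Q' : PSys κ P) (μ' : Ξ → Q'.T) (C' : ℤ), Inv lam L D C' Ref c0 rel0 Q' μ' ∧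
      ∀ x, Q'.Closed lam D (μ' x) := by
  classical
  have hL := hg.pos
  have key : ∀ (n : ℕ) (C : ℤ) (Q : PSys κ P) (μ : Ξ → Q.T), 0 ≤ C →
      Inv lam L D C Ref c0 rel0 Q μ → Nat.card {x // ¬ Q.Closed lam D (μ x)} ≤ n →
      2 * (C + (n + 1) * (2 * L + 1)) + L + 2 < D →
      ∃ (Q' : PSys κ P) (μ' : Ξ → Q'.T) (C' : ℤ), Inv lam L D C' Ref c0 rel0 Q' μ' ∧
        ∀ x, Q'.Closed lam D (μ' x) := by
    intro n
    induction n with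
    | zero =>
      intro C Q μ hC hI hn _
      refine ⟨Q, μ, C, hI, fun x => ?_⟩
      by_contra hx
      have : Nat.card {x // ¬ Q.Closed lam D (μ x)} = 0 := by omega
      rw [Finite.card_eq_zero_iff] at this
      exact this.false ⟨x, hx⟩
    | succ n ih =>
      intro C Q μ hC hI hn hD
      by_cases hall : ∀ x, Q.Closed lam D (μ x)
      · exact ⟨Q, μ, C, hI, hall⟩
      push Not at hall
      obtain ⟨x0, hx0⟩ := hall
      have hb := (hI.bd x0).resolve_left hx0
      have hpos : 0 ≤ ((n : ℤ) + 1) * (2 * L + 1) := by positivity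
      push_cast at hD
      obtain ⟨Q', μ', hI', hcl, hx0'⟩ := close_one hg hC hN hP (by nlinarith) hI hR1 hR2 x0 hb
      refine ih _ Q' μ' (by omega) hI' ?_ (by nlinarith)
      have hlt : Nat.card {x // ¬ Q'.Closed lam D (μ' x)} <
          Nat.card {x // ¬ Q.Closed lam D (μ x)} := by
        show Nat.card ({x | ¬ Q'.Closed lam D (μ' x)} : Set Ξ) <
          Nat.card ({x | ¬ Q.Closed lam D (μ x)} : Set Ξ)
        refine Set.ncard_lt_ncard ?_ (Set.toFinite _)
        refine ⟨fun x hx hx' => hx (hcl x hx'), fun hsub => hsub hx0 hx0'⟩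
      omega
  refine key (Nat.card Ξ) C Q μ hC hI ?_ hlong
  exact Nat.card_le_card_of_injective _ Subtype.val_injective

end closing

end PSys

namespace PSys

variable {κ P : Type} [AddCommGroup P] {Q : PSys κ P} {lam : ℤ → κ × P} {L D N : ℤ}

/-- A path that returns to its starting point after a multiple of the period gives a closed path. -/
theorem exists_closed_path (hg : Good lam L) {q : ℤ → Q.T} {s d : ℤ} (hd : 0 < d) (hL : L ∣ d)
    (hq : Q.IsPath lam q s (s + d)) (he : q (s + d) = q s) :
    ∃ p : ℤ → Q.T, p s = q s ∧ (∀ t, Q.Step (lam t) (p t) (p (t + 1))) ∧ ∀ t, p (t + d) = p t := by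
  have hld : ∀ t, lam (t + d) = lam t := by
    obtain ⟨k, rfl⟩ := hL
    intro t
    rw [mul_comm]
    exact per_mul hg.per t k
  refine ⟨fun t => q (s + (t - s) % d), by simp, fun t => ?_, fun t => ?_⟩
  · have e := Int.emod_add_mul_ediv (t - s) d
    have e1 := Int.emod_nonneg (t - s) hd.ne'
    have e2 := Int.emod_lt_of_pos (t - s) hd
    have h1 := hq (s + (t - s) % d) (by omega) (by omega)
    have h2 : lam t = lam (s + (t - s) % d) :=
      per_dvd hld ⟨(t - s) / d, by linarith⟩
    show Q.Step (lam t) (q (s + (t - s) % d)) (q (s + (t + 1 - s) % d))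
    rw [h2]
    have h3 : (t + 1 - s) % d = ((t - s) % d + 1) % d := by
      rw [Int.emod_add_emod]; congr 1; ring
    rw [h3]
    by_cases h4 : (t - s) % d + 1 = d
    · rw [h4, Int.emod_self, add_zero, ← he]
      rwa [add_assoc, h4] at h1
    · rw [Int.emod_eq_of_lt (a := (t - s) % d + 1) (by omega) (by omega), ← add_assoc]
      exact h1
  · show q (s + (t + d - s) % d) = q (s + (t - s) % d)
    rw [show t + d - s = t - s + d by ring, Int.add_emod_right]

theorem closed_of_long [Finite Q.T] (hg : Good lam L) (hN : D = N * L)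
    (hf : ((Nat.card Q.T).factorial : ℤ) ∣ N) {q : ℤ → Q.T} {b : ℤ}
    (hb : Nat.card Q.T * L ≤ b) (hq : Q.IsPath lam q 0 b) : Q.Closed lam D (q 0) := by
  have hL := hg.pos
  have : Fintype Q.T := Fintype.ofFinite _
  rw [Nat.card_eq_fintype_card] at hf hb
  obtain ⟨i, j, hij, he⟩ := Fintype.exists_ne_map_eq_of_card_lt
    (fun i : Fin (Fintype.card Q.T + 1) => q ((i : ℕ) * L)) (by simp)
  wlog hlt : i < j generalizing i j
  · exact this j i hij.symm he.symm (lt_of_le_of_ne (not_lt.1 hlt) hij.symm)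
  have hlt' : ((i : ℕ) : ℤ) < (j : ℕ) := by exact_mod_cast hlt
  have hjn : ((j : ℕ) : ℤ) ≤ Fintype.card Q.T := by
    have := j.2; omega
  have hi0 : 0 ≤ ((i : ℕ) : ℤ) * L := by positivity
  have hjb : ((j : ℕ) : ℤ) * L ≤ b := (mul_le_mul_of_nonneg_right hjn hL.le).trans hb
  set d : ℤ := (((j : ℕ) : ℤ) - (i : ℕ)) with hd
  have hsd : ((i : ℕ) : ℤ) * L + d * L = (j : ℕ) * L := by rw [hd]; ring
  have hpos : 0 < d * L := by apply mul_pos _ hL; omega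
  obtain ⟨p, p1, p2, p3⟩ := exists_closed_path hg (q := q) (s := (i : ℕ) * L) (d := d * L) hpos
    (Dvd.intro_left _ rfl) (hq.mono hi0 (by rw [hsd]; exact hjb)) (by rw [hsd]; exact he.symm)
  have hdN : d ∣ N := by
    refine dvd_trans ?_ hf
    have : d = ((j : ℕ) - (i : ℕ) : ℕ) := by
      rw [Nat.cast_sub (by omega)]
    rw [this]
    exact_mod_cast Nat.dvd_factorial (by omega) (by omega)
  refine ⟨p, ?_, p2, fun t => ?_⟩
  · exact (IsPath.unique (s := (i : ℕ) * L) hq (fun t _ _ => p2 t) hi0 (by linarith) p1.symm 0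
        le_rfl
      (by linarith)).symm
  · obtain ⟨k, rfl⟩ := hdN
    rw [hN, show d * k * L = k * (d * L) by ring]
    exact per_mul p3 t k

theorem closed_or_bounded [Finite Q.T] (hg : Good lam L) (hN : D = N * L)
    (hf : ((Nat.card Q.T).factorial : ℤ) ∣ N) (z : Q.T) :
    Q.Closed lam D z ∨ Q.Bounded lam (Nat.card Q.T * L) z := by
  by_cases hc : Q.Closed lam D z
  · exact Or.inl hc
  refine Or.inr fun q a b ha hb h0 hq => ⟨?_, ?_⟩
  · by_contra hlt
    exact hc (h0 ▸ closed_of_long hg hN hf (by omega) (hq.mono ha le_rfl))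
  · by_contra hlt
    have := (hq.mono le_rfl hb).reverse
    rw [neg_zero] at this
    have := (closed_of_long hg.rev hN hf (by omega) this).of_rev
    rw [neg_zero, h0] at this
    exact hc this

end PSys

theorem exists_perm_extending {T : Type*} [Finite T] (s : Set T) (f : T → T) (hf : Set.InjOn f s) :
    ∃ b : Equiv.Perm T, ∀ x ∈ s, b x = f x := by
  classical
  have := Fintype.ofFinite T
  let e : {x // x ∈ s} ≃ {x // x ∈ f '' s} := Equiv.Set.imageOfInjOn f s hf
  refine ⟨e.extendSubtype, fun x hx => ?_⟩
  rw [Equiv.extendSubtype_apply_of_mem _ _ hx]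
  rfl

/-- A permutation agrees on a finite set with a permutation of finite order. -/
theorem exists_finite_order_perm {X : Type*} (α : Equiv.Perm X) (F : Set X) (hF : F.Finite) :
    ∃ (α' : Equiv.Perm X) (n : ℕ), 0 < n ∧ α' ^ n = 1 ∧ ∀ x ∈ F, α' x = α x := by
  classical
  have hG : (F ∪ α '' F).Finite := hF.union (hF.image _)
  have := hG.to_subtype
  have hmem : ∀ x : ↥(F ∪ α '' F), (x : X) ∈ F → α x ∈ F ∪ α '' F := fun x hx =>
    Or.inr ⟨x, hx, rfl⟩
  obtain ⟨b, hb⟩ := exists_perm_extending (T := ↥(F ∪ α '' F)) {x | (x : X) ∈ F}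
    (fun x => if hx : (x : X) ∈ F then ⟨α x, hmem x hx⟩ else x) (by
      intro x hx y hy h
      simp only [Set.mem_ofPred_eq] at hx hy
      simp only [hx, hy, dif_pos] at h
      exact Subtype.ext (α.injective (congrArg Subtype.val h)))
  obtain ⟨n, hn, h1⟩ := (isOfFinOrder_iff_pow_eq_one).1 (isOfFinOrder_of_finite b)
  refine ⟨Equiv.Perm.ofSubtype b, n, hn, by rw [← map_pow, h1, map_one], fun x hx => ?_⟩
  rw [Equiv.Perm.ofSubtype_apply_of_mem b (Or.inl hx : x ∈ F ∪ α '' F), hb _ hx]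
  simp [hx]

theorem exists_periodic_perm {X : Type*} (α : Equiv.Perm X) (e : ℕ) (he : α ^ e = 1) (F : Set X)
    (hF : F.Finite) (B : ℕ) : ∃ (α' : Equiv.Perm X) (E : ℕ), 0 < E ∧ α' ^ E = 1 ∧
      (e = 0 → B < E) ∧ (e ≠ 0 → E = e) ∧
      ∀ x ∈ F, ∀ m : ℤ, |m| ≤ B → (α' ^ m) x = (α ^ m) x := by
  rcases eq_or_ne e 0 with rfl | hne
  · obtain ⟨α', n, hn, h1, h2⟩ := exists_finite_order_perm α
      (⋃ m ∈ Set.Icc (-(B : ℤ)) B, (α ^ m) '' F)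
      ((Set.finite_Icc _ _).biUnion fun m _ => hF.image _)
    have h2' : ∀ x ∈ F, ∀ m : ℤ, |m| ≤ B → α' ((α ^ m) x) = (α ^ (m + 1)) x := by
      intro x hx m hm
      rw [h2 _ (Set.mem_biUnion (abs_le.1 hm) ⟨x, hx, rfl⟩), add_comm, zpow_add, zpow_one]
      rfl
    refine ⟨α', n * (B + 1), by positivity, by rw [pow_mul, h1, one_pow], fun _ => by nlinarith,
      fun h => absurd rfl h, fun x hx m => ?_⟩
    induction m using Int.induction_on with
    | zero => simp
    | succ i ih =>
      intro hm
      rw [abs_of_nonneg (by positivity)] at hm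
      have := ih (by rw [abs_of_nonneg (by positivity)]; omega)
      rw [add_comm, zpow_add, zpow_one, Equiv.Perm.mul_apply, this, h2' x hx _
        (by rw [abs_of_nonneg (by positivity)]; omega), add_comm]
    | pred i ih =>
      intro hm
      rw [abs_of_nonpos (by omega)] at hm
      have := ih (by rw [abs_of_nonpos (by omega)]; omega)
      have h3 := h2' x hx (-i - 1) (by rw [abs_of_nonpos (by omega)]; omega)
      rw [sub_add_cancel, ← this] at h3
      rw [sub_eq_add_neg, add_comm, zpow_add, Equiv.Perm.mul_apply, ← h3, zpow_neg, zpow_one,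
        Equiv.Perm.inv_def, Equiv.symm_apply_apply, sub_eq_add_neg, add_comm]
  · exact ⟨α, e, Nat.pos_of_ne_zero hne, he, fun h => absurd h hne, fun _ => rfl,
      fun _ _ _ _ => rfl⟩

namespace PSys

variable {κ P : Type} [AddCommGroup P]

/-- Every finite partial system is completed by an action on the set of functions from colours to
points. -/
theorem exists_section_action (Q : PSys κ P) [Finite Q.T] [Nonempty Q.T] (σ : κ → P) :
    ∃ β : κ → Equiv.Perm (P → Q.T), (∀ i (E : ℕ), E • σ i = 0 → β i ^ E = 1) ∧
      ∀ i (m : ℤ) (g g' : P → Q.T), (∀ p, Q.c (g p) = p) → (∀ p, Q.c (g' p) = p) →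
        (∀ p, Q.r i (g (p - m • σ i)) = Q.r i (g' p)) → (β i ^ m) g = g' := by
  let rep : κ → Q.T → Q.T := fun i x => Function.invFun (Q.r i) (Q.r i x)
  have hrep : ∀ i x, Q.r i (rep i x) = Q.r i x := fun i x => Function.invFun_eq ⟨x, rfl⟩
  have hb : ∀ i p, ∃ b : Equiv.Perm Q.T, ∀ x ∈ {x | Q.c x = p}, b x = rep i x := by
    intro i p
    refine exists_perm_extending _ _ fun x hx y hy h => ?_
    refine Q.inj i x y ?_ (hx.trans hy.symm)
    rw [← hrep i x, ← hrep i y]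
    exact congrArg _ h
  choose b hb using hb
  let τ : P → Equiv.Perm (P → Q.T) := fun v => Equiv.arrowCongr (Equiv.addRight v) (Equiv.refl _)
  have hτ : ∀ v g p, τ v g p = g (p - v) := fun v g p => by
    simp [τ, Equiv.arrowCongr, sub_eq_add_neg]
  have hτ' : ∀ v (m : ℤ) g p, (τ v ^ m) g p = g (p - m • v) := by
    intro v m
    induction m using Int.induction_on with
    | zero => simp
    | succ i ih =>
      intro g p
      rw [zpow_add, zpow_one, Equiv.Perm.mul_apply, ih, hτ, add_smul, one_smul, sub_sub]
    | pred i ih =>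
      intro g p
      have h := ih ((τ v)⁻¹ g) p
      rw [sub_eq_add_neg, zpow_add, zpow_neg_one, Equiv.Perm.mul_apply, h]
      have h2 := hτ v ((τ v)⁻¹ g) (p - (-(i : ℤ) + -1) • v)
      rw [show τ v ((τ v)⁻¹ g) = g from (τ v).apply_symm_apply g] at h2
      rw [h2, add_smul, neg_one_smul]
      refine congrArg _ ?_
      abel
  let B : κ → Equiv.Perm (P → Q.T) := fun i => Equiv.piCongrRight (b i)
  have hpow : ∀ i (m : ℤ), ((B i)⁻¹ * τ (σ i) * B i) ^ m = (B i)⁻¹ * τ (σ i) ^ m * B i := by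
    intro i m
    have := conj_zpow (a := (B i)⁻¹) (b := τ (σ i)) (i := m)
    rwa [_root_.inv_inv] at this
  refine ⟨fun i => (B i)⁻¹ * τ (σ i) * B i, fun i E hE => ?_, fun i m g g' hg hg' h => ?_⟩
  · have h1 : τ (σ i) ^ (E : ℤ) = 1 := by
      ext g p
      rw [hτ', natCast_zsmul, hE, sub_zero]
      rfl
    have := hpow i E
    rw [h1, mul_one, inv_mul_cancel, zpow_natCast] at this
    exact this
  · rw [hpow, Equiv.Perm.mul_apply, Equiv.Perm.mul_apply, Equiv.Perm.inv_eq_iff_eq]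
    funext p
    rw [hτ']
    show b i _ (g _) = b i p (g' p)
    rw [hb i _ _ (hg _), hb i _ _ (hg' _)]
    show Function.invFun _ _ = Function.invFun _ _
    rw [h]

end PSys

/-- The product of the first `k` syllables of `s`, the later ones on the left. -/
def sylWord {κ : Type*} (s : ℤ → κ × ℤ) : ℕ → FreeGroup κ
  | 0 => 1
  | k + 1 => FreeGroup.of (s k).1 ^ (s k).2 * sylWord s k

theorem sylWord_mul {κ : Type*} {s : ℤ → κ × ℤ} {L : ℕ} (hper : ∀ t, s (t + L) = s t) (k : ℕ) :
    sylWord s (k * L) = sylWord s L ^ k := by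
  have h : ∀ k j : ℕ, sylWord s (j + k * L) = sylWord s j * sylWord s (k * L) := by
    intro k j
    induction j with
    | zero => simp [sylWord]
    | succ j ih =>
      have hs : s ((j + k * L : ℕ) : ℤ) = s j := by
        push_cast
        exact PSys.per_mul hper j k
      rw [show j + 1 + k * L = (j + k * L) + 1 by ring, sylWord, hs, ih, sylWord, mul_assoc]
  induction k with
  | zero => simp [sylWord]
  | succ k ih => rw [show (k + 1) * L = L + k * L by ring, h, ih, pow_succ']

/-- The action `β` with the map `f` is a model, on the set `S` and for the word `W`, of the
action `α`: it satisfies the same torsion relations, agrees with `α` on `S`, the `W`-orbits of the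
points of `S` have length dividing `N` and meet `S` only as forced. -/
structure IsModel {κ : Type*} {X Y : Type*} (e : κ → ℕ) (α : κ → Equiv.Perm X)
    (W : FreeGroup κ) (S : Set X) (N : ℕ) (β : κ → Equiv.Perm Y) (f : X → Y) : Prop where
  tors : ∀ i, β i ^ e i = 1
  compat : ∀ i, ∀ x ∈ S, α i x ∈ S → f (α i x) = β i (f x)
  per : ∀ x ∈ S, (FreeGroup.lift β W ^ N) (f x) = f x
  sep : ∀ x ∈ S, ∀ y ∈ S, ∀ k : ℤ, (FreeGroup.lift β W ^ k) (f x) = f y →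
    ∃ k', k' ≡ k [ZMOD N] ∧ (FreeGroup.lift α W ^ k') x = y

theorem exists_model_of_reduced {κ : Type} [Finite κ] (e : κ → ℕ) (s : ℤ → κ × ℤ) (L : ℕ)
    (hL : 0 < L) (hper : ∀ t, s (t + L) = s t) (hadj : ∀ t, (s (t + 1)).1 ≠ (s t).1)
    (hne : ∀ t, ¬ (e (s t).1 : ℤ) ∣ (s t).2) {X : Type} (α : κ → Equiv.Perm X)
    (hα : ∀ i, α i ^ e i = 1) (S : Set X) (hS : S.Finite) (hSn : S.Nonempty) :
    ∃ M : ℕ, 0 < M ∧ ∀ N : ℕ, 0 < N → M ∣ N → ∃ (Y : Type) (_ : Finite Y)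
      (β : κ → Equiv.Perm Y) (f : X → Y), IsModel e α (sylWord s L) S N β f := by
  classical
  have hL' : (0 : ℤ) < L := by exact_mod_cast hL
  set B : ℕ := 1 + ∑ t ∈ Finset.range L, (s t).2.natAbs with hB
  have hBs : ∀ t, |(s t).2| ≤ B := by
    intro t
    have h1 : s t = s ((t % L).toNat : ℤ) := by
      rw [Int.toNat_of_nonneg (Int.emod_nonneg _ hL'.ne')]
      refine PSys.per_dvd hper ⟨t / L, ?_⟩
      have := Int.emod_add_mul_ediv t L
      linarith
    have h2 : (t % L).toNat < L := by
      have := Int.emod_lt_of_pos t hL'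
      have := Int.emod_nonneg t hL'.ne'
      omega
    have h3 : (s ((t % L).toNat : ℤ)).2.natAbs ≤ ∑ t ∈ Finset.range L, (s t).2.natAbs :=
      Finset.single_le_sum (f := fun t : ℕ => (s t).2.natAbs) (fun _ _ => Nat.zero_le _)
      (Finset.mem_range.2 h2)
    rw [h1, Int.abs_eq_natAbs]
    omega
  choose α' E hE hα'E hE0 hE1 hα' using fun i => exists_periodic_perm (α i) (e i) (hα i) S hS B
  have : ∀ i, NeZero (E i) := fun i => ⟨(hE i).ne'⟩
  let P : Type := ∀ i, ZMod (E i)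
  have : Finite P := Pi.finite
  let σ : κ → P := fun i => Pi.single i 1
  have hσ : ∀ i (m : ℤ), m • σ i = 0 ↔ (E i : ℤ) ∣ m := by
    intro i m
    rw [← ZMod.intCast_zmod_eq_zero_iff_dvd]
    have hs : ∀ j, (m • σ i) j = m • (Pi.single i (1 : ZMod (E i)) : ∀ i, ZMod (E i)) j :=
      fun j => rfl
    constructor
    · intro h
      have := congrFun h i
      rw [hs, Pi.single_eq_same, zsmul_one] at this
      exact this
    · intro h
      funext j
      rw [hs]
      by_cases hj : j = i
      · subst hj
        rw [Pi.single_eq_same, zsmul_one, h]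
        rfl
      · rw [Pi.single_eq_of_ne hj, smul_zero]
        rfl
  let lam : ℤ → κ × P := fun t => ((s t).1, (s t).2 • σ (s t).1)
  have hg : PSys.Good lam L :=
    { pos := hL'
      per := fun t => by simp only [lam, hper]
      adj := hadj
      ne := fun t h => by
        have h1 := (hσ _ _).1 h
        by_cases he : e (s t).1 = 0
        · have h2 := hE0 _ he
          have h3 := hBs t
          refine hne t ?_
          rw [he, Int.eq_zero_of_abs_lt_dvd h1 (by omega)]
          simp
        · rw [hE1 _ he] at h1
          exact hne t h1 }
  obtain ⟨Θ, hΘ⟩ := PSys.exists_potential lam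
  let A : κ → Equiv.Perm (X × P) := fun i => Equiv.prodCongr (α' i) (Equiv.addRight (σ i))
  have hA : ∀ i (m : ℤ) x p, (A i ^ m) (x, p) = ((α' i ^ m) x, p + m • σ i) := by
    intro i m
    induction m using Int.induction_on with
    | zero => simp
    | succ n ih =>
      intro x p
      rw [zpow_add_one, zpow_add_one, Equiv.Perm.mul_apply, add_smul, one_smul]
      rw [show A i (x, p) = (α' i x, p + σ i) from rfl, ih, add_assoc, add_comm (σ i)]
      rfl
    | pred n ih =>
      intro x p
      rw [zpow_sub_one, zpow_sub_one, Equiv.Perm.mul_apply, sub_smul, one_smul]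
      have h : (A i)⁻¹ (x, p) = ((α' i)⁻¹ x, p - σ i) := by
        rw [Equiv.Perm.inv_eq_iff_eq]
        refine Prod.ext ((α' i).apply_symm_apply _).symm ?_
        show p = p - σ i + σ i
        abel
      rw [h, ih]
      refine Prod.ext rfl ?_
      show p - σ i + -(n : ℤ) • σ i = p + (-(n : ℤ) • σ i - σ i)
      abel
  let Q0 : PSys κ P :=
    { T := S × P
      Lab := Σ i, Quotient (Equiv.Perm.SameCycle.setoid (A i))
      c := fun x => x.2
      r := fun i x => ⟨i, Quotient.mk _ (x.1.1, x.2)⟩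
      inj := fun i x y h hc => by
        simp only [Sigma.mk.injEq, heq_eq_eq, true_and] at h
        obtain ⟨m, hm⟩ : Equiv.Perm.SameCycle (A i) (x.1.1, x.2) (y.1.1, y.2) := Quotient.exact h
        rw [hA, Prod.mk.injEq] at hm
        obtain ⟨h1, h2⟩ := hm
        rw [show y.2 = x.2 from hc.symm, add_eq_left, hσ] at h2
        obtain ⟨d, rfl⟩ := h2
        rw [zpow_mul, zpow_natCast, hα'E, one_zpow] at h1
        exact Prod.ext (Subtype.ext h1) hc }
  have hstep : ∀ t (x y : Q0.T), Q0.Step (lam t) x y →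
      (α (s t).1 ^ (s t).2) x.1.1 = y.1.1 := by
    rintro t x y ⟨h, hc⟩
    simp only [Q0, lam, Sigma.mk.injEq, heq_eq_eq, true_and] at h hc
    obtain ⟨m, hm⟩ : Equiv.Perm.SameCycle (A (s t).1) (x.1.1, x.2) (y.1.1, y.2) :=
      Quotient.exact h
    rw [hA, Prod.mk.injEq, hc, add_right_inj] at hm
    obtain ⟨h1, h2⟩ := hm
    rw [← sub_eq_zero, ← sub_smul, hσ] at h2
    obtain ⟨d, h2⟩ := h2
    obtain rfl : m = (s t).2 + E (s t).1 * d := by linarith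
    rw [zpow_add, zpow_mul, zpow_natCast, hα'E, one_zpow, mul_one,
      hα' _ _ x.1.2 _ (hBs t)] at h1
    exact h1
  have hpath : ∀ (q : ℤ → Q0.T) (n : ℕ), Q0.IsPath lam q 0 n →
      FreeGroup.lift α (sylWord s n) (q 0).1.1 = (q n).1.1 := by
    intro q n
    induction n with
    | zero => intro _; simp [sylWord]
    | succ n ih =>
      intro hq
      have h1 := hq n (by positivity) (by push_cast; omega)
      rw [sylWord, map_mul, Equiv.Perm.mul_apply,
        ih (hq.mono le_rfl (by push_cast; omega)), map_zpow, FreeGroup.lift_apply_of,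
        hstep _ _ _ h1]
      push_cast
      rfl
  have := hS.to_subtype
  have hne' : Nonempty S := hSn.to_subtype
  have hfinT : Finite Q0.T := inferInstanceAs (Finite (S × P))
  set n0 := Nat.card Q0.T with hn0
  refine ⟨n0.factorial * Nat.card P * (2 * (n0 * L + (n0 + 1) * (2 * L + 1)) + L + 3), ?_, ?_⟩
  · have : 0 < Nat.card P := Nat.card_pos
    positivity
  intro N hN hMN
  have hd1 : n0.factorial ∣ N := ((Dvd.intro _ rfl).trans (Dvd.intro _ rfl)).trans hMN
  have hd2 : Nat.card P ∣ N := ((Dvd.intro_left _ rfl).trans (Dvd.intro _ rfl)).trans hMN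
  have hd3 := Nat.le_of_dvd hN ((Dvd.intro_left _ rfl).trans hMN)
  have hP : ∀ x : P, (N : ℤ) • x = 0 := by
    intro x
    obtain ⟨d, rfl⟩ := hd2
    rw [natCast_zsmul, mul_comm, mul_smul, card_nsmul_eq_zero', smul_zero]
  let Ref : Q0.T → Q0.T → ℤ → Prop := fun x y k =>
    ∃ k', k' ≡ k [ZMOD N] ∧ (FreeGroup.lift α (sylWord s L) ^ k') x.1.1 = y.1.1
  have hI : PSys.Inv lam L (N * L) (n0 * L) Ref (fun x : Q0.T => x.2)
      (fun i x y => Q0.r i x = Q0.r i y) Q0 id :=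
    { fin := hfinT
      color := fun _ => rfl
      rel := fun _ _ _ h => h
      ref := by
        intro x y k q hk h0 h1 hq
        lift k to ℕ using hk
        refine ⟨k, Int.ModEq.refl _, ?_⟩
        have h2 := hpath q (k * L) (by exact_mod_cast hq)
        rw [sylWord_mul hper, h0] at h2
        push_cast at h2
        rw [h1, map_pow] at h2
        rw [zpow_natCast]
        exact h2
      bd := fun x => PSys.closed_or_bounded hg rfl (by exact_mod_cast hd1) x }
  obtain ⟨Q, μ, C', hI', hcl⟩ := PSys.close_all hg (by positivity) rfl hP
    (by
      have h1 : (N : ℤ) ≤ N * L := le_mul_of_one_le_right (by positivity) (by omega)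
      have h2 : ((2 * (n0 * L + (n0 + 1) * (2 * L + 1)) + L + 3 : ℕ) : ℤ) ≤ N := by
        exact_mod_cast hd3
      push_cast at h2
      linarith) hI
    (by
      rintro x y k k' ⟨j, hj, h⟩ hk
      exact ⟨j, hj.trans hk, h⟩)
    (by
      rintro x y k ⟨j, hj, h⟩
      refine ⟨-j, hj.neg, ?_⟩
      rw [zpow_neg, Equiv.Perm.inv_eq_iff_eq]
      exact h.symm)
  have := hI'.fin
  have : Nonempty Q.T := ⟨μ (hne'.some, 0)⟩
  obtain ⟨β, hβ1, hβ2⟩ := Q.exists_section_action σ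
  let f : X → P → Q.T := fun x p => if h : x ∈ S then μ (⟨x, h⟩, p) else this.some
  have hf : ∀ (x : S) p, f x p = μ (x, p) := fun x p => by simp [f]
  have hfc : ∀ (x : S) p, Q.c (f x p) = p := fun x p => by rw [hf, hI'.color]
  choose q hq0 hq1 hq2 using hcl
  have hqc : ∀ z (t : ℕ), Q.c (q z t) = z.2 + Θ t - Θ 0 := by
    intro z t
    have h1 : Q.IsPath lam (q z) 0 t := fun t _ _ => hq1 z t
    have h2 := h1.color hΘ t (by positivity) le_rfl
    rw [hq0, hI'.color] at h2
    rw [eq_sub_iff_add_eq, ← eq_sub_iff_add_eq.1 h2]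
    abel
  let g : S → ℕ → P → Q.T := fun x t p => q (x, p - Θ t + Θ 0) t
  have hgc : ∀ x t p, Q.c (g x t p) = p := by
    intro x t p
    rw [show g x t p = q (x, p - Θ t + Θ 0) t from rfl, hqc]
    simp only
    abel
  have hg0 : ∀ x : S, g x 0 = f x := by
    intro x
    funext p
    rw [hf]
    show q (x, p - Θ ((0 : ℕ) : ℤ) + Θ 0) ((0 : ℕ) : ℤ) = _
    rw [Nat.cast_zero, sub_add_cancel, hq0]
  have hgt : ∀ (x : S) t, FreeGroup.lift β (sylWord s t) (f x) = g x t := by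
    intro x t
    induction t with
    | zero => rw [hg0]; simp [sylWord]
    | succ t ih =>
      rw [sylWord, map_mul, Equiv.Perm.mul_apply, ih, map_zpow, FreeGroup.lift_apply_of]
      refine hβ2 _ _ _ _ (hgc x t) (hgc x (t + 1)) fun p => ?_
      show Q.r _ (q (x, p - (s t).2 • σ (s t).1 - Θ t + Θ 0) t) =
        Q.r _ (q (x, p - Θ ((t + 1 : ℕ) : ℤ) + Θ 0) ((t + 1 : ℕ) : ℤ))
      have h1 : p - (s t).2 • σ (s t).1 - Θ t + Θ 0 = p - Θ ((t + 1 : ℕ) : ℤ) + Θ 0 := by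
        push_cast
        rw [hΘ]
        show _ = p - (Θ t + (s t).2 • σ (s t).1) + Θ 0
        abel
      rw [h1]
      push_cast
      exact (hq1 _ t).1
  have hgW : ∀ (x : S) (k : ℕ), (FreeGroup.lift β (sylWord s L) ^ k) (f x) = g x (k * L) := by
    intro x k
    rw [← hgt, sylWord_mul hper, map_pow]
  have hperf : ∀ x ∈ S, (FreeGroup.lift β (sylWord s L) ^ N) (f x) = f x := by
    intro x hx
    rw [hgW ⟨x, hx⟩, ← hg0 ⟨x, hx⟩]
    funext p
    have h1 := PSys.potential_per hg hP hΘ 0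
    have h2 := hq2 (⟨x, hx⟩, p) 0
    show q (_, p - Θ ((N * L : ℕ) : ℤ) + Θ 0) ((N * L : ℕ) : ℤ) =
      q (_, p - Θ ((0 : ℕ) : ℤ) + Θ 0) ((0 : ℕ) : ℤ)
    push_cast
    rw [zero_add] at h1 h2
    rw [h1, sub_add_cancel, h2]
  refine ⟨P → Q.T, inferInstance, β, f, ⟨fun i => ?_, fun i x hx hx' => ?_, hperf, ?_⟩⟩
  · by_cases he : e i = 0
    · rw [he, pow_zero]
    · rw [← hE1 i he]
      refine hβ1 i _ ?_
      rw [← natCast_zsmul, hσ]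
  · symm
    rw [← zpow_one (β i)]
    refine hβ2 i 1 _ _ (hfc ⟨x, hx⟩) (hfc ⟨_, hx'⟩) fun p => ?_
    rw [hf ⟨x, hx⟩, hf ⟨_, hx'⟩]
    refine hI'.rel i _ _ ?_
    refine Sigma.ext rfl (heq_of_eq (Quotient.sound ⟨1, ?_⟩))
    rw [hA, hα' i x hx 1 (by rw [abs_one]; omega), zpow_one, sub_add_cancel]
  · intro x hx y hy k hk
    obtain ⟨j, hj⟩ : ∃ j : ℕ, k + N * (k.natAbs : ℤ) = j := by
      refine ⟨(k + N * (k.natAbs : ℤ)).toNat, (Int.toNat_of_nonneg ?_).symm⟩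
      have h1 : (k.natAbs : ℤ) ≤ N * (k.natAbs : ℤ) :=
        le_mul_of_one_le_left (by positivity) (by omega)
      omega
    have hj' : (j : ℤ) ≡ k [ZMOD N] := by
      rw [← hj]
      exact Int.modEq_iff_dvd.2 ⟨-(k.natAbs : ℤ), by ring⟩
    have h2 : (FreeGroup.lift β (sylWord s L) ^ j) (f x) = f y := by
      rw [← zpow_natCast, ← hj, zpow_add, zpow_mul, zpow_natCast, Equiv.Perm.mul_apply, ← hk]
      refine congrArg _ ?_
      rw [zpow_natCast]
      exact Equiv.Perm.pow_apply_eq_self_of_apply_eq_self (hperf x hx) _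
    rw [hgW ⟨x, hx⟩] at h2
    have h3 := congrFun h2 0
    rw [hf ⟨y, hy⟩] at h3
    obtain ⟨k', hk', h4⟩ := hI'.ref (⟨x, hx⟩, 0 - Θ ((j * L : ℕ) : ℤ) + Θ 0) (⟨y, hy⟩, 0) j
      (q (⟨x, hx⟩, 0 - Θ ((j * L : ℕ) : ℤ) + Θ 0)) (by positivity) (hq0 _)
      (by rw [← h3]; push_cast; rfl) (fun t _ _ => hq1 _ t)
    exact ⟨k', hk'.trans hj', h4⟩

/-- The relators `a_i ^ e_i`. -/
def cycRels {κ : Type*} (e : κ → ℕ) : Set (FreeGroup κ) := Set.range fun i => FreeGroup.of i ^ e i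

theorem lift_eq_of_mk_eq {κ G : Type*} [Group G] {e : κ → ℕ} {a : κ → G}
    (ha : ∀ i, a i ^ e i = 1) {U V : FreeGroup κ}
    (h : PresentedGroup.mk (cycRels e) U = PresentedGroup.mk (cycRels e) V) :
    FreeGroup.lift a U = FreeGroup.lift a V := by
  have hr : ∀ r ∈ cycRels e, FreeGroup.lift a r = 1 := by
    rintro _ ⟨i, rfl⟩
    simp [ha]
  have key : ∀ w, PresentedGroup.toGroup hr (PresentedGroup.mk (cycRels e) w) =
      FreeGroup.lift a w := fun w => rfl
  rw [← key, ← key, h]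

/-- Compatibility with the generators on a large finite set gives compatibility with a word. -/
theorem exists_compat_word {κ X : Type*} (α : κ → Equiv.Perm X) (h : FreeGroup κ) :
    ∀ S : Set X, S.Finite → ∃ S' : Set X, S'.Finite ∧ S ⊆ S' ∧
      (∀ x ∈ S, FreeGroup.lift α h x ∈ S') ∧
      ∀ {Y : Type} (β : κ → Equiv.Perm Y) (f : X → Y),
        (∀ i, ∀ x ∈ S', α i x ∈ S' → f (α i x) = β i (f x)) →
        ∀ x ∈ S, f (FreeGroup.lift α h x) = FreeGroup.lift β h (f x) := by
  induction h using FreeGroup.induction_on with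
  | C1 => exact fun S hS => ⟨S, hS, le_rfl, by simp, by simp⟩
  | of i =>
    intro S hS
    refine ⟨S ∪ α i '' S, hS.union (hS.image _), Set.subset_union_left,
      fun x hx => Or.inr ⟨x, hx, by simp⟩, fun β f hf x hx => ?_⟩
    simpa using hf i x (Or.inl hx) (Or.inr ⟨x, hx, rfl⟩)
  | inv_of i _ =>
    intro S hS
    refine ⟨S ∪ ⇑(α i)⁻¹ '' S, hS.union (hS.image _), Set.subset_union_left,
      fun x hx => Or.inr ⟨x, hx, by rw [map_inv, FreeGroup.lift_apply_of]⟩, fun β f hf x hx => ?_⟩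
    have e : α i ((α i)⁻¹ x) = x := (α i).apply_symm_apply x
    have := hf i ((α i)⁻¹ x) (Or.inr ⟨x, hx, rfl⟩) (by rw [e]; exact Or.inl hx)
    rw [e] at this
    rw [map_inv, map_inv, FreeGroup.lift_apply_of, FreeGroup.lift_apply_of, this]
    exact ((β i).symm_apply_apply _).symm
  | mul x y hx hy =>
    intro S hS
    obtain ⟨S1, h1, h2, h3, h4⟩ := hy S hS
    obtain ⟨S2, h5, h6, h7, h8⟩ := hx S1 h1
    refine ⟨S2, h5, h2.trans h6, fun z hz => ?_, fun β f hf z hz => ?_⟩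
    · rw [map_mul]
      exact h7 _ (h3 z hz)
    · rw [map_mul, map_mul, Equiv.Perm.mul_apply, Equiv.Perm.mul_apply, h8 β f hf _ (h3 z hz),
        h4 β f (fun i x hx hx' => hf i x (h6 hx) (h6 hx')) z hz]

/-- Every action satisfying the torsion relations has finite models for the word `U`. -/
def HasModels {κ : Type} (e : κ → ℕ) (U : FreeGroup κ) : Prop :=
  ∀ (X : Type) (α : κ → Equiv.Perm X), (∀ i, α i ^ e i = 1) → ∀ S : Set X, S.Finite →
    S.Nonempty → ∃ M : ℕ, 0 < M ∧ ∀ N : ℕ, 0 < N → M ∣ N → ∃ (Y : Type) (_ : Finite Y)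
      (β : κ → Equiv.Perm Y) (f : X → Y), IsModel e α U S N β f

theorem HasModels.of_isConj {κ : Type} {e : κ → ℕ} {U V : FreeGroup κ} (h : HasModels e V)
    (hc : IsConj (PresentedGroup.mk (cycRels e) V) (PresentedGroup.mk (cycRels e) U)) :
    HasModels e U := by
  intro X α hα S hS hSn
  obtain ⟨c, hc⟩ := isConj_iff.1 hc
  obtain ⟨c, rfl⟩ := PresentedGroup.mk_surjective _ c
  rw [← map_inv, ← map_mul, ← map_mul] at hc
  obtain ⟨S', h1, h2, h3, h4⟩ := exists_compat_word α c⁻¹ S hS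
  obtain ⟨M, hM, hmod⟩ := h X α hα S' h1 (hSn.mono h2)
  refine ⟨M, hM, fun N hN hMN => ?_⟩
  obtain ⟨Y, hY, β, f, hm⟩ := hmod N hN hMN
  have hU : ∀ {Z : Type} (γ : κ → Equiv.Perm Z), (∀ i, γ i ^ e i = 1) → ∀ k : ℤ,
      FreeGroup.lift γ U ^ k = (FreeGroup.lift γ c⁻¹)⁻¹ * FreeGroup.lift γ V ^ k *
        FreeGroup.lift γ c⁻¹ := by
    intro Z γ hγ k
    rw [← lift_eq_of_mk_eq hγ hc, ← map_inv, _root_.inv_inv, map_mul, map_mul, map_inv, conj_zpow]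
  have hf := h4 β f hm.compat
  refine ⟨Y, hY, β, f, hm.tors, fun i x hx hx' => hm.compat i x (h2 hx) (h2 hx'), fun x hx => ?_,
    fun x hx y hy k hk => ?_⟩
  · rw [← zpow_natCast, hU β hm.tors, Equiv.Perm.mul_apply, Equiv.Perm.mul_apply,
      Equiv.Perm.inv_eq_iff_eq, ← hf x hx, zpow_natCast]
    exact hm.per _ (h3 x hx)
  · rw [hU β hm.tors, Equiv.Perm.mul_apply, Equiv.Perm.mul_apply, Equiv.Perm.inv_eq_iff_eq,
      ← hf x hx, ← hf y hy] at hk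
    obtain ⟨k', hk', h5⟩ := hm.sep _ (h3 x hx) _ (h3 y hy) k hk
    refine ⟨k', hk', ?_⟩
    rw [hU α hα, Equiv.Perm.mul_apply, Equiv.Perm.mul_apply, Equiv.Perm.inv_eq_iff_eq]
    exact h5

/-- The product of a list of syllables, the later ones on the left. -/
def listWord {κ : Type*} : List (κ × ℤ) → FreeGroup κ
  | [] => 1
  | a :: l => listWord l * FreeGroup.of a.1 ^ a.2

theorem listWord_append {κ : Type*} (l l' : List (κ × ℤ)) :
    listWord (l ++ l') = listWord l' * listWord l := by
  induction l with
  | nil => simp [listWord]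
  | cons a l ih => rw [List.cons_append, listWord, ih, listWord, mul_assoc]

theorem exists_listWord {κ : Type*} (w : FreeGroup κ) : ∃ l, listWord l = w := by
  induction w using FreeGroup.induction_on with
  | C1 => exact ⟨[], rfl⟩
  | of i => exact ⟨[(i, 1)], by simp [listWord]⟩
  | inv_of i _ => exact ⟨[(i, -1)], by simp [listWord]⟩
  | mul x y hx hy =>
    obtain ⟨l, rfl⟩ := hx
    obtain ⟨l', rfl⟩ := hy
    exact ⟨l' ++ l, listWord_append _ _⟩

theorem isConj_listWord_rotate {κ : Type*} (l : List (κ × ℤ)) (n : ℕ) :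
    IsConj (listWord l) (listWord (l.rotate n)) := by
  induction n generalizing l with
  | zero => rw [List.rotate_zero]
  | succ n ih =>
    cases l with
    | nil => rw [List.rotate_nil]
    | cons a l =>
      rw [List.rotate_cons_succ]
      refine IsConj.trans ?_ (ih _)
      rw [listWord_append, isConj_iff]
      exact ⟨FreeGroup.of a.1 ^ a.2, by simp [listWord, mul_assoc]⟩

/-- Cyclic reduction in a free product of cyclic groups. -/
theorem exists_reduced_conj {κ : Type*} (e : κ → ℕ) (U : FreeGroup κ)
    (hU1 : PresentedGroup.mk (cycRels e) U ≠ 1)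
    (hU : ∀ i (m : ℤ), ¬ IsConj (PresentedGroup.mk (cycRels e) (FreeGroup.of i ^ m))
      (PresentedGroup.mk (cycRels e) U)) :
    ∃ (s : ℤ → κ × ℤ) (L : ℕ), 0 < L ∧ (∀ t, s (t + L) = s t) ∧
      (∀ t, (s (t + 1)).1 ≠ (s t).1) ∧ (∀ t, ¬ (e (s t).1 : ℤ) ∣ (s t).2) ∧
      IsConj (PresentedGroup.mk (cycRels e) (sylWord s L)) (PresentedGroup.mk (cycRels e) U) := by
  classical
  let mk := PresentedGroup.mk (cycRels e)
  have hex : ∃ n, ∃ l : List (κ × ℤ), l.length = n ∧ IsConj (mk (listWord l)) (mk U) := by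
    obtain ⟨l, hl⟩ := exists_listWord U
    exact ⟨_, l, rfl, by rw [hl]⟩
  obtain ⟨l, hl, hc⟩ := Nat.find_spec hex
  have hmin : ∀ l' : List (κ × ℤ), IsConj (mk (listWord l')) (mk U) → l.length ≤ l'.length := by
    intro l' h
    rw [hl]
    exact Nat.find_min' hex ⟨l', rfl, h⟩
  have hrot : ∀ n, IsConj (mk (listWord (l.rotate n))) (mk U) := fun n =>
    (mk.map_isConj (isConj_listWord_rotate l n).symm).trans hc
  have hlen : 2 ≤ l.length := by
    match l, hc with
    | [], hc =>
      simp only [listWord, map_one, isConj_one_right] at hc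
      exact absurd hc hU1
    | [a], hc => exact absurd hc (by simpa [listWord] using hU a.1 a.2)
    | a :: b :: l, _ => simp
  set L := l.length with hL
  have hlt : ∀ t : ℤ, (t % L).toNat < L := fun t => by
    have := Int.emod_lt_of_pos t (by omega : (0 : ℤ) < L)
    omega
  have hshape : ∀ t : ℤ, ∃ l', l.rotate (t % L).toNat =
      l[(t % L).toNat]'(hlt t) :: l[((t + 1) % L).toNat]'(hlt _) :: l' := by
    intro t
    have h1 : (l.rotate (t % L).toNat).length = L := by rw [List.length_rotate]
    have hnn := Int.emod_nonneg t (by omega : (L : ℤ) ≠ 0)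
    match h : l.rotate (t % L).toNat with
    | [] => rw [h] at h1; simp at h1; omega
    | [a] => rw [h] at h1; simp at h1; omega
    | a :: b :: l' =>
      refine ⟨l', ?_⟩
      have e0 := List.getElem_rotate l (t % L).toNat 0 (by omega)
      have e1 := List.getElem_rotate l (t % L).toNat 1 (by omega)
      simp only [h, List.getElem_cons_zero, List.getElem_cons_succ, ← hL] at e0 e1
      rw [e0, e1]
      congr 2
      · rw [zero_add, Nat.mod_eq_of_lt (hlt t)]
      · congr 2
        zify
        rw [Int.toNat_of_nonneg hnn, Int.toNat_of_nonneg (Int.emod_nonneg _ (by omega))]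
        rw [Int.add_emod 1 (t % L), Int.emod_emod_of_dvd _ dvd_rfl, ← Int.add_emod, add_comm]
  refine ⟨fun t => l[(t % L).toNat]'(hlt t), L, by omega, fun t => ?_, fun t h => ?_,
    fun t ⟨d, hd⟩ => ?_, ?_⟩
  · simp
  · obtain ⟨l', hl'⟩ := hshape t
    have h1 := hrot (t % L).toNat
    rw [hl', listWord, listWord, h, mul_assoc, ← zpow_add] at h1
    have h2 := congrArg List.length hl'
    rw [List.length_rotate] at h2
    have h3 := hmin ((_, _) :: l') h1
    simp only [List.length_cons] at h2 h3
    omega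
  · obtain ⟨l', hl'⟩ := hshape t
    have h1 := hrot (t % L).toNat
    have h2 := congrArg List.length hl'
    rw [List.length_rotate] at h2
    rw [hl', listWord, map_mul, hd, zpow_mul, zpow_natCast, map_zpow (f := mk)] at h1
    rw [show mk (FreeGroup.of _ ^ e _) = 1 from PresentedGroup.mk_eq_one_iff.2
      (Subgroup.subset_normalClosure ⟨_, rfl⟩), one_zpow, mul_one] at h1
    have h3 := hmin _ h1
    simp only [List.length_cons] at h2 h3
    omega
  · have : ∀ n ≤ L, sylWord (fun t : ℤ => l[(t % L).toNat]'(hlt t)) n = listWord (l.take n) := by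
      intro n
      induction n with
      | zero => simp [sylWord, listWord]
      | succ n ih =>
        intro hn
        rw [sylWord, ih (by omega), List.take_succ_eq_append_getElem (by omega), listWord_append]
        have : (((n : ℤ) % L).toNat) = n := by
          rw [Int.emod_eq_of_lt (by omega) (by omega)]; simp
        simp [listWord, this]
    rw [this L le_rfl, hL, List.take_length]
    exact hc

/-- The torsion exponents after doubling the generators: `a_i = x_i y_i`, with `x_i = (i, true)`
and `y_i = (i, false)`, where `y_i` is trivial if `a_i` has finite order. -/
def dblExp {ι : Type*} (e : ι → ℕ) : ι × Bool → ℕ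
  | (i, true) => e i
  | (i, false) => if e i = 0 then 0 else 1

/-- The substitution `a_i ↦ x_i y_i`. -/
def dbl (ι : Type*) : FreeGroup ι →* FreeGroup (ι × Bool) :=
  FreeGroup.lift fun i => FreeGroup.of (i, true) * FreeGroup.of (i, false)

theorem lift_dbl {ι G : Type*} [Group G] (a : ι × Bool → G) (w : FreeGroup ι) :
    FreeGroup.lift a (dbl ι w) = FreeGroup.lift (fun i => a (i, true) * a (i, false)) w := by
  rw [dbl, ← MonoidHom.comp_apply]
  congr 1
  ext i
  simp

theorem mk_eq_lift {ι : Type*} (R : Set (FreeGroup ι)) (w : FreeGroup ι) :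
    PresentedGroup.mk R w = FreeGroup.lift (fun i => PresentedGroup.of (rels := R) i) w := by
  congr 1
  ext i
  simp
  rfl

theorem mk_of_pow {ι : Type*} (e : ι → ℕ) (i : ι) :
    (PresentedGroup.of (rels := cycRels e) i) ^ e i = 1 :=
  PresentedGroup.mk_eq_one_iff.2 (Subgroup.subset_normalClosure ⟨i, rfl⟩)

/-- An element of infinite order becomes, after doubling, not conjugate to a power of a
generator. -/
theorem exists_reduced_dbl {ι : Type*} (e : ι → ℕ) (U : FreeGroup ι)
    (hU : ¬ IsOfFinOrder (PresentedGroup.mk (cycRels e) U)) :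
    ∃ (s : ℤ → (ι × Bool) × ℤ) (L : ℕ), 0 < L ∧ (∀ t, s (t + L) = s t) ∧
      (∀ t, (s (t + 1)).1 ≠ (s t).1) ∧ (∀ t, ¬ (dblExp e (s t).1 : ℤ) ∣ (s t).2) ∧
      IsConj (PresentedGroup.mk (cycRels (dblExp e)) (sylWord s L))
        (PresentedGroup.mk (cycRels (dblExp e)) (dbl ι U)) := by
  have key : ∀ a : ι × Bool → PresentedGroup (cycRels e), (∀ i, a i ^ dblExp e i = 1) →
      (∀ i, a (i, true) * a (i, false) = PresentedGroup.of i) →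
      ∀ c : FreeGroup (ι × Bool), IsConj (PresentedGroup.mk (cycRels (dblExp e)) c)
        (PresentedGroup.mk (cycRels (dblExp e)) (dbl ι U)) →
        ¬ IsOfFinOrder (FreeGroup.lift a c) := by
    intro a ha hmul c hc hfin
    have hr : ∀ r ∈ cycRels (dblExp e), FreeGroup.lift a r = 1 := by
      rintro _ ⟨i, rfl⟩
      rw [map_pow, FreeGroup.lift_apply_of, ha]
    have h1 : IsConj (FreeGroup.lift a c) (FreeGroup.lift a (dbl ι U)) :=
      (PresentedGroup.toGroup hr).map_isConj hc
    rw [lift_dbl] at h1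
    simp only [hmul] at h1
    rw [← mk_eq_lift] at h1
    obtain ⟨g, hg⟩ := isConj_iff.1 h1
    refine hU ?_
    rw [← hg]
    exact (MulAut.conj g).toMonoidHom.isOfFinOrder hfin
  let a1 : ι × Bool → PresentedGroup (cycRels e) := fun x =>
    match x with
    | (i, true) => PresentedGroup.of i
    | (i, false) => 1
  let a2 : ι × Bool → PresentedGroup (cycRels e) := fun x =>
    match x with
    | (i, true) => if e i = 0 then 1 else PresentedGroup.of i
    | (i, false) => if e i = 0 then PresentedGroup.of i else 1
  have k1 := key a1 (by
      rintro ⟨i, _ | _⟩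
      · simp [a1]
      · exact mk_of_pow e i) (fun i => by simp [a1])
  have k2 := key a2 (by
      rintro ⟨i, _ | _⟩
      · by_cases h : e i = 0 <;> simp [a2, dblExp, h]
      · by_cases h : e i = 0
        · simp [a2, h]
        · simpa [a2, h, dblExp] using mk_of_pow e i)
        (fun i => by by_cases h : e i = 0 <;> simp [a2, h])
  refine exists_reduced_conj (dblExp e) (dbl ι U) (fun h => ?_) fun i m hc => ?_
  · refine k1 1 (by rw [h, map_one]) ?_
    rw [map_one]
    exact IsOfFinOrder.one
  · obtain ⟨i, _ | _⟩ := i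
    · refine k1 _ hc ?_
      simp [a1]
    · refine k2 _ hc ?_
      rw [map_zpow, FreeGroup.lift_apply_of]
      by_cases h : e i = 0
      · simp [a2, h]
      · refine IsOfFinOrder.zpow ?_
        simp only [a2, h, if_false]
        exact isOfFinOrder_iff_pow_eq_one.2 ⟨e i, Nat.pos_of_ne_zero h, mk_of_pow e i⟩

theorem hasModels {ι : Type} [Finite ι] (e : ι → ℕ) (U : FreeGroup ι)
    (hU : ¬ IsOfFinOrder (PresentedGroup.mk (cycRels e) U)) : HasModels e U := by
  obtain ⟨s, L, hL, hper, hadj, hne, hc⟩ := exists_reduced_dbl e U hU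
  have h1 : HasModels (dblExp e) (sylWord s L) := fun X α hα S hS hSn =>
    exists_model_of_reduced _ s L hL hper hadj hne α hα S hS hSn
  have h2 := h1.of_isConj hc
  intro X α hα S hS hSn
  let α' : ι × Bool → Equiv.Perm X := fun x =>
    match x with
    | (i, true) => α i
    | (i, false) => 1
  have hlα : ∀ w, FreeGroup.lift α' (dbl ι w) = FreeGroup.lift α w := by
    intro w
    rw [lift_dbl]
    simp [α']
  obtain ⟨M, hM, hm⟩ := h2 X α' (by
    rintro ⟨i, _ | _⟩
    · simp [α']
    · exact hα i) S hS hSn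
  refine ⟨M, hM, fun N hN hMN => ?_⟩
  obtain ⟨Y, hY, β, f, h⟩ := hm N hN hMN
  have hlβ := lift_dbl β
  refine ⟨Y, hY, fun i => β (i, true) * β (i, false), f, fun i => ?_, fun i x hx hx' => ?_,
    fun x hx => ?_, fun x hx y hy k hk => ?_⟩
  · by_cases he : e i = 0
    · rw [he, pow_zero]
    · have h1 := h.tors (i, true)
      have h2 := h.tors (i, false)
      simp only [dblExp, he, if_false, pow_one] at h1 h2
      simp [h2, h1]
  · have h1 := h.compat (i, true) x hx hx'
    have h2 := h.compat (i, false) x hx hx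
    rw [Equiv.Perm.mul_apply, ← h2]
    exact h1
  · rw [← hlβ]
    exact h.per x hx
  · rw [← hlβ] at hk
    rw [← hlα]
    exact h.sep x hx y hy k hk

theorem exists_descended_action {κ X Z : Type*} (π : X → Z) (hπ : Function.Surjective π)
    (a : κ → Equiv.Perm X) (h : ∀ i x y, π x = π y ↔ π (a i x) = π (a i y)) :
    ∃ b : κ → Equiv.Perm Z, (∀ i n, a i ^ n = 1 → b i ^ n = 1) ∧
      ∀ w x, FreeGroup.lift b w (π x) = π (FreeGroup.lift a w x) := by
  let g := Function.surjInv hπ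
  have hg : ∀ z, π (g z) = z := Function.surjInv_eq hπ
  have key : ∀ i x, π (a i (g (π x))) = π (a i x) := fun i x => (h i _ _).1 (hg _)
  have key' : ∀ i x, π ((a i)⁻¹ (g (π x))) = π ((a i)⁻¹ x) := fun i x => by
    rw [h i, show a i ((a i)⁻¹ (g (π x))) = g (π x) from (a i).apply_symm_apply _,
      show a i ((a i)⁻¹ x) = x from (a i).apply_symm_apply _, hg]
  let b : κ → Equiv.Perm Z := fun i =>
    { toFun := fun z => π (a i (g z))
      invFun := fun z => π ((a i)⁻¹ (g z))
      left_inv := fun z => by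
        show π ((a i)⁻¹ (g (π (a i (g z))))) = z
        rw [key', show (a i)⁻¹ (a i (g z)) = g z from (a i).symm_apply_apply _, hg]
      right_inv := fun z => by
        show π (a i (g (π ((a i)⁻¹ (g z))))) = z
        rw [key, show a i ((a i)⁻¹ (g z)) = g z from (a i).apply_symm_apply _, hg] }
  have hb : ∀ w x, FreeGroup.lift b w (π x) = π (FreeGroup.lift a w x) := by
    intro w
    induction w using FreeGroup.induction_on with
    | C1 => simp
    | of i =>
      intro x
      rw [FreeGroup.lift_apply_of, FreeGroup.lift_apply_of]
      exact key i x
    | inv_of i _ =>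
      intro x
      rw [map_inv, map_inv, FreeGroup.lift_apply_of, FreeGroup.lift_apply_of]
      exact key' i x
    | mul u v hu hv =>
      intro x
      rw [map_mul, map_mul, Equiv.Perm.mul_apply, Equiv.Perm.mul_apply, hv, hu]
  refine ⟨b, fun i n hn => ?_, hb⟩
  ext z
  obtain ⟨x, rfl⟩ := hπ z
  have := hb (FreeGroup.of i ^ n) x
  rw [map_pow, map_pow, FreeGroup.lift_apply_of, FreeGroup.lift_apply_of, hn] at this
  exact this

section triangular

variable {R : Type} [CommRing R]

/-- A triangular additive automorphism of the sequences, whose diagonal entries are roots of unity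
of order dividing `E`. -/
structure Tri (E : ℕ) (σ : Equiv.Perm (ℕ → R)) : Prop where
  add : ∀ x y, σ (x + y) = σ x + σ y
  diag : ∀ j, ∃ c : Rˣ, c ^ E = 1 ∧ ∀ x : ℕ → R, (∀ i < j, x i = 0) →
    (∀ i < j, σ x i = 0) ∧ σ x j = c * x j

theorem Tri.one (E : ℕ) : Tri E (1 : Equiv.Perm (ℕ → R)) :=
  ⟨fun _ _ => rfl, fun j => ⟨1, one_pow _, fun x hx => ⟨hx, by simp⟩⟩⟩

theorem Tri.mul {E : ℕ} {σ τ : Equiv.Perm (ℕ → R)} (hσ : Tri E σ) (hτ : Tri E τ) :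
    Tri E (σ * τ) := by
  refine ⟨fun x y => ?_, fun j => ?_⟩
  · rw [Equiv.Perm.mul_apply, hτ.add, hσ.add]
    rfl
  · obtain ⟨c, hc, h1⟩ := hσ.diag j
    obtain ⟨d, hd, h2⟩ := hτ.diag j
    refine ⟨c * d, by rw [mul_pow, hc, hd, one_mul], fun x hx => ?_⟩
    obtain ⟨h3, h4⟩ := h2 x hx
    obtain ⟨h5, h6⟩ := h1 _ h3
    refine ⟨h5, ?_⟩
    rw [Equiv.Perm.mul_apply, h6, h4, Units.val_mul, mul_assoc]

/-- The diagonal entries of an `n`-th power are `n`-th powers. -/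
theorem Tri.pow_diag {E : ℕ} {σ : Equiv.Perm (ℕ → R)} (hσ : Tri E σ) (j : ℕ) {x : ℕ → R}
    (hx : ∀ i < j, x i = 0) : (σ ^ E) x j = x j := by
  obtain ⟨c, hc, h⟩ := hσ.diag j
  have : ∀ n : ℕ, (∀ i < j, (σ ^ n) x i = 0) ∧ (σ ^ n) x j = (c ^ n : Rˣ) * x j := by
    intro n
    induction n with
    | zero => exact ⟨hx, by simp⟩
    | succ n ih =>
      obtain ⟨h1, h2⟩ := h _ ih.1
      rw [pow_succ', Equiv.Perm.mul_apply]
      refine ⟨h1, ?_⟩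
      rw [h2, ih.2, pow_succ', Units.val_mul, mul_assoc]
  rw [(this E).2, hc, Units.val_one, one_mul]

theorem Tri.pow {E : ℕ} {σ : Equiv.Perm (ℕ → R)} (hσ : Tri E σ) (n : ℕ) : Tri E (σ ^ n) := by
  induction n with
  | zero => exact Tri.one E
  | succ n ih => rw [pow_succ]; exact ih.mul hσ

theorem Tri.sub {E : ℕ} {σ : Equiv.Perm (ℕ → R)} (hσ : Tri E σ) (x y : ℕ → R) :
    σ (x - y) = σ x - σ y := by
  rw [eq_sub_iff_add_eq, ← hσ.add, sub_add_cancel]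

variable {κ : Type} [DecidableEq κ] (τ : ℕ → κ)

/-- Multiplication by `c` on the vectors `x_j + x_{j-1}`, for the coordinates `j` of type `i`. -/
def triFun (i : κ) (c : R) (x : ℕ → R) : ℕ → R
  | 0 => x 0
  | j + 1 => if τ j = i then c * (x (j + 1) + x j) - x j else x (j + 1)

variable {τ}

theorem triFun_triFun (hτ : ∀ j, τ (j + 1) ≠ τ j) (i : κ) (c d : R) (x : ℕ → R) :
    triFun τ i c (triFun τ i d x) = triFun τ i (c * d) x := by
  have h : ∀ j, τ j = i → triFun τ i d x j = x j := by
    intro j hj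
    cases j with
    | zero => rfl
    | succ j =>
      have : τ j ≠ i := fun h => hτ j (hj.trans h.symm)
      simp [triFun, this]
  funext j
  cases j with
  | zero => rfl
  | succ j =>
    by_cases hj : τ j = i
    · have h1 : ∀ (b : R) (y : ℕ → R), triFun τ i b y (j + 1) = b * (y (j + 1) + y j) - y j :=
        fun b y => if_pos hj
      rw [h1, h1, h1, h j hj]
      ring
    · simp [triFun, hj]

theorem triFun_one (i : κ) (x : ℕ → R) : triFun τ i 1 x = x := by
  funext j
  cases j with
  | zero => rfl
  | succ j => by_cases hj : τ j = i <;> simp [triFun, hj]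

/-- The elementary triangular automorphisms. -/
def triHom (hτ : ∀ j, τ (j + 1) ≠ τ j) (i : κ) : Rˣ →* Equiv.Perm (ℕ → R) where
  toFun c :=
    { toFun := triFun τ i (c : R)
      invFun := triFun τ i ((c⁻¹ : Rˣ) : R)
      left_inv := fun x => by
        rw [triFun_triFun hτ, Units.inv_mul, triFun_one]
      right_inv := fun x => by
        rw [triFun_triFun hτ, Units.mul_inv, triFun_one] }
  map_one' := by
    ext x : 1
    exact triFun_one i x
  map_mul' c d := by
    ext x : 1
    exact (triFun_triFun hτ i (c : R) (d : R) x).symm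

theorem triHom_apply (hτ : ∀ j, τ (j + 1) ≠ τ j) (i : κ) (c : Rˣ) (x : ℕ → R) :
    triHom hτ i c x = triFun τ i (c : R) x := rfl

theorem triHom_tri (hτ : ∀ j, τ (j + 1) ≠ τ j) (i : κ) {c : Rˣ} {E : ℕ} (hc : c ^ E = 1) :
    Tri E (triHom hτ i c) := by
  refine ⟨fun x y => ?_, fun j => ?_⟩
  · simp only [triHom_apply]
    funext j
    cases j with
    | zero => rfl
    | succ j =>
      by_cases hj : τ j = i
      · simp only [triFun, hj, if_true, Pi.add_apply]
        ring
      · simp [triFun, hj]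
  · have hlow : ∀ x : ℕ → R, (∀ i < j, x i = 0) → ∀ k < j, triFun τ i (c : R) x k = 0 := by
      intro x hx k hk
      cases k with
      | zero => exact hx 0 hk
      | succ k => simp [triFun, hx _ hk, hx k (by omega)]
    cases j with
    | zero => exact ⟨1, one_pow _, fun x hx => ⟨hlow x hx, by simp [triHom_apply, triFun]⟩⟩
    | succ j =>
      by_cases hj : τ j = i
      · exact ⟨c, hc, fun x hx => ⟨hlow x hx, by simp [triHom_apply, triFun, hj, hx j]⟩⟩
      · exact ⟨1, one_pow _, fun x hx => ⟨hlow x hx, by simp [triHom_apply, triFun, hj]⟩⟩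

theorem lift_tri (hτ : ∀ j, τ (j + 1) ≠ τ j) {z : κ → Rˣ} {E : ℕ} (hz : ∀ i, z i ^ E = 1)
    (w : FreeGroup κ) : Tri E (FreeGroup.lift (fun i => triHom hτ i (z i)) w) := by
  induction w using FreeGroup.induction_on with
  | C1 => rw [map_one]; exact Tri.one E
  | of i => rw [FreeGroup.lift_apply_of]; exact triHom_tri hτ i (hz i)
  | inv_of i _ =>
    rw [map_inv, FreeGroup.lift_apply_of, ← map_inv]
    exact triHom_tri hτ i (by rw [inv_pow, hz, inv_one])
  | mul u v hu hv => rw [map_mul]; exact hu.mul hv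

theorem lift_sylWord_ne [IsDomain R] {s : ℤ → κ × ℤ}
    (hτ : ∀ j : ℕ, (s ((j + 1 : ℕ) : ℤ)).1 ≠ (s (j : ℤ)).1)
    {z : κ → Rˣ} (hz : ∀ t, z (s t).1 ^ (s t).2 ≠ 1) (n : ℕ) :
    FreeGroup.lift (fun i => triHom (τ := fun j : ℕ => (s j).1) hτ i (z i)) (sylWord s n)
      (Pi.single 0 1) n ≠ 0 := by
  suffices h : ∀ x, x = FreeGroup.lift
      (fun i => triHom (τ := fun j : ℕ => (s j).1) hτ i (z i)) (sylWord s n) (Pi.single 0 1) →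
      x n ≠ 0 ∧ ∀ j > n, x j = 0 from (h _ rfl).1
  induction n with
  | zero =>
    rintro _ rfl
    simp only [sylWord, map_one, Equiv.Perm.one_apply]
    exact ⟨by simp, fun j hj => by simp [(show j ≠ 0 by omega)]⟩
  | succ n ih =>
    rintro _ rfl
    obtain ⟨h1, h2⟩ := ih _ rfl
    rw [sylWord, map_mul, Equiv.Perm.mul_apply, map_zpow, FreeGroup.lift_apply_of, ← map_zpow,
      triHom_apply]
    refine ⟨?_, fun j hj => ?_⟩
    · simp only [triFun, if_true]
      rw [h2 (n + 1) (by omega), zero_add, ← sub_one_mul]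
      refine mul_ne_zero (fun h => hz n ?_) h1
      rw [sub_eq_zero] at h
      exact Units.ext h
    · obtain ⟨j, rfl⟩ : ∃ k, j = k + 1 := ⟨j - 1, by omega⟩
      simp [triFun, h2 (j + 1) (by omega), h2 j (by omega)]

end triangular

section unipotent

variable {R : Type} [CommRing R]

theorem Tri.nsmul {E : ℕ} {σ : Equiv.Perm (ℕ → R)} (hσ : Tri E σ) (n : ℕ) (x : ℕ → R) :
    σ (n • x) = n • σ x :=
  map_nsmul (AddMonoidHom.mk' σ hσ.add) n x

/-- Triangular maps preserve congruence modulo an integer in the first coordinates. -/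
theorem Tri.dvd_of_dvd {E : ℕ} {σ : Equiv.Perm (ℕ → R)} (hσ : Tri E σ) (n d : ℕ) {x : ℕ → R}
    (hx : ∀ j ≤ d, (n : R) ∣ x j) : ∀ j ≤ d, (n : R) ∣ σ x j := by
  choose! y hy using hx
  have h1 : ∀ j < d + 1, (x - n • y) j = 0 := by
    intro j hj
    rw [Pi.sub_apply, Pi.smul_apply, nsmul_eq_mul, ← hy j (by omega), sub_self]
  obtain ⟨c, -, hc⟩ := hσ.diag (d + 1)
  intro j hj
  have h2 := (hc _ h1).1 j (by omega)
  rw [hσ.sub, hσ.nsmul, Pi.sub_apply, Pi.smul_apply, nsmul_eq_mul, sub_eq_zero] at h2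
  exact ⟨_, h2⟩

theorem exists_nat_max_dvd [Module.Free ℤ R] {X : Type*} (ψ : X → R) {x0 : X}
    (hx0 : ψ x0 ≠ 0) : ∃ g : ℕ, (∀ x, (g : R) ∣ ψ x) ∧
      ∀ h : ℕ, (∀ x, (h : R) ∣ ψ x) → h ≤ g := by
  classical
  let B := Module.Free.chooseBasis ℤ R
  obtain ⟨i, hi⟩ : ∃ i, B.repr (ψ x0) i ≠ 0 := by
    by_contra! h
    exact hx0 (B.repr.map_eq_zero_iff.1 (Finsupp.ext h))
  have hb : ∀ h : ℕ, (∀ x, (h : R) ∣ ψ x) → h ≤ (B.repr (ψ x0) i).natAbs := by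
    intro h hh
    obtain ⟨y, hy⟩ := hh x0
    rw [← nsmul_eq_mul] at hy
    have : B.repr (ψ x0) i = h * B.repr y i := by
      rw [hy, map_nsmul, Finsupp.smul_apply, nsmul_eq_mul]
    refine Nat.le_of_dvd (Int.natAbs_pos.2 hi) ?_
    rw [this, Int.natAbs_mul, Int.natAbs_natCast]
    exact dvd_mul_right _ _
  refine ⟨Nat.findGreatest (fun h => ∀ x, (h : R) ∣ ψ x) (B.repr (ψ x0) i).natAbs, ?_,
    fun h hh => Nat.le_findGreatest (hb h hh) hh⟩
  exact Nat.findGreatest_spec (P := fun h : ℕ => ∀ x, (h : R) ∣ ψ x) (m := 1)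
    (hb 1 (by simp)) (by simp)

theorem exists_quotient_orderOf [IsDomain R] [CharZero R] [Module.Free ℤ R] [Module.Finite ℤ R]
    {κ : Type} (a : κ → Equiv.Perm (ℕ → R)) {E : ℕ}
    (ha : ∀ w, Tri E (FreeGroup.lift a w)) (W : FreeGroup κ)
    (hW : FreeGroup.lift a W ^ E ≠ 1) {N : ℕ} (hN : 0 < N) :
    ∃ (Γ : Type) (_ : Group Γ) (_ : Finite Γ) (b : κ → Γ),
      (∀ i n, a i ^ n = 1 → b i ^ n = 1) ∧ orderOf (FreeGroup.lift b W ^ E) = N := by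
  classical
  set u := FreeGroup.lift a W ^ E with hu
  have hut : Tri E u := (ha W).pow E
  have hex : ∃ d, ∃ x, u x d ≠ x d := by
    by_contra! h
    exact hW (Equiv.ext fun x => funext fun d => h d x)
  set d := Nat.find hex with hd
  obtain ⟨x0, hx0⟩ := Nat.find_spec hex
  have hlow : ∀ j < d, ∀ x, u x j = x j := fun j hj x => by
    by_contra h
    exact Nat.find_min hex hj ⟨x, h⟩
  let ψ : (ℕ → R) → R := fun x => u x d - x d
  have hψ : ∀ x y, (∀ j < d, x j = y j) → ψ x = ψ y := by
    intro x y hxy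
    have := (ha W).pow_diag d (x := x - y) (fun j hj => sub_eq_zero.2 (hxy j hj))
    rw [← hu, hut.sub, Pi.sub_apply, Pi.sub_apply] at this
    simp only [ψ]
    linear_combination this
  have hpow : ∀ (m : ℕ) x, (∀ j < d, (u ^ m) x j = x j) ∧ (u ^ m) x d = x d + m * ψ x := by
    intro m x
    induction m with
    | zero => simp
    | succ m ih =>
      rw [pow_succ', Equiv.Perm.mul_apply]
      refine ⟨fun j hj => by rw [hlow j hj, ih.1 j hj], ?_⟩
      have h1 := hψ _ _ ih.1
      have h2 : u ((u ^ m) x) d = (u ^ m) x d + ψ ((u ^ m) x) := by simp [ψ]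
      rw [h2, h1, ih.2]
      push_cast
      ring
  obtain ⟨g, hg, hgmax⟩ := exists_nat_max_dvd ψ (x0 := x0) (sub_ne_zero.2 hx0)
  have hg0 : 0 < g := hgmax 1 (by simp)
  let I : Ideal R := Ideal.span {((g * N : ℕ) : R)}
  have hI : I ≠ ⊥ := by
    rw [Ne, Ideal.span_singleton_eq_bot]
    exact_mod_cast (Nat.mul_pos hg0 hN).ne'
  have : Finite (R ⧸ I) := Ideal.finiteQuotientOfFreeOfNeBot I hI
  let π : (ℕ → R) → (Fin (d + 1) → R ⧸ I) := fun x j => Ideal.Quotient.mk I (x j)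
  have hπ : Function.Surjective π := by
    intro y
    choose x hx using fun j => Ideal.Quotient.mk_surjective (y j)
    refine ⟨fun j => if h : j < d + 1 then x ⟨j, h⟩ else 0, funext fun j => ?_⟩
    simp [π, hx, Nat.lt_succ_iff.1 j.2]
  have hπe : ∀ x y, π x = π y ↔ ∀ j ≤ d, ((g * N : ℕ) : R) ∣ (x - y) j := by
    intro x y
    rw [funext_iff]
    simp only [π, Ideal.Quotient.eq, I, Ideal.mem_span_singleton]
    exact ⟨fun h j hj => h ⟨j, by omega⟩, fun h j => h j (by omega)⟩
  have hdesc : ∀ w x y, π x = π y → π (FreeGroup.lift a w x) = π (FreeGroup.lift a w y) := by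
    intro w x y h
    rw [hπe] at h ⊢
    rw [← (ha w).sub]
    exact (ha w).dvd_of_dvd _ _ h
  obtain ⟨b, hb1, hb2⟩ := exists_descended_action π hπ a fun i x y => by
    constructor
    · intro h
      simpa using hdesc (FreeGroup.of i) x y h
    · intro h
      have := hdesc (FreeGroup.of i)⁻¹ _ _ h
      rw [map_inv, FreeGroup.lift_apply_of] at this
      rwa [show (a i)⁻¹ (a i x) = x from (a i).symm_apply_apply x,
        show (a i)⁻¹ (a i y) = y from (a i).symm_apply_apply y] at this
  refine ⟨_, inferInstance, inferInstance, b, hb1, ?_⟩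
  have hiff : ∀ m : ℕ, (FreeGroup.lift b W ^ E) ^ m = 1 ↔
      ∀ x, ((g * N : ℕ) : R) ∣ m * ψ x := by
    intro m
    have h1 : ∀ x, ((FreeGroup.lift b W ^ E) ^ m) (π x) = π ((u ^ m) x) := by
      intro x
      rw [hu, ← map_pow, ← map_pow, ← map_pow, ← map_pow, hb2]
    constructor
    · intro h x
      have h2 := h1 x
      rw [h, Equiv.Perm.one_apply, eq_comm, hπe] at h2
      have h3 := h2 d le_rfl
      rwa [Pi.sub_apply, (hpow m x).2, add_sub_cancel_left] at h3
    · intro h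
      ext z : 1
      obtain ⟨x, rfl⟩ := hπ z
      rw [h1, Equiv.Perm.one_apply, hπe]
      intro j hj
      rcases hj.lt_or_eq with hj | rfl
      · rw [Pi.sub_apply, (hpow m x).1 j hj, sub_self]
        exact dvd_zero _
      · rw [Pi.sub_apply, (hpow m x).2, add_sub_cancel_left]
        exact h x
  refine Nat.dvd_antisymm (orderOf_dvd_of_pow_eq_one ((hiff N).2 fun x => ?_)) ?_
  · rw [Nat.cast_mul, mul_comm]
    exact mul_dvd_mul_left _ (hg x)
  · have h1 := (hiff _).1 (pow_orderOf_eq_one (FreeGroup.lift b W ^ E))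
    set m := orderOf (FreeGroup.lift b W ^ E)
    obtain ⟨q, hq⟩ := Nat.gcd_dvd_right m N
    have hh : 0 < m.gcd N := Nat.gcd_pos_of_pos_right _ hN
    have h2 : ∀ x, ((g * q : ℕ) : R) ∣ ψ x := by
      intro x
      have h3 : ((g * N : ℕ) : R) ∣ (m.gcd N : ℕ) * ψ x := by
        have h4 : ((m.gcd N : ℕ) : R) = m * (m.gcdA N : R) + N * (m.gcdB N : R) := by
          have := congrArg (Int.cast : ℤ → R) (Nat.gcd_eq_gcd_ab m N)
          push_cast at this
          exact_mod_cast this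
        rw [h4, add_mul]
        refine dvd_add ?_ ?_
        · rw [mul_right_comm]
          exact (h1 x).mul_right _
        · obtain ⟨y, hy⟩ := hg x
          rw [hy]
          exact ⟨m.gcdB N * y, by push_cast; ring⟩
      have hne : ((m.gcd N : ℕ) : R) ≠ 0 := by exact_mod_cast hh.ne'
      refine (mul_dvd_mul_iff_left hne).1 ?_
      refine dvd_trans (dvd_of_eq ?_) h3
      conv_rhs => rw [hq]
      push_cast
      ring
    have h5 := hgmax _ h2
    have h6 : q ≤ 1 := by
      by_contra h7
      have : g * 2 ≤ g * q := Nat.mul_le_mul_left g (by omega)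
      omega
    have h8 : q = 1 := by
      rcases Nat.le_one_iff_eq_zero_or_eq_one.1 h6 with h | h
      · rw [h, mul_zero] at hq
        omega
      · exact h
    rw [h8, mul_one] at hq
    rw [hq]
    exact Nat.gcd_dvd_left m N

end unipotent

theorem orderOf_eq_of_orderOf_pow {G : Type*} [Group G] [Finite G] {x : G} {E k : ℕ}
    (h : orderOf (x ^ E) = E * k) : orderOf x = E * E * k := by
  have h1 : E ∣ orderOf x :=
    (Dvd.intro _ h.symm).trans (orderOf_pow_dvd E)
  rw [orderOf_pow, Nat.gcd_eq_right h1] at h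
  rw [mul_assoc, ← h, Nat.mul_div_cancel' h1]

/-- There are finite quotients of the free product of cyclics in which `U` has order exactly `N`,
for all `N` divisible by some fixed integer. -/
def HasQuotients {κ : Type} (e : κ → ℕ) (U : FreeGroup κ) : Prop :=
  ∃ M, 0 < M ∧ ∀ N, 0 < N → M ∣ N → ∃ (Γ : Type) (_ : Group Γ) (_ : Finite Γ) (a : κ → Γ),
    (∀ i, a i ^ e i = 1) ∧ orderOf (FreeGroup.lift a U) = N

theorem exists_units_roots (E : ℕ) (hE : 0 < E) :
    ∃ (R : Type) (_ : CommRing R) (_ : IsDomain R) (_ : CharZero R) (_ : Module.Free ℤ R)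
      (_ : Module.Finite ℤ R) (ζ : Rˣ), IsPrimitiveRoot ζ E := by
  have : NeZero E := ⟨hE.ne'⟩
  have : IsCyclotomicExtension {E} ℚ (CyclotomicField E ℚ) :=
    CyclotomicField.isCyclotomicExtension E ℚ
  have h := (IsCyclotomicExtension.zeta_spec E ℚ (CyclotomicField E ℚ)).toInteger_isPrimitiveRoot
  exact ⟨NumberField.RingOfIntegers (CyclotomicField E ℚ), inferInstance, inferInstance,
    inferInstance, inferInstance, inferInstance, _, h.isUnit_unit hE.ne'⟩

theorem sylWord_hasQuotients {κ : Type} [Finite κ] (e : κ → ℕ) (s : ℤ → κ × ℤ) {L : ℕ}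
    (hL : 0 < L) (hper : ∀ t, s (t + L) = s t) (hadj : ∀ t, (s (t + 1)).1 ≠ (s t).1)
    (hne : ∀ t, ¬ (e (s t).1 : ℤ) ∣ (s t).2) : HasQuotients e (sylWord s L) := by
  classical
  have := Fintype.ofFinite κ
  -- a bound for the exponents
  have hmod : ∀ t, s t = s (t % L) := by
    intro t
    have h : ∀ k : ℤ, ∀ t, s (t + L * k) = s t := by
      intro k
      induction k with
      | zero => simp
      | succ k ih => intro t; rw [mul_add, mul_one, ← add_assoc, hper, ih]
      | pred k ih =>
        intro t
        rw [← hper (t + L * (-(k : ℤ) - 1)), ← ih t]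
        congr 1
        ring
    conv_lhs => rw [← Int.emod_add_mul_ediv t L]
    exact h _ _
  obtain ⟨C, hC⟩ : ∃ C : ℕ, ∀ t, (s t).2.natAbs < C := by
    refine ⟨∑ t ∈ Finset.range L, ((s t).2.natAbs + 1), fun t => ?_⟩
    have hL' : (L : ℤ) ≠ 0 := by exact_mod_cast hL.ne'
    obtain ⟨r, hr⟩ := Int.eq_ofNat_of_zero_le (Int.emod_nonneg t hL')
    have hr2 : r < L := by
      have := Int.emod_lt_of_pos t (b := (L : ℤ)) (by omega)
      omega
    rw [hmod t, hr]
    exact Nat.lt_of_succ_le (Finset.single_le_sum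
      (f := fun t : ℕ => (s t).2.natAbs + 1) (fun _ _ => Nat.zero_le _) (Finset.mem_range.2 hr2))
  have hC0 : 0 < C := (Nat.zero_le _).trans_lt (hC 0)
  let f : κ → ℕ := fun i => if e i = 0 then C else e i
  have hf : ∀ i, 0 < f i := fun i => by
    simp only [f]
    split_ifs <;> omega
  let E := ∏ i, f i
  have hE : 0 < E := Finset.prod_pos fun i _ => hf i
  have hfE : ∀ i, f i ∣ E := fun i => Finset.dvd_prod_of_mem f (Finset.mem_univ i)
  obtain ⟨R, _, _, _, _, _, ζ, hζ⟩ := exists_units_roots E hE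
  let z : κ → Rˣ := fun i => ζ ^ (E / f i)
  have hz : ∀ i, IsPrimitiveRoot (z i) (f i) := fun i =>
    hζ.pow hE (Nat.div_mul_cancel (hfE i)).symm
  have hzE : ∀ i, z i ^ E = 1 := fun i => by
    rw [(hz i).pow_eq_one_iff_dvd]
    exact hfE i
  have hzs : ∀ t, z (s t).1 ^ (s t).2 ≠ 1 := by
    intro t h
    rw [(hz _).zpow_eq_one_iff_dvd] at h
    simp only [f] at h
    split_ifs at h with h0
    · have h1 := Int.natAbs_dvd_natAbs.2 h
      rw [Int.natAbs_natCast] at h1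
      have h2 : (s t).2.natAbs = 0 := Nat.eq_zero_of_dvd_of_lt h1 (hC t)
      refine hne t ?_
      rw [Int.natAbs_eq_zero.1 h2]
      exact dvd_zero _
    · exact hne t h
  have hτ : ∀ j : ℕ, (s ((j + 1 : ℕ) : ℤ)).1 ≠ (s (j : ℤ)).1 := fun j => by
    rw [Nat.cast_succ]
    exact hadj j
  let a : κ → Equiv.Perm (ℕ → R) := fun i => triHom (τ := fun j : ℕ => (s j).1) hτ i (z i)
  have ha : ∀ w, Tri E (FreeGroup.lift a w) := lift_tri hτ hzE
  refine ⟨E * E, Nat.mul_pos hE hE, ?_⟩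
  rintro _ hN ⟨k, rfl⟩
  have hk : 0 < E * k := Nat.mul_pos hE (Nat.pos_of_mul_pos_left hN)
  obtain ⟨Γ, _, _, b, hb1, hb2⟩ := exists_quotient_orderOf a ha (sylWord s L) (by
    intro h
    have h1 := lift_sylWord_ne hτ hzs (E * L)
    rw [mul_comm, mul_comm, sylWord_mul hper, map_pow] at h1
    change ((FreeGroup.lift a (sylWord s L)) ^ E) _ _ ≠ 0 at h1
    rw [h, Equiv.Perm.one_apply, Pi.single_apply, if_neg (Nat.mul_pos hE hL).ne'] at h1
    exact h1 rfl) hk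
  refine ⟨Γ, inferInstance, inferInstance, b, fun i => ?_, orderOf_eq_of_orderOf_pow hb2⟩
  by_cases h0 : e i = 0
  · rw [h0, pow_zero]
  · refine hb1 i _ ?_
    have h1 : z i ^ e i = 1 := by
      have := (hz i).pow_eq_one
      simpa only [f, if_neg h0] using this
    simp only [a]
    rw [← map_pow, h1, map_one]

theorem hasQuotients {ι : Type} [Finite ι] (e : ι → ℕ) (U : FreeGroup ι)
    (hU : ¬ IsOfFinOrder (PresentedGroup.mk (cycRels e) U)) : HasQuotients e U := by
  obtain ⟨s, L, hL, hper, hadj, hne, hconj⟩ := exists_reduced_dbl e U hU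
  obtain ⟨M, hM, h⟩ := sylWord_hasQuotients (dblExp e) s hL hper hadj hne
  refine ⟨M, hM, fun N hN hMN => ?_⟩
  obtain ⟨Γ, _, _, a, ha, ho⟩ := h N hN hMN
  have hr : ∀ r ∈ cycRels (dblExp e), FreeGroup.lift a r = 1 := by
    rintro _ ⟨i, rfl⟩
    rw [map_pow, FreeGroup.lift_apply_of, ha]
  have h1 : IsConj (FreeGroup.lift a (sylWord s L)) (FreeGroup.lift a (dbl ι U)) :=
    (PresentedGroup.toGroup hr).map_isConj hconj
  refine ⟨Γ, inferInstance, inferInstance, fun i => a (i, true) * a (i, false), fun i => ?_, ?_⟩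
  · by_cases h0 : e i = 0
    · rw [h0, pow_zero]
    · have h2 := ha (i, false)
      simp only [dblExp, if_neg h0, pow_one] at h2
      simp only [h2, mul_one]
      exact ha (i, true)
  · rw [← lift_dbl, ← ho]
    obtain ⟨c, hc⟩ := isConj_iff.1 h1
    rw [← hc]
    exact (MulAut.conj c).orderOf_eq _

section conj

open Function

variable {Y Z : Type*} {σ : Equiv.Perm Y} {τ : Equiv.Perm Z}

/-- The pairs in `R` are matched compatibly with the actions of `σ` and `τ`. -/
def Matched (σ : Equiv.Perm Y) (τ : Equiv.Perm Z) (R : Set (Y × Z)) : Prop :=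
  ∀ a ∈ R, ∀ b ∈ R, ∀ k : ℤ, (σ ^ k) a.1 = b.1 ↔ (τ ^ k) a.2 = b.2

theorem zpow_apply_eq_self_iff (σ : Equiv.Perm Y) (y : Y) (k : ℤ) :
    (σ ^ k) y = y ↔ (minimalPeriod σ y : ℤ) ∣ k :=
  MulAction.zpow_smul_eq_iff_minimalPeriod_dvd (a := σ) (b := y)

theorem Matched.minimalPeriod_eq {R : Set (Y × Z)} (hR : Matched σ τ R) {a : Y × Z} (ha : a ∈ R) :
    minimalPeriod σ a.1 = minimalPeriod τ a.2 := by
  refine Nat.dvd_antisymm ?_ ?_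
  · rw [← Int.natCast_dvd_natCast, ← zpow_apply_eq_self_iff, hR a ha a ha,
      zpow_apply_eq_self_iff]
  · rw [← Int.natCast_dvd_natCast, ← zpow_apply_eq_self_iff, ← hR a ha a ha,
      zpow_apply_eq_self_iff]

theorem Matched.map_zpow {R : Set (Y × Z)} (hR : Matched σ τ R) (j : ℤ) :
    Matched σ τ (R ∪ (fun a : Y × Z => ((σ ^ j) a.1, (τ ^ j) a.2)) '' R) := by
  have h1 : ∀ (a : Y × Z) (j k : ℤ) b, ((σ ^ k) ((σ ^ j) a.1) = b ↔ (σ ^ (k + j)) a.1 = b) ∧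
      ∀ c, ((τ ^ k) ((τ ^ j) a.2) = c ↔ (τ ^ (k + j)) a.2 = c) := fun a j k b => by
    simp only [zpow_add, Equiv.Perm.mul_apply, implies_true, and_self]
  have h2 : ∀ (a b : Y × Z) (j k : ℤ), ((σ ^ k) a.1 = (σ ^ j) b.1 ↔ (σ ^ (k - j)) a.1 = b.1) ∧
      ((τ ^ k) a.2 = (τ ^ j) b.2 ↔ (τ ^ (k - j)) a.2 = b.2) := fun a b j k => by
    rw [sub_eq_neg_add, zpow_add, zpow_add, Equiv.Perm.mul_apply, Equiv.Perm.mul_apply, zpow_neg,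
      zpow_neg, Equiv.Perm.inv_eq_iff_eq, Equiv.Perm.inv_eq_iff_eq]
    exact ⟨eq_comm.trans eq_comm, eq_comm.trans eq_comm⟩
  rintro _ (ha | ⟨a, ha, rfl⟩) _ (hb | ⟨b, hb, rfl⟩) k
  · exact hR _ ha _ hb k
  · simp only [h2]
    exact hR _ ha _ hb _
  · rw [(h1 a j k _).1, (h1 a j k a.1).2]
    exact hR _ ha _ hb _
  · rw [(h1 a j k _).1, (h1 a j k a.1).2]
    simp only [h2]
    exact hR _ ha _ hb _

/-- Permutations with the same number of points of each period are conjugate, and the conjugation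
can be prescribed on matched pairs. -/
theorem exists_conj_extending [Finite Y] [Finite Z]
    (hc : ∀ l, Nat.card {y // minimalPeriod σ y = l} = Nat.card {z // minimalPeriod τ z = l})
    {R₀ : Set (Y × Z)} (hR₀ : Matched σ τ R₀) :
    ∃ θ : Y ≃ Z, (∀ y, θ (σ y) = τ (θ y)) ∧ ∀ a ∈ R₀, θ a.1 = a.2 := by
  classical
  obtain ⟨R, hR₀R, hR⟩ := (Set.toFinite {R | Matched σ τ R}).exists_le_maximal hR₀
  have hRm : Matched σ τ R := hR.prop
  have hmem : ∀ R', Matched σ τ R' → R ⊆ R' → R' ⊆ R := fun R' h1 h2 => hR.le_of_ge h1 h2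
  have hclosed : ∀ (j : ℤ), ∀ a ∈ R, ((σ ^ j) a.1, (τ ^ j) a.2) ∈ R := fun j a ha =>
    hmem _ (hRm.map_zpow j) Set.subset_union_left (Or.inr ⟨a, ha, rfl⟩)
  have huniq : ∀ a ∈ R, ∀ b ∈ R, a.1 = b.1 ↔ a.2 = b.2 := fun a ha b hb => by
    simpa using hRm a ha b hb 0
  have hdom : ∀ y, ∃ z, (y, z) ∈ R := by
    intro y
    by_contra! hy
    set l := minimalPeriod σ y with hl
    have hz : ∃ z, minimalPeriod τ z = l ∧ ∀ y, (y, z) ∉ R := by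
      by_contra! h
      choose g hg using h
      let G : {z // minimalPeriod τ z = l} → {y // minimalPeriod σ y = l} := fun z =>
        ⟨g z.1 z.2, (hRm.minimalPeriod_eq (hg z.1 z.2)).trans z.2⟩
      have hG : Injective G := fun z z' h =>
        Subtype.ext ((huniq _ (hg z.1 z.2) _ (hg z'.1 z'.2)).1 (congrArg Subtype.val h))
      have hG2 := (Nat.bijective_iff_injective_and_card G).2 ⟨hG, (hc l).symm⟩
      obtain ⟨z, hz⟩ := hG2.2 ⟨y, rfl⟩
      have h1 := hg z.1 z.2
      rw [show g z.1 z.2 = y from congrArg Subtype.val hz] at h1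
      exact hy _ h1
    obtain ⟨z, hzl, hz⟩ := hz
    refine hy z (hmem (insert (y, z) R) ?_ (Set.subset_insert _ _) (Set.mem_insert _ _))
    rintro a (rfl | ha) b (rfl | hb) k
    · simp only [zpow_apply_eq_self_iff, hzl, ← hl]
    · refine iff_of_false (fun h => ?_) (fun h => ?_)
      · have h1 := hclosed (-k) b hb
        rw [← h, zpow_neg, show (σ ^ k)⁻¹ ((σ ^ k) y) = y from (σ ^ k).symm_apply_apply y] at h1
        exact hy _ h1
      · have h1 := hclosed (-k) b hb
        rw [← h, zpow_neg, zpow_neg,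
          show (τ ^ k)⁻¹ ((τ ^ k) z) = z from (τ ^ k).symm_apply_apply z] at h1
        exact hz _ h1
    · refine iff_of_false (fun h => ?_) (fun h => ?_)
      · have h1 := hclosed k a ha
        rw [h] at h1
        exact hy _ h1
      · have h1 := hclosed k a ha
        rw [h] at h1
        exact hz _ h1
    · exact hRm a ha b hb k
  choose f hf using hdom
  have hinj : Injective f := fun y y' h => (huniq _ (hf y) _ (hf y')).2 h
  have hcard : Nat.card Y = Nat.card Z :=
    Nat.card_congr (Equiv.ofFiberEquiv (f := minimalPeriod σ) (g := minimalPeriod τ)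
      fun l => Classical.choice (by
        rw [← Finite.card_eq]
        exact hc l))
  have hbij := (Nat.bijective_iff_injective_and_card f).2 ⟨hinj, hcard⟩
  refine ⟨Equiv.ofBijective f hbij, fun y => ?_, fun a ha => ?_⟩
  · have h1 := hclosed 1 _ (hf y)
    rw [zpow_one, zpow_one] at h1
    exact (huniq _ (hf (σ y)) _ h1).1 rfl
  · exact (huniq _ (hf a.1) _ (hR₀R ha)).1 rfl

end conj

/-- A finite permutation representation of the group `⟨κ | i ^ e i⟩` in which `W ^ N` is trivial. -/
structure FinAct {κ : Type} (e : κ → ℕ) (W : FreeGroup κ) (N : ℕ) where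
  Y : Type
  fin : Finite Y
  act : κ → Equiv.Perm Y
  tors : ∀ i, act i ^ e i = 1
  per : FreeGroup.lift act W ^ N = 1

namespace FinAct

open Function

attribute [instance] FinAct.fin

variable {κ : Type} {e : κ → ℕ} {W : FreeGroup κ} {N : ℕ}

/-- The permutation induced by `W`. -/
def perm (A : FinAct e W N) : Equiv.Perm A.Y := FreeGroup.lift A.act W

/-- The number of points of period `l` under `W`. -/
noncomputable def cnt (A : FinAct e W N) (l : ℕ) : ℕ := Nat.card {y // minimalPeriod A.perm y = l}

theorem minimalPeriod_dvd (A : FinAct e W N) (y : A.Y) : minimalPeriod A.perm y ∣ N := by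
  rw [← Int.natCast_dvd_natCast, ← zpow_apply_eq_self_iff, zpow_natCast]
  have := A.per
  rw [perm, this, Equiv.Perm.one_apply]

theorem cnt_eq_zero (A : FinAct e W N) {l : ℕ} (hl : ¬ l ∣ N) : A.cnt l = 0 := by
  have : IsEmpty {y // minimalPeriod A.perm y = l} :=
    ⟨fun y => hl (y.2 ▸ A.minimalPeriod_dvd y.1)⟩
  exact Nat.card_of_isEmpty

/-- Permutations acting on copies of two sets. -/
def copiesHom (Y Z : Type) (m s : ℕ) :
    Equiv.Perm Y × Equiv.Perm Z →* Equiv.Perm (Y × Fin m ⊕ Z × Fin s) where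
  toFun p := Equiv.sumCongr (p.1.prodCongr (Equiv.refl _)) (p.2.prodCongr (Equiv.refl _))
  map_one' := by ext (x | x) <;> rfl
  map_mul' p q := by ext (x | x) <;> rfl

theorem lift_copiesHom {Y Z : Type} (m s : ℕ) (a : κ → Equiv.Perm Y) (b : κ → Equiv.Perm Z)
    (w : FreeGroup κ) : FreeGroup.lift (fun i => copiesHom Y Z m s (a i, b i)) w =
      copiesHom Y Z m s (FreeGroup.lift a w, FreeGroup.lift b w) := by
  change _ = ((copiesHom Y Z m s).comp ((FreeGroup.lift a).prod (FreeGroup.lift b))) w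
  congr 1
  ext i : 1
  simp

/-- The disjoint union of `m` copies of `A` and `s` copies of `B`. -/
def copies (A B : FinAct e W N) (m s : ℕ) : FinAct e W N where
  Y := A.Y × Fin m ⊕ B.Y × Fin s
  fin := inferInstance
  act i := copiesHom A.Y B.Y m s (A.act i, B.act i)
  tors i := by
    rw [← map_pow, Prod.pow_mk, A.tors, B.tors]
    exact map_one _
  per := by
    rw [lift_copiesHom, ← map_pow, Prod.pow_mk, A.per, B.per]
    exact map_one _

theorem copies_perm (A B : FinAct e W N) (m s : ℕ) :
    (A.copies B m s).perm = copiesHom A.Y B.Y m s (A.perm, B.perm) :=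
  lift_copiesHom m s A.act B.act W

theorem minimalPeriod_eq_of_injective {Y Z : Type*} {f : Y → Y} {g : Z → Z} {h : Y → Z}
    (hh : Injective h) (hs : Semiconj h f g) (y : Y) :
    minimalPeriod g (h y) = minimalPeriod f y := by
  rw [minimalPeriod_eq_minimalPeriod_iff]
  intro n
  rw [IsPeriodicPt, IsPeriodicPt, IsFixedPt, IsFixedPt, ← (hs.iterate_right n).eq, hh.eq_iff]

theorem cnt_copies (A B : FinAct e W N) (m s l : ℕ) :
    (A.copies B m s).cnt l = m * A.cnt l + s * B.cnt l := by
  have hl : ∀ (k : Fin m) (y : A.Y),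
      minimalPeriod (A.copies B m s).perm (Sum.inl (y, k)) = minimalPeriod A.perm y := fun k y =>
    minimalPeriod_eq_of_injective (h := fun y : A.Y => (Sum.inl (y, k) : (A.copies B m s).Y))
      (fun y y' h => by simpa using h) (fun y => by rw [copies_perm]; rfl) y
  have hr : ∀ (k : Fin s) (y : B.Y),
      minimalPeriod (A.copies B m s).perm (Sum.inr (y, k)) = minimalPeriod B.perm y := fun k y =>
    minimalPeriod_eq_of_injective (h := fun y : B.Y => (Sum.inr (y, k) : (A.copies B m s).Y))
      (fun y y' h => by simpa using h) (fun y => by rw [copies_perm]; rfl) y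
  let E : {y // minimalPeriod (A.copies B m s).perm y = l} ≃
      (Fin m × {y // minimalPeriod A.perm y = l}) ⊕ (Fin s × {y // minimalPeriod B.perm y = l}) :=
    { toFun := fun y => match y with
        | ⟨Sum.inl (y, k), h⟩ => Sum.inl (k, ⟨y, (hl k y).symm.trans h⟩)
        | ⟨Sum.inr (y, k), h⟩ => Sum.inr (k, ⟨y, (hr k y).symm.trans h⟩)
      invFun := fun y => match y with
        | Sum.inl (k, y) => ⟨Sum.inl (y.1, k), (hl k y.1).trans y.2⟩
        | Sum.inr (k, y) => ⟨Sum.inr (y.1, k), (hr k y.1).trans y.2⟩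
      left_inv := by rintro ⟨⟨y, k⟩ | ⟨y, k⟩, h⟩ <;> rfl
      right_inv := by rintro (⟨k, y⟩ | ⟨k, y⟩) <;> rfl }
  rw [cnt, Nat.card_congr E, Nat.card_sum, Nat.card_prod, Nat.card_prod, Nat.card_fin,
    Nat.card_fin]
  rfl

/-- An equivariant embedding into another action. -/
def Embeds (A B : FinAct e W N) : Prop :=
  ∃ h : A.Y → B.Y, Injective h ∧ ∀ i y, h (A.act i y) = B.act i (h y)

theorem Embeds.refl (A : FinAct e W N) : A.Embeds A := ⟨id, injective_id, fun _ _ => rfl⟩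

theorem Embeds.trans {A B C : FinAct e W N} (h : A.Embeds B) (h' : B.Embeds C) : A.Embeds C := by
  obtain ⟨f, hf, hf'⟩ := h
  obtain ⟨g, hg, hg'⟩ := h'
  exact ⟨g ∘ f, hg.comp hf, fun i y => by simp [hf', hg']⟩

theorem embeds_copies (A B : FinAct e W N) {m : ℕ} (hm : 0 < m) (s : ℕ) :
    A.Embeds (A.copies B m s) :=
  ⟨fun y => Sum.inl (y, ⟨0, hm⟩), fun _ _ h => congrArg Prod.fst (Sum.inl.inj h), fun _ _ => rfl⟩

/-- The action on the cosets of `⟨W ^ l⟩` in a finite quotient where `W` has order `N`. -/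
theorem exists_cnt_pos (hN : 0 < N) {Γ : Type} [Group Γ] [Finite Γ] (a : κ → Γ)
    (ha : ∀ i, a i ^ e i = 1) (ho : orderOf (FreeGroup.lift a W) = N) {l : ℕ} (hl : l ∣ N) :
    ∃ B : FinAct e W N, 0 < B.cnt l ∧ ∀ j < l, B.cnt j = 0 := by
  set u := FreeGroup.lift a W with hu
  let H := Subgroup.zpowers (u ^ l)
  have hlift : FreeGroup.lift (fun i => MulAction.toPermHom Γ (Γ ⧸ H) (a i)) W =
      MulAction.toPermHom Γ (Γ ⧸ H) u := by
    rw [hu, ← MonoidHom.comp_apply]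
    congr 1
    ext i : 1
    simp
  let B : FinAct e W N :=
    { Y := Γ ⧸ H
      fin := inferInstance
      act := fun i => MulAction.toPermHom Γ (Γ ⧸ H) (a i)
      tors := fun i => by rw [← map_pow, ha, map_one]
      per := by rw [hlift, ← map_pow, ← ho, pow_orderOf_eq_one, map_one] }
  have hl0 : 0 < l := Nat.pos_of_dvd_of_pos hl hN
  have hper : ∀ (g : Γ) (m : ℕ), (B.perm ^ (m : ℤ)) (g : Γ ⧸ H) = (g : Γ ⧸ H) ↔
      g⁻¹ * u ^ m * g ∈ H := by
    intro g m
    have h1 : B.perm = MulAction.toPermHom Γ (Γ ⧸ H) u := hlift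
    rw [h1, zpow_natCast, ← map_pow, MulAction.toPermHom_apply, MulAction.toPerm_apply,
      MulAction.Quotient.smul_coe, eq_comm, QuotientGroup.eq, smul_eq_mul, mul_assoc]
  have hdvd : ∀ (g : Γ) (m : ℕ), g⁻¹ * u ^ m * g ∈ H → l ∣ m := by
    intro g m h
    obtain ⟨k, hk⟩ := Subgroup.mem_zpowers_iff.1 h
    have h2 : (g⁻¹ * u ^ m * g) ^ (N / l) = 1 := by
      rw [← hk, ← zpow_natCast, zpow_comm, zpow_natCast, ← pow_mul, Nat.mul_div_cancel' hl,
        ← ho, pow_orderOf_eq_one, one_zpow]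
    have h3 : (g⁻¹ * u ^ m * g) ^ (N / l) = g⁻¹ * (u ^ m) ^ (N / l) * g := by
      have := conj_pow (i := N / l) (a := g⁻¹) (b := u ^ m)
      rwa [inv_inv] at this
    rw [h3, ← pow_mul] at h2
    have h4 : u ^ (m * (N / l)) = 1 := by
      have := congrArg (fun x => g * x * g⁻¹) h2
      simpa [mul_assoc] using this
    rw [← orderOf_dvd_iff_pow_eq_one, ho] at h4
    obtain ⟨q, hq⟩ := hl
    rw [hq, Nat.mul_div_cancel_left q hl0] at h4
    have hq0 : 0 < q := Nat.pos_of_ne_zero fun h => by rw [h, mul_zero] at hq; omega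
    exact Nat.dvd_of_mul_dvd_mul_right hq0 h4
  refine ⟨B, ?_, fun j hj => ?_⟩
  · have h1 : minimalPeriod B.perm ((1 : Γ) : Γ ⧸ H) = l := by
      refine Nat.dvd_antisymm ?_ (hdvd 1 _ ((hper 1 _).1
        ((zpow_apply_eq_self_iff _ _ _).2 dvd_rfl)))
      rw [← Int.natCast_dvd_natCast, ← zpow_apply_eq_self_iff, hper]
      rw [inv_one, one_mul, mul_one]
      exact Subgroup.mem_zpowers _
    have : Nonempty {y // minimalPeriod B.perm y = l} := ⟨⟨_, h1⟩⟩
    exact Nat.card_pos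
  · have : IsEmpty {y // minimalPeriod B.perm y = j} := by
      refine ⟨fun y => ?_⟩
      obtain ⟨y, hy⟩ := y
      obtain ⟨g, rfl⟩ := QuotientGroup.mk_surjective y
      have h1 := hdvd g _ ((hper g _).1 ((zpow_apply_eq_self_iff _ _ _).2 dvd_rfl))
      rw [hy] at h1
      have h2 : 0 < minimalPeriod B.perm ((g : Γ) : Γ ⧸ H) :=
        Nat.pos_of_dvd_of_pos (B.minimalPeriod_dvd _) hN
      exact absurd (Nat.le_of_dvd (hy ▸ h2) h1) (by omega)
    exact Nat.card_of_isEmpty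

/-- Two finite actions can be enlarged to have the same numbers of points of each period. -/
theorem exists_balanced {κ' : Type} {e' : κ' → ℕ} {W' : FreeGroup κ'} (hN : 0 < N)
    (h1 : ∀ l, l ∣ N → ∃ B : FinAct e W N, 0 < B.cnt l ∧ ∀ j < l, B.cnt j = 0)
    (h2 : ∀ l, l ∣ N → ∃ B : FinAct e' W' N, 0 < B.cnt l ∧ ∀ j < l, B.cnt j = 0)
    (A : FinAct e W N) (A' : FinAct e' W' N) :
    ∃ (B : FinAct e W N) (B' : FinAct e' W' N), A.Embeds B ∧ A'.Embeds B' ∧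
      ∀ l, B.cnt l = B'.cnt l := by
  suffices h : ∀ j, ∃ (B : FinAct e W N) (B' : FinAct e' W' N), A.Embeds B ∧ A'.Embeds B' ∧
      ∀ l < j, B.cnt l = B'.cnt l by
    obtain ⟨B, B', hB, hB', hc⟩ := h (N + 1)
    refine ⟨B, B', hB, hB', fun l => ?_⟩
    by_cases hl : l ∣ N
    · exact hc l (Nat.lt_succ_of_le (Nat.le_of_dvd hN hl))
    · rw [cnt_eq_zero _ hl, cnt_eq_zero _ hl]
  intro j
  induction j with
  | zero => exact ⟨A, A', Embeds.refl _, Embeds.refl _, fun l hl => absurd hl (by omega)⟩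
  | succ j ih =>
    obtain ⟨B, B', hB, hB', hc⟩ := ih
    by_cases hj : j ∣ N
    · obtain ⟨C, hC, hC0⟩ := h1 j hj
      obtain ⟨C', hC', hC0'⟩ := h2 j hj
      have hm := Nat.mul_pos hC hC'
      refine ⟨B.copies C (C.cnt j * C'.cnt j) (B'.cnt j * C'.cnt j),
        B'.copies C' (C.cnt j * C'.cnt j) (B.cnt j * C.cnt j),
        hB.trans (embeds_copies _ _ hm _), hB'.trans (embeds_copies _ _ hm _), fun l hl => ?_⟩
      rw [cnt_copies, cnt_copies]
      rcases (Nat.lt_succ_iff.1 hl).lt_or_eq with hl | rfl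
      · rw [hC0 l hl, hC0' l hl, hc l hl, mul_zero, mul_zero]
      · ring
    · refine ⟨B, B', hB, hB', fun l hl => ?_⟩
      rcases (Nat.lt_succ_iff.1 hl).lt_or_eq with hl | rfl
      · exact hc l hl
      · rw [cnt_eq_zero _ hj, cnt_eq_zero _ hj]

end FinAct

open Function in
theorem exists_pos_separating {X : Type*} (u : Equiv.Perm X) (x y : X) :
    ∃ q : ℕ, 0 < q ∧ ∀ k : ℤ, (q : ℤ) ∣ k → (u ^ k) x = y → x = y := by
  rcases Nat.eq_zero_or_pos (minimalPeriod u x) with h0 | h0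
  · by_cases h : ∃ k : ℤ, (u ^ k) x = y
    · obtain ⟨k, hk⟩ := h
      refine ⟨k.natAbs + 1, by omega, fun k' hq hk' => ?_⟩
      have h1 : (u ^ (k' - k)) x = x := by
        rw [sub_eq_neg_add, zpow_add, Equiv.Perm.mul_apply, zpow_neg, Equiv.Perm.inv_eq_iff_eq, hk,
          hk']
      rw [zpow_apply_eq_self_iff, h0, Nat.cast_zero, zero_dvd_iff, sub_eq_zero] at h1
      rw [h1, Int.natCast_dvd] at hq
      have h2 : k.natAbs = 0 := Nat.eq_zero_of_dvd_of_lt hq (by omega)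
      rw [Int.natAbs_eq_zero.1 h2] at hk
      exact hk
    · exact ⟨1, one_pos, fun k _ hk => absurd ⟨k, hk⟩ h⟩
  · refine ⟨_, h0, fun k hq hk => ?_⟩
    rwa [(zpow_apply_eq_self_iff u x k).2 hq] at hk

theorem exists_pos_separating_set {X : Type*} (u : Equiv.Perm X) {S : Set X} (hS : S.Finite) :
    ∃ q : ℕ, 0 < q ∧ ∀ x ∈ S, ∀ y ∈ S, ∀ k : ℤ, (q : ℤ) ∣ k → (u ^ k) x = y → x = y := by
  choose q hq0 hq using exists_pos_separating u
  refine ⟨∏ p ∈ hS.toFinset ×ˢ hS.toFinset, q p.1 p.2, Finset.prod_pos fun p _ => hq0 _ _,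
    fun x hx y hy k hk => hq x y k (dvd_trans ?_ hk)⟩
  rw [Int.natCast_dvd_natCast]
  exact Finset.dvd_prod_of_mem (fun p : X × X => q p.1 p.2) (a := (x, y)) (by simp [hx, hy])

/-- Compatibility with the generators on a large finite set gives compatibility with finitely many
words. -/
theorem exists_compat_words {κ X : Type*} (α : κ → Equiv.Perm X) {S : Set X} (hS : S.Finite)
    {H : Set (FreeGroup κ)} (hH : H.Finite) :
    ∃ S' : Set X, S'.Finite ∧ S ⊆ S' ∧ (∀ h ∈ H, ∀ x ∈ S, FreeGroup.lift α h x ∈ S') ∧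
      ∀ {Y : Type} (β : κ → Equiv.Perm Y) (f : X → Y),
        (∀ i, ∀ x ∈ S', α i x ∈ S' → f (α i x) = β i (f x)) →
        ∀ h ∈ H, ∀ x ∈ S, f (FreeGroup.lift α h x) = FreeGroup.lift β h (f x) := by
  choose T h1 h2 h3 h4 using fun h => exists_compat_word α h S hS
  refine ⟨S ∪ ⋃ h ∈ H, T h, hS.union (hH.biUnion fun h _ => h1 h), Set.subset_union_left,
    fun h hh x hx => Or.inr (Set.mem_biUnion hh (h3 h x hx)), fun β f hf h hh x hx => ?_⟩
  exact h4 h β f (fun i x hx hx' => hf i x (Or.inr (Set.mem_biUnion hh hx))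
    (Or.inr (Set.mem_biUnion hh hx'))) x hx

open Function in
/-- A finite model of an action together with the finite quotients needed to adjust its orbit
counts. -/
theorem exists_finAct {κ : Type} {e : κ → ℕ} {U : FreeGroup κ} (hm : HasModels e U)
    (hq : HasQuotients e U) {X : Type} (α : κ → Equiv.Perm X) (hα : ∀ i, α i ^ e i = 1)
    {S : Set X} (hS : S.Finite) (hSn : S.Nonempty) :
    ∃ M : ℕ, 0 < M ∧ ∀ N₀ : ℕ, 0 < N₀ → M ∣ N₀ → ∃ N₁ : ℕ, 0 < N₁ ∧ ∀ N, 0 < N → N₁ ∣ N →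
      (∀ l, l ∣ N → ∃ B : FinAct e U N, 0 < B.cnt l ∧ ∀ j < l, B.cnt j = 0) ∧
      ∃ (A : FinAct e U N) (f : X → A.Y),
        (∀ i, ∀ x ∈ S, α i x ∈ S → f (α i x) = A.act i (f x)) ∧
        (∀ x ∈ S, (A.perm ^ N₀) (f x) = f x) ∧
        (∀ x ∈ S, ∀ y ∈ S, ∀ k : ℤ, (A.perm ^ k) (f x) = f y →
          ∃ k', k' ≡ k [ZMOD N₀] ∧ (FreeGroup.lift α U ^ k') x = y) ∧
        (∀ x ∈ S, ∀ y ∈ S, ∀ k : ℤ, (FreeGroup.lift α U ^ k) x = y →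
          (A.perm ^ k) (f x) = f y) ∧ Set.InjOn f S := by
  classical
  set u := FreeGroup.lift α U with hu
  have hK : ∀ x y, ∃ k : ℤ, (∃ k : ℤ, (u ^ k) x = y) → (u ^ k) x = y := fun x y => by
    by_cases h : ∃ k : ℤ, (u ^ k) x = y
    · exact ⟨h.choose, fun _ => h.choose_spec⟩
    · exact ⟨0, fun h' => absurd h' h⟩
  choose K hK using hK
  let H : Set (FreeGroup κ) := (fun p : X × X => U ^ K p.1 p.2) '' (S ×ˢ S) ∪
    (fun x => U ^ (minimalPeriod u x)) '' S
  have hH : H.Finite := ((hS.prod hS).image _).union (hS.image _)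
  obtain ⟨S', hS', hSS', -, hcw⟩ := exists_compat_words α hS hH
  obtain ⟨M, hM, hmod⟩ := hm X α hα S' hS' (hSn.mono hSS')
  obtain ⟨q, hq0, hqs⟩ := exists_pos_separating_set u hS
  obtain ⟨M', hM', hquot⟩ := hq
  refine ⟨M * q, Nat.mul_pos hM hq0, fun N₀ hN₀ hMN₀ => ?_⟩
  obtain ⟨Y, _, β, f, hf⟩ := hmod N₀ hN₀ ((dvd_mul_right _ _).trans hMN₀)
  refine ⟨M' * orderOf (FreeGroup.lift β U), Nat.mul_pos hM' (orderOf_pos _),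
    fun N hN hN₁ => ⟨fun l hl => ?_, ?_⟩⟩
  · obtain ⟨Γ, _, _, a, ha, ho⟩ := hquot N hN ((dvd_mul_right _ _).trans hN₁)
    exact FinAct.exists_cnt_pos hN a ha ho hl
  · let A : FinAct e U N :=
      { Y := Y
        fin := inferInstance
        act := β
        tors := hf.tors
        per := orderOf_dvd_iff_pow_eq_one.1 ((dvd_mul_left _ _).trans hN₁) }
    refine ⟨A, f, fun i x hx hx' => hf.compat i x (hSS' hx) (hSS' hx'),
      fun x hx => hf.per x (hSS' hx), fun x hx y hy => hf.sep x (hSS' hx) y (hSS' hy),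
      fun x hx y hy k hk => ?_, fun x hx y hy hxy => ?_⟩
    · have h1 := hK x y ⟨k, hk⟩
      have h2 := hcw β f hf.compat _ (Or.inl ⟨(x, y), ⟨hx, hy⟩, rfl⟩) x hx
      have h3 := hcw β f hf.compat _ (Or.inr ⟨x, hx, rfl⟩) x hx
      rw [map_zpow, map_zpow, ← hu, h1] at h2
      rw [map_pow, map_pow, ← hu, ← zpow_natCast, ← zpow_natCast,
        (zpow_apply_eq_self_iff u x _).2 dvd_rfl] at h3
      have h4 : (u ^ (k - K x y)) x = x := by
        rw [sub_eq_neg_add, zpow_add, Equiv.Perm.mul_apply, zpow_neg, Equiv.Perm.inv_eq_iff_eq, h1,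
          hk]
      rw [zpow_apply_eq_self_iff] at h4
      have h5 : (A.perm ^ (k - K x y)) (f x) = f x :=
        (zpow_apply_eq_self_iff _ _ _).2
          (dvd_trans ((zpow_apply_eq_self_iff _ _ _).1 h3.symm) h4)
      rw [← add_sub_cancel (K x y) k, zpow_add, Equiv.Perm.mul_apply, h5]
      exact h2.symm
    · obtain ⟨k, hk, hk'⟩ := hf.sep x (hSS' hx) y (hSS' hy) 0 (by rw [zpow_zero]; exact hxy)
      refine hqs x hx y hy k ?_ hk'
      refine dvd_trans ?_ (Int.modEq_zero_iff_dvd.1 hk)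
      exact_mod_cast (dvd_mul_left _ _).trans hMN₀

open Classical in
/-- The function equal to `1` outside `P`. -/
noncomputable def restr {κ A : Type*} [One A] (P : κ → Prop) (a : κ → A) (i : κ) : A :=
  if P i then a i else 1

theorem lift_congr_toWord {κ G : Type*} [DecidableEq κ] [Group G] {a b : κ → G} (U : FreeGroup κ)
    (h : ∀ x ∈ U.toWord, a x.1 = b x.1) : FreeGroup.lift a U = FreeGroup.lift b U := by
  rw [← FreeGroup.mk_toWord (x := U), FreeGroup.lift_mk, FreeGroup.lift_mk]
  congr 1
  refine List.map_congr_left fun x hx => ?_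
  rw [h x hx]

theorem lift_restr {κ G : Type*} [DecidableEq κ] [Group G] {P : κ → Prop} (a : κ → G)
    {U : FreeGroup κ} (h : ∀ x ∈ U.toWord, P x.1) :
    FreeGroup.lift (restr P a) U = FreeGroup.lift a U :=
  lift_congr_toWord U fun x hx => if_pos (h x hx)

theorem restr_pow {κ G : Type*} [Group G] {P : κ → Prop} {a : κ → G} {e : κ → ℕ}
    (ha : ∀ i, a i ^ e i = 1) (i : κ) : restr P a i ^ restr P e i = 1 := by
  by_cases h : P i
  · simp only [restr, if_pos h, ha]
  · simp only [restr, if_neg h, one_pow]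

theorem Matched.image {Y Z Y' Z' : Type*} {σ : Equiv.Perm Y} {τ : Equiv.Perm Z}
    {σ' : Equiv.Perm Y'} {τ' : Equiv.Perm Z'} {h : Y → Y'} {h' : Z → Z'}
    (hi : Function.Injective h) (hi' : Function.Injective h')
    (hs : ∀ (k : ℤ) y, h ((σ ^ k) y) = (σ' ^ k) (h y))
    (hs' : ∀ (k : ℤ) z, h' ((τ ^ k) z) = (τ' ^ k) (h' z)) {R : Set (Y × Z)}
    (hR : Matched σ τ R) : Matched σ' τ' (Set.image (Prod.map h h') R) := by
  rintro _ ⟨a, ha, rfl⟩ _ ⟨b, hb, rfl⟩ k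
  simp only [Prod.map_fst, Prod.map_snd, ← hs, ← hs', hi.eq_iff, hi'.eq_iff]
  exact hR a ha b hb k

theorem lift_semiconj {κ Y Z : Type*} {a : κ → Equiv.Perm Y} {b : κ → Equiv.Perm Z} {h : Y → Z}
    (hh : ∀ i y, h (a i y) = b i (h y)) (w : FreeGroup κ) (y : Y) :
    h (FreeGroup.lift a w y) = FreeGroup.lift b w (h y) := by
  induction w using FreeGroup.induction_on generalizing y with
  | C1 => simp
  | of i => simpa using hh i y
  | inv_of i _ =>
    rw [map_inv, map_inv, Equiv.Perm.eq_inv_iff_eq, FreeGroup.lift_apply_of,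
      FreeGroup.lift_apply_of, ← hh, show a i ((a i)⁻¹ y) = y from (a i).apply_symm_apply y]
  | mul u v hu hv => rw [map_mul, map_mul, Equiv.Perm.mul_apply, Equiv.Perm.mul_apply, hu, hv]

theorem minimalPeriod_inv_perm {Y : Type*} (σ : Equiv.Perm Y) (y : Y) :
    Function.minimalPeriod (σ⁻¹ : Equiv.Perm Y) y = Function.minimalPeriod σ y := by
  have h : ∀ k : ℤ, (σ⁻¹ ^ k) y = y ↔ (σ ^ k) y = y := fun k => by
    rw [inv_zpow, Equiv.Perm.inv_eq_iff_eq, eq_comm]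
  refine Nat.dvd_antisymm ?_ ?_
  · rw [← Int.natCast_dvd_natCast, ← zpow_apply_eq_self_iff, h, zpow_apply_eq_self_iff]
  · rw [← Int.natCast_dvd_natCast, ← zpow_apply_eq_self_iff, ← h, zpow_apply_eq_self_iff]

theorem zpow_apply_eq_of_modEq {Y : Type*} {σ : Equiv.Perm Y} {y : Y} {N : ℕ}
    (h : (σ ^ N) y = y) {j k : ℤ} (hjk : j ≡ k [ZMOD N]) : (σ ^ j) y = (σ ^ k) y := by
  rw [← zpow_natCast, zpow_apply_eq_self_iff] at h
  have h1 : (σ ^ (k - j)) y = y := (zpow_apply_eq_self_iff _ _ _).2 (h.trans hjk.dvd)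
  rw [← add_sub_cancel j k, zpow_add, Equiv.Perm.mul_apply, h1]

/-- Finite models for actions of an amalgamated product of two free products of cyclics along the
cyclic subgroups generated by `U` and `V`. -/
theorem exists_finite_action {κ : Type} [DecidableEq κ] (P : κ → Prop) (e : κ → ℕ)
    {U V : FreeGroup κ} (hU : ∀ x ∈ U.toWord, P x.1) (hV : ∀ x ∈ V.toWord, ¬ P x.1)
    (mU : HasModels (restr P e) U) (qU : HasQuotients (restr P e) U)
    (mV : HasModels (restr (fun i => ¬ P i) e) V) (qV : HasQuotients (restr (fun i => ¬ P i) e) V)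
    {X : Type} (α : κ → Equiv.Perm X) (hα : ∀ i, α i ^ e i = 1)
    (hUV : FreeGroup.lift α U * FreeGroup.lift α V = 1) {S : Set X} (hS : S.Finite)
    (hSn : S.Nonempty) :
    ∃ (Y : Type) (_ : Finite Y) (β : κ → Equiv.Perm Y) (f : X → Y), (∀ i, β i ^ e i = 1) ∧
      FreeGroup.lift β U * FreeGroup.lift β V = 1 ∧
      (∀ i, ∀ x ∈ S, α i x ∈ S → f (α i x) = β i (f x)) ∧ Set.InjOn f S := by
  classical
  set u := FreeGroup.lift α U with hu
  have hv : FreeGroup.lift α V = u⁻¹ := eq_inv_of_mul_eq_one_right hUV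
  obtain ⟨M₁, hM₁, h1⟩ := exists_finAct mU qU (restr P α) (restr_pow hα) hS hSn
  obtain ⟨M₂, hM₂, h2⟩ := exists_finAct mV qV (restr (fun i => ¬ P i) α) (restr_pow hα) hS hSn
  rw [lift_restr α hU] at h1
  rw [lift_restr α hV] at h2
  have hN₀ := Nat.mul_pos hM₁ hM₂
  set N₀ := M₁ * M₂
  obtain ⟨N₁, hN₁, h1⟩ := h1 N₀ hN₀ (dvd_mul_right _ _)
  obtain ⟨N₂, hN₂, h2⟩ := h2 N₀ hN₀ (dvd_mul_left _ _)
  have hN := Nat.mul_pos hN₁ hN₂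
  set N := N₁ * N₂
  obtain ⟨b1, A₁, f₁, hc1, hp1, hs1, hr1, hi1⟩ := h1 N hN (dvd_mul_right _ _)
  obtain ⟨b2, A₂, f₂, hc2, hp2, hs2, hr2, hi2⟩ := h2 N hN (dvd_mul_left _ _)
  obtain ⟨B₁, B₂, ⟨g₁, hg₁, hg₁'⟩, ⟨g₂, hg₂, hg₂'⟩, hcnt⟩ :=
    FinAct.exists_balanced hN b1 b2 A₁ A₂
  have hR : Matched A₁.perm A₂.perm⁻¹ ((fun x => (f₁ x, f₂ x)) '' S) := by
    rintro _ ⟨x, hx, rfl⟩ _ ⟨y, hy, rfl⟩ k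
    rw [inv_zpow, ← zpow_neg]
    dsimp only
    constructor
    · intro h
      obtain ⟨k', hk, hk'⟩ := hs1 x hx y hy k h
      rw [← hr2 x hx y hy (-k') (by rw [hv, inv_zpow, zpow_neg, inv_inv]; exact hk')]
      exact zpow_apply_eq_of_modEq (hp2 x hx) hk.symm.neg
    · intro h
      obtain ⟨k', hk, hk'⟩ := hs2 x hx y hy (-k) h
      rw [hv, inv_zpow, ← zpow_neg] at hk'
      rw [← hr1 x hx y hy (-k') hk']
      refine zpow_apply_eq_of_modEq (hp1 x hx) ?_
      have := hk.symm.neg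
      rwa [neg_neg] at this
  have hR' : Matched B₁.perm B₂.perm⁻¹ (Prod.map g₁ g₂ '' ((fun x => (f₁ x, f₂ x)) '' S)) := by
    refine hR.image hg₁ hg₂ (fun k y => ?_) (fun k y => ?_)
    · rw [FinAct.perm, FinAct.perm, ← map_zpow, ← map_zpow]
      exact lift_semiconj hg₁' _ y
    · rw [FinAct.perm, FinAct.perm, ← map_inv, ← map_inv, ← map_zpow, ← map_zpow]
      exact lift_semiconj hg₂' _ y
  obtain ⟨θ, hθ, hθR⟩ := exists_conj_extending (σ := B₁.perm) (τ := B₂.perm⁻¹) (fun l => by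
    simp only [minimalPeriod_inv_perm]
    exact hcnt l) hR'
  let c : κ → Equiv.Perm B₁.Y := fun i => θ.symm.permCongrHom (B₂.act i)
  have hcV : FreeGroup.lift c V = B₁.perm⁻¹ := by
    have h3 : FreeGroup.lift c V = θ.symm.permCongrHom (FreeGroup.lift B₂.act V) := by
      change _ = (θ.symm.permCongrHom.toMonoidHom.comp (FreeGroup.lift B₂.act)) V
      congr 1
      ext i : 1
      simp [c]
    rw [h3, eq_comm, inv_eq_iff_eq_inv, ← map_inv]
    ext y
    have h4 := hθ y
    rw [FinAct.perm] at h4 ⊢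
    change _ = θ.symm ((FreeGroup.lift B₂.act V)⁻¹ (θ y))
    rw [Equiv.eq_symm_apply]
    exact h4
  let β : κ → Equiv.Perm B₁.Y := fun i => if P i then B₁.act i else c i
  have hβU : FreeGroup.lift β U = B₁.perm :=
    lift_congr_toWord U fun x hx => if_pos (hU x hx)
  have hβV : FreeGroup.lift β V = B₁.perm⁻¹ := by
    rw [← hcV]
    exact lift_congr_toWord V fun x hx => if_neg (hV x hx)
  have hfR : ∀ x ∈ S, θ (g₁ (f₁ x)) = g₂ (f₂ x) := fun x hx =>
    hθR _ ⟨_, ⟨x, hx, rfl⟩, rfl⟩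
  refine ⟨B₁.Y, inferInstance, β, fun x => g₁ (f₁ x), fun i => ?_, ?_, fun i x hx hx' => ?_,
    fun x hx y hy h => hi1 hx hy (hg₁ h)⟩
  · by_cases hi : P i
    · have := B₁.tors i
      simp only [restr, if_pos hi] at this
      simp only [β, if_pos hi, this]
    · have := B₂.tors i
      simp only [restr, hi, not_false_eq_true, if_true] at this
      simp only [β, if_neg hi, c, ← map_pow, this, map_one]
  · rw [hβU, hβV, mul_inv_cancel]
  · by_cases hi : P i
    · have := hc1 i x hx
      simp only [restr, if_pos hi] at this
      simp only [β, if_pos hi, this hx', hg₁']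
    · have := hc2 i x hx
      simp only [restr, hi, not_false_eq_true, if_true] at this
      simp only [β, if_neg hi, c]
      change _ = θ.symm (B₂.act i (θ (g₁ (f₁ x))))
      rw [hfR x hx, Equiv.eq_symm_apply, hfR _ hx', this hx', hg₂']

theorem finiteIndex_comap {G H : Type*} [Group G] [Group H] (φ : G →* H) (K : Subgroup H)
    [K.FiniteIndex] : (K.comap φ).FiniteIndex :=
  ⟨by rw [Subgroup.index_comap]
      exact fun h => K.index_ne_zero_of_finite (K.index_eq_zero_of_relIndex_eq_zero h)⟩

theorem exists_finiteIndex_presentedGroup {κ : Type} [Finite κ] [DecidableEq κ] (P : κ → Prop)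
    (e : κ → ℕ) {U V : FreeGroup κ} (hU : ∀ x ∈ U.toWord, P x.1) (hV : ∀ x ∈ V.toWord, ¬ P x.1)
    (oU : ¬ IsOfFinOrder (PresentedGroup.mk (cycRels (restr P e)) U))
    (oV : ¬ IsOfFinOrder (PresentedGroup.mk (cycRels (restr (fun i => ¬ P i) e)) V))
    {R : Set (FreeGroup κ)} (hR : R = cycRels e ∪ {U * V})
    (K : Subgroup (PresentedGroup R)) (hK : K.FG) (g : PresentedGroup R) (hg : g ∉ K) :
    ∃ K' : Subgroup (PresentedGroup R), K'.FiniteIndex ∧ K ≤ K' ∧ g ∉ K' := by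
  obtain ⟨T, rfl⟩ := hK
  set K := Subgroup.closure (T : Set (PresentedGroup R)) with hKdef
  let X := PresentedGroup R ⧸ K
  let α : κ → Equiv.Perm X := fun i =>
    MulAction.toPermHom (PresentedGroup R) X (PresentedGroup.of i)
  have hα : ∀ w, FreeGroup.lift α w =
      MulAction.toPermHom (PresentedGroup R) X (PresentedGroup.mk R w) := by
    intro w
    rw [mk_eq_lift, ← MonoidHom.comp_apply]
    congr 1
    ext1 i
    simp [α]
  have hrel : ∀ r ∈ R, FreeGroup.lift α r = 1 := by
    intro r hr
    rw [hα, PresentedGroup.mk_eq_one_iff.2 (Subgroup.subset_normalClosure hr), map_one]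
  have htor : ∀ i, α i ^ e i = 1 := by
    intro i
    simpa using hrel (FreeGroup.of i ^ e i) (hR ▸ Or.inl ⟨i, rfl⟩)
  have hUV : FreeGroup.lift α U * FreeGroup.lift α V = 1 := by
    simpa using hrel (U * V) (hR ▸ Or.inr rfl)
  let s : PresentedGroup R → FreeGroup κ := Function.surjInv (PresentedGroup.mk_surjective R)
  have hs : ∀ x, PresentedGroup.mk R (s x) = x := Function.surjInv_eq _
  let x₀ : X := (1 : PresentedGroup R)
  have hx₀ : ∀ x, FreeGroup.lift α (s x) x₀ = (x : X) := by
    intro x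
    rw [hα, hs, MulAction.toPermHom_apply, MulAction.toPerm_apply]
    change ((x * 1 : PresentedGroup R) : X) = _
    rw [mul_one]
  obtain ⟨S, hS, hxS, hHS, hf⟩ := exists_compat_words α (Set.finite_singleton x₀)
    (((T.finite_toSet.insert g)).image s)
  have hxS : x₀ ∈ S := hxS rfl
  obtain ⟨Y, _, β, f, hβ, hβUV, hcomp, hinj⟩ := exists_finite_action P e hU hV
    (hasModels _ _ oU) (hasQuotients _ _ oU) (hasModels _ _ oV) (hasQuotients _ _ oV)
    α htor hUV hS ⟨x₀, hxS⟩
  have hβR : ∀ r ∈ R, FreeGroup.lift β r = 1 := by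
    rw [hR]
    rintro r (⟨i, rfl⟩ | rfl)
    · simp [hβ]
    · simpa using hβUV
  let φ : PresentedGroup R →* Equiv.Perm Y := PresentedGroup.toGroup hβR
  have hφ : ∀ x, φ x = FreeGroup.lift β (s x) := by
    intro x
    conv_lhs => rw [← hs x]
    rfl
  have hφf : ∀ x ∈ insert g (T : Set (PresentedGroup R)), φ x (f x₀) = f (x : X) := by
    intro x hx
    rw [hφ, ← hf β f hcomp _ ⟨x, hx, rfl⟩ x₀ rfl, hx₀]
  refine ⟨(MulAction.stabilizer (Equiv.Perm Y) (f x₀)).comap φ, ?_, ?_, ?_⟩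
  · exact finiteIndex_comap φ _
  · rw [hKdef, Subgroup.closure_le]
    intro x hx
    change φ x (f x₀) = f x₀
    rw [hφf x (Or.inr hx)]
    congr 1
    exact QuotientGroup.eq.2 (by simpa using Subgroup.subset_closure hx)
  · intro h
    change φ g (f x₀) = f x₀ at h
    rw [hφf g (Or.inl rfl)] at h
    have hgS : (g : X) ∈ S := by
      rw [← hx₀]
      exact hHS _ ⟨g, Or.inl rfl, rfl⟩ x₀ rfl
    have := QuotientGroup.eq.1 (hinj hgS hxS h)
    exact hg (by simpa using this)

theorem not_isOfFinOrder_cycRels {κ : Type*} {P : κ → Prop} {e : κ → ℕ} {U : FreeGroup κ}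
    {R : Set (FreeGroup κ)} (h1 : ∀ i, P i → FreeGroup.of i ^ e i ∈ R)
    (h2 : ∀ i, ¬ P i → FreeGroup.of i ∈ R) (hU : ¬ IsOfFinOrder (PresentedGroup.mk R U)) :
    ¬ IsOfFinOrder (PresentedGroup.mk (cycRels (restr P e)) U) := by
  have hr : ∀ r ∈ cycRels (restr P e),
      FreeGroup.lift (fun i => PresentedGroup.of (rels := R) i) r = 1 := by
    rintro _ ⟨i, rfl⟩
    rw [← mk_eq_lift]
    refine PresentedGroup.mk_eq_one_iff.2 (Subgroup.subset_normalClosure ?_)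
    by_cases hi : P i
    · simpa [restr, hi] using h1 i hi
    · simpa [restr, hi] using h2 i hi
  intro h
  apply hU
  have := (PresentedGroup.toGroup hr).isOfFinOrder h
  rwa [mk_eq_lift]

/-- Every group of F-type is subgroup separable (LERF): for every finitely
generated subgroup `K` and every `g ∉ K` there is a finite-index subgroup containing `K` but
not `g`. -/
theorem fType_subgroup_separable (G : Type*) [Group G] (hG : IsFTypeGroup G)
    (K : Subgroup G) (hK : K.FG) (g : G) (hg : g ∉ K) :
    ∃ K' : Subgroup G, K'.FiniteIndex ∧ K ≤ K' ∧ g ∉ K' := by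
  obtain ⟨D, ⟨-, -, -, -, hU, hV, -, -, oU, oV, -, -⟩, ⟨E⟩⟩ := hG
  have hR : D.rels = cycRels D.e ∪ {D.U * D.V} := by
    ext w
    simp only [FTypeBase.rels, cycRels, Set.mem_union, Set.mem_range, Set.mem_ofPred_eq, eq_comm]
  have hK' : (K.map E.toMonoidHom).FG := by
    rw [Subgroup.fg_iff_submonoid_fg] at hK ⊢
    exact hK.map E.toMonoidHom
  obtain ⟨K', hfin, hle, hgK⟩ := exists_finiteIndex_presentedGroup
    (fun i : Fin D.n => (i : ℕ) < D.p) D.e hU (fun x hx => not_lt.2 (hV x hx))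
    (not_isOfFinOrder_cycRels (R := D.rels1) (fun i hi => Or.inl ⟨i, hi, rfl⟩)
      (fun i hi => Or.inr ⟨i, not_lt.1 hi, rfl⟩) oU)
    (not_isOfFinOrder_cycRels (R := D.rels2) (fun i hi => Or.inl ⟨i, not_lt.1 hi, rfl⟩)
      (fun i hi => Or.inr ⟨i, not_not.1 hi, rfl⟩) oV)
    hR (K.map E.toMonoidHom) hK' (E g) (by simpa using hg)
  exact ⟨K'.comap E.toMonoidHom, finiteIndex_comap _ _, Subgroup.map_le_iff_le_comap.1 hle, hgK⟩

end FPaper
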